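/- Let Ω ⊂ ℝⁿ be a bounded Lipschitz domain (not necessarily simply connected), let f ∈ C²([0,∞)) be strictly convex with f(0) = f'(0) = 0, satisfying the linear growth condition νt − L ≤ f(t) ≤ L(t+1) and the bound f''(t) ≤ L(1+t)⁻¹ for all t ≥ 0, and let T₀ ∈ W^{2,∞}(Ω;ℝ^{N×n}) satisfy ‖T₀‖_{L^∞(Ω;ℝ^{N×n})} < f^∞(1). Let u_k ∈ W^{1,2}(Ω;ℝ^N) be the minimisers of 𝔉_k with (u_k)_Ω = 0, and let E ∈ L¹(Ω;ℝ^{N×n}) be the ℒⁿ-a.e. pointwise limit of (a subsequence of) the gradients ∇u_k. Then E is curl-free in the sense of distributions on Ω; if moreover Ω is simply connected, there exists v ∈ W^{1,1}(Ω;ℝ^N) with ∇v = E ℒⁿ-almost everywhere in Ω. -/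

import Mathlib

open MeasureTheory Filter Topology Set
open scoped ENNReal RealInnerProductSpace

noncomputable section

/-- Euclidean space `ℝⁿ`. -/
abbrev EVec (n : ℕ) := EuclideanSpace ℝ (Fin n)

/-- Frobenius inner product of two "matrices". -/
def mdot {ι κ : Type*} [Fintype ι] [Fintype κ] (A B : ι → κ → ℝ) : ℝ :=
  ∑ a, ∑ i, A a i * B a i

/-- Frobenius norm. -/
noncomputable def mnorm {ι κ : Type*} [Fintype ι] [Fintype κ] (A : ι → κ → ℝ) : ℝ :=
  Real.sqrt (mdot A A)

/-- Euclidean norm of a vector given as a tuple. -/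
noncomputable def vnorm {ι : Type*} [Fintype ι] (v : ι → ℝ) : ℝ :=
  Real.sqrt (∑ a, v a ^ 2)

/-- `Ω ⊆ ℝⁿ` is a (nonempty, open, connected) Lipschitz domain: every boundary point has
a neighbourhood on which `Ω` can be flattened to a half space by a bi-Lipschitz map. -/
def IsLipschitzDomain {n : ℕ} (Ω : Set (EVec n)) : Prop :=
  IsOpen Ω ∧ Ω.Nonempty ∧ IsConnected Ω ∧
  ∀ x ∈ frontier Ω, ∃ (U : Set (EVec n)) (h hinv : EVec n → EVec n) (K : NNReal)
      (e : EVec n),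
    ‖e‖ = 1 ∧ IsOpen U ∧ x ∈ U ∧ LipschitzOnWith K h U ∧
    LipschitzOnWith K hinv (h '' U) ∧ (∀ y ∈ U, hinv (h y) = y) ∧
    h '' (U ∩ Ω) = (h '' U) ∩ {y : EVec n | 0 < ⟪e, y⟫}

/-- `Du` is the weak (distributional) gradient of `u` on `Ω`, and both are integrable;
i.e. `u ∈ W^{1,1}(Ω; ℝ^ι)` with weak gradient `Du`. -/
def HasWeakDerivOn {n : ℕ} {ι : Type*} [Fintype ι] (Ω : Set (EVec n))
    (u : EVec n → ι → ℝ) (Du : EVec n → ι → Fin n → ℝ) : Prop :=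
  IntegrableOn u Ω volume ∧ IntegrableOn Du Ω volume ∧
  ∀ φ : EVec n → ℝ, ContDiff ℝ 1 φ → HasCompactSupport φ → tsupport φ ⊆ Ω →
    ∀ (a : ι) (i : Fin n),
      ∫ x in Ω, u x a * fderiv ℝ φ x (EuclideanSpace.single i 1) =
        - ∫ x in Ω, Du x a i * φ x

/-- `u ∈ W^{1,2}(Ω;ℝ^ι)` with weak gradient `Du`. -/
def MemW12 {n : ℕ} {ι : Type*} [Fintype ι] (Ω : Set (EVec n))
    (u : EVec n → ι → ℝ) (Du : EVec n → ι → Fin n → ℝ) : Prop :=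
  HasWeakDerivOn Ω u Du ∧ IntegrableOn (fun x => vnorm (u x) ^ 2) Ω volume ∧
    IntegrableOn (fun x => mnorm (Du x) ^ 2) Ω volume

/-- vanishing mean value `(u)_Ω = 0`. -/
def ZeroMean {n : ℕ} {ι : Type*} [Fintype ι] (Ω : Set (EVec n))
    (u : EVec n → ι → ℝ) : Prop :=
  ∀ a : ι, ∫ x in Ω, u x a = 0

/-- The `L^∞(Ω)` norm of a matrix field (w.r.t. the pointwise Frobenius norm). -/
noncomputable def linfNormOn {n N : ℕ} (Ω : Set (EVec n))
    (T : EVec n → Fin N → Fin n → ℝ) : ℝ≥0∞ :=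
  essSup (fun x => ENNReal.ofReal (mnorm (T x))) (volume.restrict Ω)

/-- `T ∈ W^{1,∞}(Ω)`: bounded and Lipschitz on `Ω`. -/
def MemW1inf {n N : ℕ} (Ω : Set (EVec n)) (T : EVec n → Fin N → Fin n → ℝ) : Prop :=
  ∃ C : NNReal, (∀ x ∈ Ω, ‖T x‖ ≤ C) ∧ LipschitzOnWith C T Ω

/-- `T ∈ W^{2,∞}(Ω)`: `T` is bounded with bounded Lipschitz derivative on `Ω`. -/
def MemW2inf {n N : ℕ} (Ω : Set (EVec n)) (T : EVec n → Fin N → Fin n → ℝ) : Prop :=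
  ∃ (C : NNReal) (DT : EVec n → EVec n →L[ℝ] (Fin N → Fin n → ℝ)),
    (∀ x ∈ Ω, ‖T x‖ ≤ C) ∧ (∀ x ∈ Ω, HasFDerivWithinAt T (DT x) Ω x) ∧
    (∀ x ∈ Ω, ‖DT x‖ ≤ C) ∧ LipschitzOnWith C DT Ω

/-- The nonlinear map `A(z) = f'(|z|) z / |z|` (equal to `0` at `z = 0`). -/
noncomputable def Amap {N n : ℕ} (f' : ℝ → ℝ) (z : Fin N → Fin n → ℝ) :
    Fin N → Fin n → ℝ :=
  fun a i => (f' (mnorm z) / mnorm z) * z a i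

/-- `u` is a weak solution of the Neumann problem for the integrand `f(|·|)` and datum `T₀`. -/
def IsWeakSolution {n N : ℕ} (Ω : Set (EVec n)) (f' : ℝ → ℝ)
    (T₀ : EVec n → Fin N → Fin n → ℝ)
    (u : EVec n → Fin N → ℝ) (Du : EVec n → Fin N → Fin n → ℝ) : Prop :=
  HasWeakDerivOn Ω u Du ∧
  ∀ φ Dφ, HasWeakDerivOn Ω φ Dφ →
    ∫ x in Ω, mdot (Amap f' (Du x)) (Dφ x) = ∫ x in Ω, mdot (T₀ x) (Dφ x)

/-- The functional `𝔉[w] = ∫_Ω (f(|∇w|) − T₀ · ∇w) dx` (as a function of the gradient). -/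
noncomputable def FF {n N : ℕ} (Ω : Set (EVec n)) (f : ℝ → ℝ)
    (T₀ : EVec n → Fin N → Fin n → ℝ) (Du : EVec n → Fin N → Fin n → ℝ) : ℝ :=
  ∫ x in Ω, (f (mnorm (Du x)) - mdot (T₀ x) (Du x))

/-- The regularised functional `𝔉_k[w] = 𝔉[w] + (2k)⁻¹ ∫_Ω |∇w|² dx`. -/
noncomputable def FFk {n N : ℕ} (Ω : Set (EVec n)) (f : ℝ → ℝ)
    (T₀ : EVec n → Fin N → Fin n → ℝ) (k : ℕ)
    (Du : EVec n → Fin N → Fin n → ℝ) : ℝ :=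
  FF Ω f T₀ Du + (2 * (k : ℝ))⁻¹ * ∫ x in Ω, mnorm (Du x) ^ 2

end

/-- `E ∈ L¹(Ω;ℝ^{N×n})` is curl-free in the sense of distributions on `Ω`. -/
def CurlFreeOn {n N : ℕ} (Ω : Set (EVec n)) (E : EVec n → Fin N → Fin n → ℝ) : Prop :=
  ∀ φ : EVec n → ℝ, ContDiff ℝ 1 φ → HasCompactSupport φ → tsupport φ ⊆ Ω →
    ∀ (a : Fin N) (i j : Fin n),
      ∫ x in Ω, (E x a i * fderiv ℝ φ x (EuclideanSpace.single j 1) -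
        E x a j * fderiv ℝ φ x (EuclideanSpace.single i 1)) = 0

section MPA
noncomputable def n2 {n : ℕ} (f : EVec n → ℝ) : ℝ := (eLpNorm f 2 volume).toReal

section PA
variable {n : ℕ}

theorem n2_nonneg (f : EVec n → ℝ) : 0 ≤ n2 f := ENNReal.toReal_nonneg

theorem n2_add {f g : EVec n → ℝ} (hf : MemLp f 2) (hg : MemLp g 2) :
    n2 (fun x => f x + g x) ≤ n2 f + n2 g := by
  unfold n2
  rw [← ENNReal.toReal_add hf.eLpNorm_ne_top hg.eLpNorm_ne_top]
  exact ENNReal.toReal_mono (ENNReal.add_ne_top.2 ⟨hf.eLpNorm_ne_top, hg.eLpNorm_ne_top⟩)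
    (eLpNorm_add_le hf.1 hg.1 (by norm_num))

theorem n2_sub {f g : EVec n → ℝ} (hf : MemLp f 2) (hg : MemLp g 2) :
    n2 (fun x => f x - g x) ≤ n2 f + n2 g := by
  unfold n2
  rw [← ENNReal.toReal_add hf.eLpNorm_ne_top hg.eLpNorm_ne_top]
  exact ENNReal.toReal_mono (ENNReal.add_ne_top.2 ⟨hf.eLpNorm_ne_top, hg.eLpNorm_ne_top⟩)
    (eLpNorm_sub_le hf.1 hg.1 (by norm_num))

theorem memLp_translate {f : EVec n → ℝ} (hf : MemLp f 2) (v : EVec n) :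
    MemLp (fun x => f (x + v)) 2 :=
  hf.comp_measurePreserving (measurePreserving_add_right volume v)

theorem n2_translate {f : EVec n → ℝ} (hf : MemLp f 2) (v : EVec n) :
    n2 (fun x => f (x + v)) = n2 f := by
  unfold n2
  congr 1
  exact eLpNorm_comp_measurePreserving (μ := volume) (ν := volume) (g := f) hf.1 (measurePreserving_add_right volume v)

theorem n2_sq {f : EVec n → ℝ} (hf : MemLp f 2) : n2 f ^ 2 = ∫ x, f x ^ 2 := by
  unfold n2
  rw [hf.eLpNorm_eq_integral_rpow_norm (by norm_num) (by norm_num)]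
  have h0 : 0 ≤ ∫ x, f x ^ 2 := integral_nonneg fun x => sq_nonneg _
  simp only [ENNReal.toReal_ofNat, Real.norm_eq_abs]
  have : ∀ x, |f x| ^ (2:ℝ) = f x ^ 2 := fun x => by
    rw [Real.rpow_ofNat]; exact sq_abs _
  simp only [this]
  rw [ENNReal.toReal_ofReal (by positivity), ← Real.rpow_natCast, ← Real.rpow_mul h0]
  norm_num

theorem int_mul_L2 {f g : EVec n → ℝ} (hf : MemLp f 2) (hg : MemLp g 2) :
    Integrable (fun x => f x * g x) := hf.integrable_mul hg

theorem int_sq_L2 {f : EVec n → ℝ} (hf : MemLp f 2) :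
    Integrable (fun x => f x ^ 2) := hf.integrable_sq

theorem n2_cs_abs {f g : EVec n → ℝ} (hf : MemLp f 2) (hg : MemLp g 2) :
    ∫ x, |f x * g x| ≤ n2 f * n2 g := by
  have h2 : MemLp f (ENNReal.ofReal 2) := by simpa using hf
  have h3 : MemLp g (ENNReal.ofReal 2) := by simpa using hg
  have h := integral_mul_norm_le_Lp_mul_Lq (μ := volume) Real.HolderConjugate.two_two h2 h3
  have e : ∀ u : EVec n → ℝ, MemLp u 2 → (∫ a, ‖u a‖ ^ (2:ℝ)) ^ ((1:ℝ)/2) = n2 u := by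
    intro u hu
    have := n2_sq hu
    have h4 : ∀ x, ‖u x‖ ^ (2:ℝ) = u x ^ 2 := fun x => by
      rw [Real.rpow_ofNat]; exact sq_abs _
    simp only [h4]
    rw [← this, ← Real.sqrt_eq_rpow, Real.sqrt_sq (n2_nonneg _)]
  rw [e f hf, e g hg] at h
  simpa [abs_mul] using h

theorem n2_cs {f g : EVec n → ℝ} (hf : MemLp f 2) (hg : MemLp g 2) :
    |∫ x, f x * g x| ≤ n2 f * n2 g :=
  (abs_integral_le_integral_abs).trans (n2_cs_abs hf hg)

theorem n2_translate_tendsto {f : EVec n → ℝ} (hf : MemLp f 2) :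
    Tendsto (fun v : EVec n => n2 (fun x => f (x + v) - f x)) (𝓝 0) (𝓝 0) := by
  haveI : Fact ((2:ℝ≥0∞) ≠ ∞) := ⟨by norm_num⟩
  have hc : Continuous (fun v : EVec n => (DomAddAct.mk v) +ᵥ (hf.toLp f)) := by
    have : Continuous (fun v : EVec n => (DomAddAct.mk v : (EVec n)ᵈᵃᵃ)) := DomAddAct.continuous_mk
    exact this.vadd continuous_const
  have h1 : Tendsto (fun v : EVec n => ‖((DomAddAct.mk v) +ᵥ (hf.toLp f)) - hf.toLp f‖) (𝓝 0) (𝓝 0) := by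
    have := ((hc.sub continuous_const).norm (E := Lp ℝ 2 (volume : Measure (EVec n)))).tendsto (0 : EVec n) (f := fun v => ‖((DomAddAct.mk v) +ᵥ (hf.toLp f)) - hf.toLp f‖)
    convert! this using 2
    have : (DomAddAct.mk (0 : EVec n)) +ᵥ (hf.toLp f) = hf.toLp f := by
      rw [DomAddAct.mk_zero]; exact zero_vadd _ _
    rw [this]; simp
  convert! h1 using 2 with v
  rw [DomAddAct.mk_vadd_toLp, ← MemLp.toLp_sub, Lp.norm_toLp]
  unfold n2
  congr 2
  ext x
  simp [add_comm]

theorem n2_scale {f : EVec n → ℝ} (c : ℝ) : n2 (fun x => c * f x) = |c| * n2 f := by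
  unfold n2
  have : (fun x => c * f x) = c • f := by ext; simp
  rw [this, eLpNorm_const_smul]; simp

theorem n2_le_of_dual {f : EVec n → ℝ} (hf : MemLp f 2) (C : ℝ)
    (h : ∀ ψ : EVec n → ℝ, ContDiff ℝ 1 ψ → HasCompactSupport ψ → |∫ x, f x * ψ x| ≤ C * n2 ψ) :
    n2 f ≤ C := by
  have hC : ∀ ε > 0, n2 f * n2 f ≤ (|C| + n2 f) * ε + C * n2 f := by
    intro ε hε
    obtain ⟨ψ, h1, h2, h3⟩ := hf.exist_eLpNorm_sub_le (by norm_num) (by norm_num) hε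
    have hψ : MemLp ψ 2 := h2.continuous.memLp_of_hasCompactSupport h1
    have h4 : n2 (fun x => f x - ψ x) ≤ ε := ENNReal.toReal_le_of_le_ofReal hε.le h3
    have h5 := h ψ (h2.of_le (by exact_mod_cast le_top)) h1
    have h6 : n2 ψ ≤ n2 f + ε := by
      have := n2_sub hf (hf.sub hψ)
      have e : (fun x => f x - (f - ψ) x) = ψ := by ext; simp
      rw [e] at this
      exact this.trans (by gcongr; exact h4)
    have h6' : n2 f ≤ n2 ψ + ε := by
      have := n2_add (hf.sub hψ) hψ
      have e : (fun x => (f - ψ) x + ψ x) = f := by ext; simp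
      rw [e] at this
      have h4' : n2 (f - ψ) ≤ ε := h4
      linarith
    have h7 : n2 f * n2 f = ∫ x, f x * ψ x + f x * (f - ψ) x := by
      rw [← sq, n2_sq hf]; congr 1; ext x; simp; ring
    rw [integral_add (int_mul_L2 hf hψ) (int_mul_L2 hf (hf.sub hψ))] at h7
    have h8 := n2_cs hf (hf.sub hψ)
    have h9 : |∫ x, f x * (f - ψ) x| ≤ n2 f * ε := h8.trans (by gcongr; exact n2_nonneg _; exact h4)
    have h10 : C * n2 ψ ≤ C * n2 f + |C| * ε := by
      rcases le_total 0 C with hC | hC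
      · rw [abs_of_nonneg hC]; nlinarith
      · rw [abs_of_nonpos hC]; nlinarith
    have := le_abs_self (∫ x, f x * ψ x)
    have := le_abs_self (∫ x, f x * (f - ψ) x)
    simp only [Pi.sub_apply] at *
    nlinarith
  have : n2 f * n2 f ≤ C * n2 f := by
    refine le_of_forall_pos_le_add fun δ hδ => ?_
    have hp : 0 < |C| + n2 f + 1 := by have := n2_nonneg f; positivity
    have := hC (δ / (|C| + n2 f + 1)) (by positivity)
    have h2 : (|C| + n2 f) * (δ / (|C| + n2 f + 1)) ≤ δ := by
      rw [mul_div_assoc', div_le_iff₀ hp]; nlinarith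
    linarith
  rcases (n2_nonneg f).eq_or_lt with h0 | h0
  · rw [← h0]
    by_contra hneg
    push Not at hneg
    by_cases hex : ∃ ψ : EVec n → ℝ, ContDiff ℝ 1 ψ ∧ HasCompactSupport ψ ∧ 0 < n2 ψ
    · obtain ⟨ψ, a, b, c⟩ := hex
      have := h ψ a b
      have := abs_nonneg (∫ x, f x * ψ x)
      nlinarith
    · push Not at hex
      obtain ⟨b⟩ : Nonempty (ContDiffBump (0 : EVec n)) := inferInstance
      have h1 := hex b b.contDiff b.hasCompactSupport
      have hb : MemLp b 2 (volume : Measure (EVec n)) := b.continuous.memLp_of_hasCompactSupport b.hasCompactSupport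
      have h2 : n2 (b : EVec n → ℝ) = 0 := le_antisymm h1 (n2_nonneg _)
      have h3 := n2_sq hb
      rw [h2] at h3
      have h4 : 0 < ∫ x, b x ^ 2 := by
        refine (b.continuous.pow 2).integral_pos_of_hasCompactSupport_nonneg_nonzero ?_ (fun x => sq_nonneg _) (x := 0) ?_
        · exact b.hasCompactSupport.comp_left (g := fun t : ℝ => t ^ 2) (by norm_num)
        · simp [b.one_of_mem_closedBall (Metric.mem_closedBall_self b.rIn_pos.le)]
      linarith
  · exact le_of_mul_le_mul_right this h0

noncomputable def ev (i : Fin n) : EVec n := EuclideanSpace.single i 1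

theorem norm_ev (i : Fin n) : ‖ev i‖ = 1 := by simp [ev]

structure WD (i : Fin n) (u g : EVec n → ℝ) : Prop where
  mu : MemLp u 2
  mg : MemLp g 2
  wd : ∀ φ : EVec n → ℝ, ContDiff ℝ 1 φ → HasCompactSupport φ →
    ∫ x, u x * fderiv ℝ φ x (ev i) = - ∫ x, g x * φ x

theorem hasDerivAt_pair {u : EVec n → ℝ} (hu : LocallyIntegrable u) (e : EVec n)
    {ψ : EVec n → ℝ} (hψ : ContDiff ℝ 1 ψ) (hc : HasCompactSupport ψ) (t : ℝ) :
    HasDerivAt (fun t : ℝ => ∫ x, u x * ψ (x - t • e))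
      (∫ x, u x * (- fderiv ℝ ψ (x - t • e) e)) t := by
  obtain ⟨R, hR⟩ := hc.isCompact.isBounded.subset_closedBall (0 : EVec n)
  have hdc : Continuous (fun x => fderiv ℝ ψ x e) := (hψ.continuous_fderiv (by norm_num)).clm_apply continuous_const
  have hdcs : HasCompactSupport (fun x => fderiv ℝ ψ x e) := hc.fderiv_apply ℝ e
  obtain ⟨C, hC⟩ := hdcs.exists_bound_of_continuous hdc
  set K := Metric.closedBall (0 : EVec n) (R + (|t| + 1) * ‖e‖) with hK
  have hsub : ∀ s ∈ Metric.ball t 1, ∀ x, x ∉ K → x - s • e ∉ tsupport ψ := by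
    intro s hs x hx hmem
    have h1 := hR hmem
    apply hx
    simp only [hK, Metric.mem_closedBall, dist_zero_right, Metric.mem_ball, Real.dist_eq] at *
    have h2 : |s| ≤ |t| + 1 := by
      have := abs_sub_abs_le_abs_sub s t; linarith
    calc ‖x‖ = ‖(x - s • e) + s • e‖ := by simp
      _ ≤ ‖x - s • e‖ + ‖s • e‖ := norm_add_le _ _
      _ ≤ R + (|t| + 1) * ‖e‖ := by
        rw [norm_smul, Real.norm_eq_abs]; gcongr
  have hint : ∀ s : ℝ, ∀ g : EVec n → ℝ, Continuous g → HasCompactSupport g →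
      Integrable (fun x => u x * g (x - s • e)) := by
    intro s g hg hgc
    have : HasCompactSupport (fun x => g (x - s • e)) := by
      have := hgc.comp_homeomorph (Homeomorph.addRight (-(s • e)))
      simpa [Function.comp_def, sub_eq_add_neg] using this
    have h2 := hu.integrable_smul_left_of_hasCompactSupport (g := fun x => g (x - s • e)) (by fun_prop) this
    simpa [mul_comm] using h2
  refine (hasDerivAt_integral_of_dominated_loc_of_deriv_le (F := fun t x => u x * ψ (x - t • e)) (F' := fun t x => u x * (- fderiv ℝ ψ (x - t • e) e))
    (bound := K.indicator (fun x => |u x| * C)) (Metric.ball_mem_nhds t one_pos) ?_ ?_ ?_ ?_ ?_ ?_).2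
  · exact Eventually.of_forall fun s => (hint s ψ hψ.continuous hc).aestronglyMeasurable
  · exact hint t ψ hψ.continuous hc
  · exact (hint t _ hdc.neg (hdcs.neg)).aestronglyMeasurable
  · refine Eventually.of_forall fun x s hs => ?_
    by_cases hx : x ∈ K
    · rw [indicator_of_mem hx, norm_mul, norm_neg]
      exact mul_le_mul_of_nonneg_left (hC _) (abs_nonneg _)
    · have : fderiv ℝ ψ (x - s • e) = 0 := by
        by_contra h
        exact hsub s hs x hx (support_fderiv_subset ℝ h)
      simp [indicator_of_notMem hx, this]
  · have : IntegrableOn (fun x => |u x| * C) K :=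
      ((hu.integrableOn_isCompact (isCompact_closedBall _ _)).abs.mul_const C)
    exact (integrable_indicator_iff Metric.isClosed_closedBall.measurableSet).2 this
  · refine Eventually.of_forall fun x s hs => ?_
    have h1 : HasDerivAt (fun s : ℝ => x - s • e) (-e) s := by
      simpa using ((hasDerivAt_id s).smul_const e).const_sub x
    have h2 := (hψ.differentiable (by norm_num) (x - s • e)).hasFDerivAt.comp_hasDerivAt s h1
    simpa using h2.const_mul (u x)

theorem WD.pair_bound {i : Fin n} {u g p : EVec n → ℝ} (w : WD i u g) (hp : MemLp p 2)
    {ψ : EVec n → ℝ} (hψ : ContDiff ℝ 1 ψ) (hc : HasCompactSupport ψ) (h : ℝ) (hh : 0 ≤ h)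
    (B : ℝ) (hB : ∀ s ∈ Icc 0 h, |∫ x, (g (x + s • ev i) - p x) * ψ x| ≤ B) :
    |∫ x, (u (x + h • ev i) - u x - h * p x) * ψ x| ≤ h * B := by
  have hψ2 : MemLp ψ 2 := hψ.continuous.memLp_of_hasCompactSupport hc
  set e := ev i
  have tr : ∀ (v : EVec n → ℝ) (s : ℝ), ∫ x, v x * ψ (x - s • e) = ∫ x, v (x + s • e) * ψ x := by
    intro v s
    rw [← integral_add_right_eq_self (fun x => v x * ψ (x - s • e)) (s • e)]
    simp
  set F : ℝ → ℝ := fun t => (∫ x, u x * ψ (x - t • e)) - t * ∫ x, p x * ψ x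
  have hd : ∀ t, HasDerivAt F (∫ x, (g (x + t • e) - p x) * ψ x) t := by
    intro t
    have h1 := (hasDerivAt_pair (w.mu.locallyIntegrable (by norm_num)) e hψ hc t).sub ((hasDerivAt_id t).mul_const (∫ x, p x * ψ x))
    convert! h1 using 1
    have h2 := w.wd (fun x => ψ (x - t • e)) (by fun_prop) (by
      have := hc.comp_homeomorph (Homeomorph.addRight (-(t • e)))
      simpa [Function.comp_def, sub_eq_add_neg] using this)
    rw [tr g t] at h2
    have h3 : ∀ x, fderiv ℝ (fun x => ψ (x - t • e)) x = fderiv ℝ ψ (x - t • e) := by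
      intro x
      simpa using fderiv_comp_sub (𝕜 := ℝ) (f := ψ) (x := x) (t • e)
    simp only [h3] at h2
    have h4 : ∫ x, u x * -(fderiv ℝ ψ (x - t • e)) e = ∫ x, g (x + t • e) * ψ x := by
      simp only [mul_neg, integral_neg]
      rw [h2, neg_neg]
    rw [h4, one_mul, ← integral_sub (int_mul_L2 (memLp_translate w.mg _) hψ2) (int_mul_L2 hp hψ2)]
    congr 1; ext x; ring
  have key : ‖F h - F 0‖ ≤ B * (h - 0) := by
    refine norm_image_sub_le_of_norm_deriv_le_segment' (f := F) (a := 0) (b := h) (C := B) (fun t ht => (hd t).hasDerivWithinAt) ?_ h ⟨hh, le_rfl⟩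
    intro t ht
    exact hB t ⟨ht.1, ht.2.le⟩
  have e1 : F h - F 0 = ∫ x, (u (x + h • e) - u x - h * p x) * ψ x := by
    have hu := w.mu
    simp only [F, tr u]
    simp only [zero_smul, add_zero, zero_mul, sub_zero]
    rw [← integral_const_mul, sub_right_comm, ← integral_sub (int_mul_L2 (memLp_translate hu _) hψ2) (int_mul_L2 hu hψ2), ← integral_sub]
    · congr 1; ext x; ring
    · exact (int_mul_L2 (memLp_translate hu _) hψ2).sub (int_mul_L2 hu hψ2)
    · exact (int_mul_L2 hp hψ2).const_mul h
  rw [← e1]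
  rw [Real.norm_eq_abs] at key
  linarith [mul_comm B (h - 0)]

theorem WD.dq_bound {i : Fin n} {u g p : EVec n → ℝ} (w : WD i u g) (hp : MemLp p 2)
    (h : ℝ) (hh : 0 ≤ h) (ω : ℝ) (hω : ∀ s ∈ Icc 0 h, n2 (fun x => g (x + s • ev i) - p x) ≤ ω) :
    n2 (fun x => u (x + h • ev i) - u x - h * p x) ≤ h * ω := by
  refine n2_le_of_dual (((memLp_translate w.mu _).sub w.mu).sub (hp.const_mul h)) _ ?_
  intro ψ h1 h2
  have hψ2 : MemLp ψ 2 := h1.continuous.memLp_of_hasCompactSupport h2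
  rw [mul_assoc]
  refine w.pair_bound hp h1 h2 h hh _ ?_
  intro s hs
  exact (n2_cs ((memLp_translate w.mg _).sub hp) hψ2).trans (mul_le_mul_of_nonneg_right (hω s hs) (n2_nonneg _))

theorem tendsto_smul_ev (i : Fin n) : Tendsto (fun h : ℝ => h • ev i) (𝓝 0) (𝓝 0) := by
  have : Continuous (fun h : ℝ => h • ev i) := by fun_prop
  simpa using this.tendsto 0

theorem n2_translate_ev {f : EVec n → ℝ} (hf : MemLp f 2) (i : Fin n) {ε : ℝ} (hε : 0 < ε) :
    ∃ δ > 0, ∀ h : ℝ, |h| < δ → n2 (fun x => f (x + h • ev i) - f x) < ε := by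
  have := (n2_translate_tendsto hf).comp (tendsto_smul_ev i)
  obtain ⟨δ, h1, h2⟩ := Metric.eventually_nhds_iff.1 (this.eventually_lt_const hε)
  exact ⟨δ, h1, fun h hh => h2 (by simpa using hh)⟩

noncomputable def dq (h : ℝ) (i : Fin n) (u : EVec n → ℝ) (x : EVec n) : ℝ :=
  h⁻¹ * (u (x + h • ev i) - u x)

theorem memLp_dq {u : EVec n → ℝ} (hu : MemLp u 2) (h : ℝ) (i : Fin n) : MemLp (dq h i u) 2 :=
  ((memLp_translate hu _).sub hu).const_mul h⁻¹

theorem WD.dq_tendsto {i : Fin n} {u g : EVec n → ℝ} (w : WD i u g) :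
    Tendsto (fun h => n2 (fun x => dq h i u x - g x)) (𝓝[>] 0) (𝓝 0) := by
  rw [Metric.tendsto_nhds]
  intro ε hε
  obtain ⟨δ, h1, h2⟩ := n2_translate_ev w.mg i (half_pos hε)
  filter_upwards [Ioo_mem_nhdsGT h1] with h hh
  have h3 := w.dq_bound w.mg h hh.1.le (ε/2) (fun s hs => (h2 s (by rw [abs_of_nonneg hs.1]; exact hs.2.trans_lt hh.2)).le)
  have h4 : (fun x => dq h i u x - g x) = fun x => h⁻¹ * (u (x + h • ev i) - u x - h * g x) := by
    ext x; unfold dq; field_simp [hh.1.ne']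
  rw [h4, n2_scale, Real.dist_0_eq_abs, abs_of_nonneg (mul_nonneg (abs_nonneg _) (n2_nonneg _)), abs_of_pos (inv_pos.2 hh.1)]
  have := mul_le_mul_of_nonneg_left h3 (inv_pos.2 hh.1).le
  rw [← mul_assoc, inv_mul_cancel₀ hh.1.ne'] at this
  linarith

end PA
end MPA

section MPB
section PB
variable {n : ℕ}

theorem int_mul_test {u : EVec n → ℝ} (hu : LocallyIntegrable u) {g : EVec n → ℝ}
    (hg : Continuous g) (hgc : HasCompactSupport g) : Integrable (fun x => u x * g x) := by
  have h2 := hu.integrable_smul_left_of_hasCompactSupport (g := g) hg hgc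
  simpa [mul_comm] using h2

theorem cont_fd {φ : EVec n → ℝ} (h : ContDiff ℝ 1 φ) (e : EVec n) : Continuous (fun x => fderiv ℝ φ x e) :=
  (h.continuous_fderiv (by norm_num)).clm_apply continuous_const

theorem WD.add {i : Fin n} {u g v k : EVec n → ℝ} (a : WD i u g) (b : WD i v k) :
    WD i (fun x => u x + v x) (fun x => g x + k x) := by
  refine ⟨a.mu.add b.mu, a.mg.add b.mg, fun φ h1 h2 => ?_⟩
  have hφ : MemLp φ 2 := h1.continuous.memLp_of_hasCompactSupport h2
  have hφ' : MemLp (fun x => fderiv ℝ φ x (ev i)) 2 :=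
    (cont_fd h1 _).memLp_of_hasCompactSupport (h2.fderiv_apply ℝ _)
  simp only [add_mul]
  rw [integral_add (int_mul_L2 a.mu hφ') (int_mul_L2 b.mu hφ'), integral_add (int_mul_L2 a.mg hφ) (int_mul_L2 b.mg hφ),
    a.wd φ h1 h2, b.wd φ h1 h2]
  ring

theorem WD.const_mul {i : Fin n} {u g : EVec n → ℝ} (a : WD i u g) (c : ℝ) :
    WD i (fun x => c * u x) (fun x => c * g x) := by
  refine ⟨a.mu.const_mul c, a.mg.const_mul c, fun φ h1 h2 => ?_⟩
  simp only [mul_assoc]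
  rw [integral_const_mul, integral_const_mul, a.wd φ h1 h2]
  ring

theorem WD.sub {i : Fin n} {u g v k : EVec n → ℝ} (a : WD i u g) (b : WD i v k) :
    WD i (fun x => u x - v x) (fun x => g x - k x) := by
  have := a.add (b.const_mul (-1))
  simpa [sub_eq_add_neg] using this

theorem hcs_translate {φ : EVec n → ℝ} (h : HasCompactSupport φ) (v : EVec n) :
    HasCompactSupport (fun x => φ (x + v)) := by
  have := h.comp_homeomorph (Homeomorph.addRight v)
  simpa [Function.comp_def] using this

theorem WD.translate {i : Fin n} {u g : EVec n → ℝ} (a : WD i u g) (v : EVec n) :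
    WD i (fun x => u (x + v)) (fun x => g (x + v)) := by
  refine ⟨memLp_translate a.mu v, memLp_translate a.mg v, fun φ h1 h2 => ?_⟩
  have h := a.wd (fun x => φ (x + (-v))) (by fun_prop) (hcs_translate h2 _)
  rw [← integral_add_right_eq_self _ v, ← integral_add_right_eq_self (fun x => g x * φ (x + -v)) v] at h
  simp only [fderiv_comp_add_right, add_neg_cancel_right] at h
  exact h

theorem WD.mul {i : Fin n} {u g : EVec n → ℝ} (a : WD i u g) {η : EVec n → ℝ}
    (h1 : ContDiff ℝ 1 η) (h2 : HasCompactSupport η) :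
    WD i (fun x => η x * u x) (fun x => η x * g x + fderiv ℝ η x (ev i) * u x) := by
  have bdd : ∀ {k v : EVec n → ℝ}, Continuous k → HasCompactSupport k → MemLp v 2 → MemLp (fun x => k x * v x) 2 := by
    intro k v hk hc hv
    obtain ⟨C, hC⟩ := hc.exists_bound_of_continuous hk
    exact MemLp.of_le_mul (c := C) hv (hk.aestronglyMeasurable.mul hv.1) (Eventually.of_forall fun x => by
      rw [norm_mul]; exact mul_le_mul_of_nonneg_right (hC x) (norm_nonneg _))
  have m1 := bdd h1.continuous h2 a.mu
  have m2 := bdd h1.continuous h2 a.mg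
  have m3 := bdd (cont_fd h1 (ev i)) (h2.fderiv_apply ℝ _) a.mu
  refine ⟨m1, m2.add m3, fun φ h3 h4 => ?_⟩
  have hφ : MemLp φ 2 := h3.continuous.memLp_of_hasCompactSupport h4
  have hφ' : MemLp (fun x => fderiv ℝ φ x (ev i)) 2 :=
    (cont_fd h3 _).memLp_of_hasCompactSupport (h4.fderiv_apply ℝ _)
  have h := a.wd (fun x => η x * φ x) (h1.mul h3) h2.mul_right
  have e : ∀ x, u x * fderiv ℝ (fun x => η x * φ x) x (ev i) = η x * u x * fderiv ℝ φ x (ev i) + fderiv ℝ η x (ev i) * u x * φ x := by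
    intro x
    rw [fderiv_fun_mul (h1.differentiable (by norm_num) x) (h3.differentiable (by norm_num) x)]
    simp; ring
  simp only [e] at h
  rw [integral_add (int_mul_L2 m1 hφ') (int_mul_L2 m3 hφ)] at h
  have e2 : ∀ x, (η x * g x + fderiv ℝ η x (ev i) * u x) * φ x = g x * (η x * φ x) + fderiv ℝ η x (ev i) * u x * φ x := fun x => by ring
  simp only [e2]
  rw [integral_add ?_ (int_mul_L2 m3 hφ)]
  · linarith
  · have := int_mul_L2 m2 hφ
    refine this.congr (Eventually.of_forall fun x => ?_)
    simp only; ring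

theorem WD.of_local {Ω : Set (EVec n)} (hΩ : IsOpen Ω) {i : Fin n} {u g : EVec n → ℝ}
    (hu : MemLp u 2 (volume.restrict Ω)) (hg : MemLp g 2 (volume.restrict Ω))
    (h : ∀ φ : EVec n → ℝ, ContDiff ℝ 1 φ → HasCompactSupport φ → tsupport φ ⊆ Ω →
      ∫ x in Ω, u x * fderiv ℝ φ x (ev i) = - ∫ x in Ω, g x * φ x)
    {χ : EVec n → ℝ} (h1 : ContDiff ℝ 1 χ) (h2 : HasCompactSupport χ) (h3 : tsupport χ ⊆ Ω) :
    WD i (fun x => χ x * u x) (fun x => χ x * g x + fderiv ℝ χ x (ev i) * u x) := by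
  have z1 : ∀ x, x ∉ Ω → χ x = 0 := fun x hx => image_eq_zero_of_notMem_tsupport fun h => hx (h3 h)
  have z2 : ∀ x, x ∉ Ω → fderiv ℝ χ x (ev i) = 0 := fun x hx => by
    have : fderiv ℝ χ x = 0 := by
      by_contra hh
      exact hx (h3 (support_fderiv_subset ℝ hh))
    simp [this]
  have bdd : ∀ {k v : EVec n → ℝ}, Continuous k → HasCompactSupport k → (∀ x, x ∉ Ω → k x = 0) →
      MemLp v 2 (volume.restrict Ω) → MemLp (fun x => k x * v x) 2 := by
    intro k v hk hc hz hv
    obtain ⟨C, hC⟩ := hc.exists_bound_of_continuous hk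
    have : MemLp (fun x => k x * v x) 2 (volume.restrict Ω) := 
      MemLp.of_le_mul (c := C) hv (hk.aestronglyMeasurable.mul hv.1) (Eventually.of_forall fun x => by
      rw [norm_mul]; exact mul_le_mul_of_nonneg_right (hC x) (norm_nonneg _))
    rw [← memLp_indicator_iff_restrict hΩ.measurableSet] at this
    convert! this using 1
    ext x
    by_cases hx : x ∈ Ω
    · simp [hx]
    · simp [hx, hz x hx]
  have m1 := bdd h1.continuous h2 z1 hu
  have m2 := bdd h1.continuous h2 z1 hg
  have m3 := bdd (cont_fd h1 (ev i)) (h2.fderiv_apply ℝ _) z2 hu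
  have set_eq : ∀ F : EVec n → ℝ, (∀ x, x ∉ Ω → F x = 0) → ∫ x in Ω, F x = ∫ x, F x := by
    intro F hF
    exact setIntegral_eq_integral_of_forall_compl_eq_zero hF
  refine ⟨m1, m2.add m3, fun φ h4 h5 => ?_⟩
  have hφ : MemLp φ 2 := h4.continuous.memLp_of_hasCompactSupport h5
  have hφ' : MemLp (fun x => fderiv ℝ φ x (ev i)) 2 :=
    (cont_fd h4 _).memLp_of_hasCompactSupport (h5.fderiv_apply ℝ _)
  have h := h (fun x => χ x * φ x) (h1.mul h4) h2.mul_right ((tsupport_mul_subset_left).trans h3)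
  have e : ∀ x, u x * fderiv ℝ (fun x => χ x * φ x) x (ev i) = χ x * u x * fderiv ℝ φ x (ev i) + fderiv ℝ χ x (ev i) * u x * φ x := by
    intro x
    rw [fderiv_fun_mul (h1.differentiable (by norm_num) x) (h4.differentiable (by norm_num) x)]
    simp; ring
  simp only [e] at h
  rw [set_eq _ (fun x hx => by simp [z1 x hx, z2 x hx]), set_eq _ (fun x hx => by simp [z1 x hx]),
    integral_add (int_mul_L2 m1 hφ') (int_mul_L2 m3 hφ)] at h
  have e2 : ∀ x, (χ x * g x + fderiv ℝ χ x (ev i) * u x) * φ x = g x * (χ x * φ x) + fderiv ℝ χ x (ev i) * u x * φ x := fun x => by ring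
  simp only [e2]
  rw [integral_add ?_ (int_mul_L2 m3 hφ)]
  · linarith
  · have := int_mul_L2 m2 hφ
    refine this.congr (Eventually.of_forall fun x => ?_)
    simp only; ring

end PB
end MPB

section MPC
structure PF (p : ℝ → ℝ) (L : ℝ) : Prop where
  p0 : p 0 = 0
  mono : ∀ s r, 0 ≤ s → s ≤ r → p s ≤ p r
  lip : ∀ s r, 0 ≤ s → s ≤ r → p r - p s ≤ L / (1 + s) * (r - s)
  bd : ∀ t, 0 ≤ t → p t ≤ L
  pos : ∀ t, 0 < t → 0 < p t

section PC
variable {H : Type*} [NormedAddCommGroup H] [InnerProductSpace ℝ H]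

theorem PF.nonneg {p : ℝ → ℝ} {L : ℝ} (P : PF p L) {t : ℝ} (ht : 0 ≤ t) : 0 ≤ p t := by
  have := P.mono 0 t le_rfl ht
  rwa [P.p0] at this

theorem PF.L_pos {p : ℝ → ℝ} {L : ℝ} (P : PF p L) : 0 < L := (P.pos 1 one_pos).trans_le (P.bd 1 zero_le_one)

noncomputable def AA (p : ℝ → ℝ) (z : H) : H := (p ‖z‖ / ‖z‖) • z

noncomputable def qq (p : ℝ → ℝ) (z w : H) : ℝ := ⟪AA p z - AA p w, z - w⟫

theorem PF.div_mul {p : ℝ → ℝ} {L : ℝ} (P : PF p L) (t : ℝ) : p t / t * t = p t := by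
  rcases eq_or_ne t 0 with h | h
  · simp [h, P.p0]
  · field_simp

theorem PF.div_nonneg {p : ℝ → ℝ} {L : ℝ} (P : PF p L) {t : ℝ} (ht : 0 ≤ t) : 0 ≤ p t / t :=
  _root_.div_nonneg (P.nonneg ht) ht

theorem PF.div_le {p : ℝ → ℝ} {L : ℝ} (P : PF p L) {t : ℝ} (ht : 0 ≤ t) : p t / t ≤ 2 * L / (1 + t) := by
  have hL := P.L_pos
  rcases ht.eq_or_lt with h | h
  · rw [← h]; simp; exact hL.le
  · rw [div_le_div_iff₀ h (by linarith)]
    have h1 := P.bd t ht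
    have h2 := P.lip 0 t le_rfl ht
    rw [P.p0] at h2
    simp at h2
    nlinarith

theorem PF.qq_eq {p : ℝ → ℝ} {L : ℝ} (P : PF p L) (z w : H) :
    qq p z w = (p ‖z‖ - p ‖w‖) * (‖z‖ - ‖w‖) + (p ‖z‖ / ‖z‖ + p ‖w‖ / ‖w‖) * (‖z‖ * ‖w‖ - ⟪z, w⟫) := by
  unfold qq AA
  simp only [inner_sub_left, inner_sub_right, real_inner_smul_left, real_inner_self_eq_norm_sq]
  rw [real_inner_comm z w]
  have h1 := P.div_mul ‖z‖
  have h2 := P.div_mul ‖w‖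
  set a := p ‖z‖ / ‖z‖
  set b := p ‖w‖ / ‖w‖
  rw [← h1, ← h2]; ring

theorem PF.AA_sub_sq {p : ℝ → ℝ} {L : ℝ} (P : PF p L) (z w : H) :
    ‖AA p z - AA p w‖ ^ 2 = (p ‖z‖ - p ‖w‖) ^ 2 + 2 * (p ‖z‖ / ‖z‖) * (p ‖w‖ / ‖w‖) * (‖z‖ * ‖w‖ - ⟪z, w⟫) := by
  rw [← real_inner_self_eq_norm_sq]
  unfold AA
  simp only [inner_sub_left, inner_sub_right, real_inner_smul_left, real_inner_smul_right]
  simp only [real_inner_self_eq_norm_sq]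
  rw [real_inner_comm z w]
  have h1 := P.div_mul ‖z‖
  have h2 := P.div_mul ‖w‖
  set a := p ‖z‖ / ‖z‖
  set b := p ‖w‖ / ‖w‖
  rw [← h1, ← h2]; ring

theorem PF.mono_mul {p : ℝ → ℝ} {L : ℝ} (P : PF p L) {r s : ℝ} (hr : 0 ≤ r) (hs : 0 ≤ s) :
    0 ≤ (p r - p s) * (r - s) := by
  rcases le_total r s with h | h
  · exact mul_nonneg_of_nonpos_of_nonpos (by linarith [P.mono r s hr h]) (by linarith)
  · exact mul_nonneg (by linarith [P.mono s r hs h]) (by linarith)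

theorem m_nonneg (z w : H) : 0 ≤ ‖z‖ * ‖w‖ - ⟪z, w⟫ := by linarith [real_inner_le_norm z w]

theorem PF.qq_nonneg {p : ℝ → ℝ} {L : ℝ} (P : PF p L) (z w : H) : 0 ≤ qq p z w := by
  rw [P.qq_eq]
  have := P.mono_mul (norm_nonneg z) (norm_nonneg w)
  have := m_nonneg z w
  have := P.div_nonneg (norm_nonneg z)
  have := P.div_nonneg (norm_nonneg w)
  positivity

theorem PF.AA_sub_le {p : ℝ → ℝ} {L : ℝ} (P : PF p L) (z w : H) :
    ‖AA p z - AA p w‖ ^ 2 ≤ 2 * L / (1 + min ‖z‖ ‖w‖) * qq p z w := by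
  rw [P.qq_eq, P.AA_sub_sq]
  have hL := P.L_pos
  have hr := norm_nonneg z
  have hs := norm_nonneg w
  have hm := m_nonneg z w
  have ha := P.div_nonneg hr
  have hb := P.div_nonneg hs
  have ha2 := P.div_le hr
  have hb2 := P.div_le hs
  set r := ‖z‖
  set s := ‖w‖
  set a := p r / r
  set b := p s / s
  set m := r * s - ⟪z, w⟫
  have hmin : 0 ≤ min r s := le_min hr hs
  set c := 2 * L / (1 + min r s) with hc
  have hc0 : 0 ≤ c := by positivity
  have ha3 : a ≤ c := ha2.trans (div_le_div_of_nonneg_left (by linarith) (by linarith) (by linarith [min_le_left r s]))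
  have hb3 : b ≤ c := hb2.trans (div_le_div_of_nonneg_left (by linarith) (by linarith) (by linarith [min_le_right r s]))
  have h1 : (p r - p s) ^ 2 ≤ c * ((p r - p s) * (r - s)) := by
    have key : ∀ x y, 0 ≤ x → x ≤ y → min r s = x → (p y - p x) ^ 2 ≤ c * ((p y - p x) * (y - x)) := by
      intro x y hx hxy hmx
      have h2 := P.lip x y hx hxy
      have h3 := P.mono x y hx hxy
      have h4 : L / (1 + x) * (y - x) ≤ c * (y - x) := by
        rw [hc, hmx]
        have : L / (1 + x) ≤ 2 * L / (1 + x) := by gcongr; linarith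
        exact mul_le_mul_of_nonneg_right this (by linarith)
      have h5 : p y - p x ≤ c * (y - x) := h2.trans h4
      have := mul_le_mul_of_nonneg_left h5 (sub_nonneg.2 h3)
      nlinarith
    rcases le_total r s with h | h
    · have := key r s hr h (min_eq_left h); nlinarith
    · exact key s r hs h (min_eq_right h)
  have h2 : 2 * a * b ≤ c * (a + b) := by nlinarith
  have h3 := mul_le_mul_of_nonneg_right h2 hm
  nlinarith

theorem PF.AA_lip {p : ℝ → ℝ} {L : ℝ} (P : PF p L) (z w : H) :
    ‖AA p z - AA p w‖ ≤ 2 * L * ‖z - w‖ := by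
  have h1 := P.AA_sub_le z w
  have hq := P.qq_nonneg z w
  have hq2 : qq p z w ≤ ‖AA p z - AA p w‖ * ‖z - w‖ := real_inner_le_norm _ _
  have hL := P.L_pos
  have hmin : 0 ≤ min ‖z‖ ‖w‖ := le_min (norm_nonneg _) (norm_nonneg _)
  have h2 : 2 * L / (1 + min ‖z‖ ‖w‖) ≤ 2 * L := div_le_self (by linarith) (by linarith)
  have h3 : ‖AA p z - AA p w‖ ^ 2 ≤ 2 * L * (‖AA p z - AA p w‖ * ‖z - w‖) :=
    h1.trans (mul_le_mul h2 hq2 hq (by linarith))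
  rcases (norm_nonneg (AA p z - AA p w)).eq_or_lt with h | h
  · rw [← h]; positivity
  · refine le_of_mul_le_mul_left ?_ h
    nlinarith

theorem PF.AA_zero (p : ℝ → ℝ) : AA p (0 : H) = 0 := by simp [AA]

noncomputable def PP (z ξ : H) : H := ‖z‖ ^ 2 • ξ - ⟪z, ξ⟫ • z

theorem PF.PP_le {p : ℝ → ℝ} {L : ℝ} (P : PF p L) (z w : H) :
    p ‖w‖ * ‖PP w (z - w)‖ ^ 2 ≤ 2 * ‖w‖ ^ 4 * ‖z‖ * qq p z w := by
  have e1 : PP w (z - w) = PP w z := by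
    unfold PP
    rw [inner_sub_right, real_inner_self_eq_norm_sq, smul_sub, sub_smul]; abel
  have e2 : ‖PP w z‖ ^ 2 = ‖w‖ ^ 2 * ((‖z‖ * ‖w‖ - ⟪z, w⟫) * (‖z‖ * ‖w‖ + ⟪z, w⟫)) := by
    rw [← real_inner_self_eq_norm_sq]
    unfold PP
    simp only [inner_sub_left, inner_sub_right, real_inner_smul_left, real_inner_smul_right]
    simp only [real_inner_self_eq_norm_sq]
    rw [real_inner_comm z w]
    ring
  rw [e1, e2]
  have hm := m_nonneg z w
  have h1 := real_inner_le_norm z w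
  have hb := P.div_nonneg (norm_nonneg w)
  have ha := P.div_nonneg (norm_nonneg z)
  have hq : p ‖w‖ / ‖w‖ * (‖z‖ * ‖w‖ - ⟪z, w⟫) ≤ qq p z w := by
    rw [P.qq_eq]
    have := P.mono_mul (norm_nonneg z) (norm_nonneg w)
    nlinarith
  rw [← P.div_mul ‖w‖]
  set b := p ‖w‖ / ‖w‖
  set m := ‖z‖ * ‖w‖ - ⟪z, w⟫
  set s := ‖w‖ with hs
  have hs0 : 0 ≤ s := norm_nonneg _
  have h2 : ‖z‖ * s + ⟪z, w⟫ ≤ 2 * ‖z‖ * s := by linarith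
  calc b * s * (s ^ 2 * (m * (‖z‖ * s + ⟪z, w⟫))) = s ^ 3 * (b * m) * (‖z‖ * s + ⟪z, w⟫) := by ring
    _ ≤ s ^ 3 * (b * m) * (2 * ‖z‖ * s) := mul_le_mul_of_nonneg_left h2 (by positivity)
    _ = (2 * s ^ 4 * ‖z‖) * (b * m) := by ring
    _ ≤ (2 * s ^ 4 * ‖z‖) * qq p z w := mul_le_mul_of_nonneg_left hq (by positivity)

theorem weight_bound (z w : H) (a : ℝ) (ha0 : 0 ≤ a) (ha : a ≤ ‖w‖) :
    a ^ 2 / (1 + min ‖z‖ ‖w‖) ≤ ‖w‖ + ‖w‖ * ‖z - w‖ := by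
  have hmin : 0 ≤ min ‖z‖ ‖w‖ := le_min (norm_nonneg _) (norm_nonneg _)
  rw [div_le_iff₀ (by linarith)]
  have h1 : ‖w‖ ≤ ‖z‖ + ‖z - w‖ := by
    have := norm_sub_norm_le w z
    rw [norm_sub_rev] at this; linarith
  have h2 : ‖w‖ ≤ min ‖z‖ ‖w‖ + ‖z - w‖ := by
    rcases min_choice ‖z‖ ‖w‖ with h | h <;> rw [h] <;> linarith [norm_nonneg (z - w)]
  set s := ‖w‖
  set mi := min ‖z‖ s
  have h3 := norm_nonneg (z - w)
  have hs : 0 ≤ s := norm_nonneg _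
  have h4 : a ^ 2 ≤ s * s := by nlinarith
  have h5 : s * s ≤ s * (mi + ‖z - w‖) := mul_le_mul_of_nonneg_left h2 hs
  have h6 : 0 ≤ s * ‖z - w‖ * mi := by positivity
  nlinarith

structure FP (f p : ℝ → ℝ) (L : ℝ) : Prop extends PF p L where
  tan : ∀ s t, 0 ≤ s → 0 ≤ t → f s + p s * (t - s) ≤ f t

theorem FP.conv {f p : ℝ → ℝ} {L : ℝ} (P : FP f p L) (z w : H) :
    f ‖w‖ + ⟪AA p w, z - w⟫ ≤ f ‖z‖ := by
  refine le_trans ?_ (P.tan ‖w‖ ‖z‖ (norm_nonneg _) (norm_nonneg _))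
  have h1 := m_nonneg z w
  have h2 := P.div_nonneg (norm_nonneg w)
  have h3 := P.div_mul ‖w‖
  unfold AA
  rw [real_inner_smul_left, inner_sub_right, real_inner_self_eq_norm_sq, real_inner_comm z w]
  set b := p ‖w‖ / ‖w‖
  rw [← h3]
  nlinarith

theorem FP.descent {f p : ℝ → ℝ} {L : ℝ} (P : FP f p L) (z ζ : H) :
    f ‖z + ζ‖ ≤ f ‖z‖ + ⟪AA p z, ζ⟫ + 2 * L * ‖ζ‖ ^ 2 := by
  have h1 := P.conv z (z + ζ)
  have h2 : ⟪AA p (z + ζ) - AA p z, ζ⟫ ≤ 2 * L * ‖ζ‖ * ‖ζ‖ := by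
    refine (real_inner_le_norm _ _).trans (mul_le_mul_of_nonneg_right ?_ (norm_nonneg _))
    simpa using P.AA_lip (z + ζ) z
  rw [inner_sub_left] at h2
  have e : z - (z + ζ) = -ζ := by abel
  rw [e, inner_neg_right] at h1
  nlinarith

theorem FP.mk' (L : ℝ) (f f' f'' : ℝ → ℝ)
    (hderiv : ∀ t ∈ Set.Ici (0:ℝ), HasDerivWithinAt f (f' t) (Set.Ici 0) t)
    (hderiv' : ∀ t ∈ Set.Ici (0:ℝ), HasDerivWithinAt f' (f'' t) (Set.Ici 0) t)
    (hf''cont : ContinuousOn f'' (Set.Ici 0))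
    (hstrict : StrictConvexOn ℝ (Set.Ici 0) f)
    (hf0 : f 0 = 0) (hf'0 : f' 0 = 0)
    (hgrowth : ∀ t ∈ Set.Ici (0:ℝ), f t ≤ L * (t + 1))
    (hsec : ∀ t ∈ Set.Ici (0:ℝ), f'' t ≤ L * (1 + t)⁻¹) (hL : 0 ≤ L) : FP f f' L := by
  have tan : ∀ s t, 0 ≤ s → 0 ≤ t → f s + f' s * (t - s) ≤ f t := by
    intro s t hs ht
    rcases lt_trichotomy s t with h | h | h
    · have := hstrict.convexOn.le_slope_of_hasDerivWithinAt hs ht h (hderiv s hs)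
      rw [slope_def_field, le_div_iff₀ (by linarith)] at this
      linarith
    · simp [h]
    · have := hstrict.convexOn.slope_le_of_hasDerivWithinAt ht hs h (hderiv s hs)
      rw [slope_def_field, div_le_iff₀ (by linarith)] at this
      linarith
  have mono : ∀ s r, 0 ≤ s → s ≤ r → f' s ≤ f' r := by
    intro s r hs hr
    rcases hr.eq_or_lt with h | h
    · rw [h]
    · have h1 := tan s r hs (hs.trans hr)
      have h2 := tan r s (hs.trans hr) hs
      have : f' s * (r - s) ≤ f' r * (r - s) := by linarith
      exact le_of_mul_le_mul_right this (by linarith)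
  refine ⟨⟨hf'0, mono, ?_, ?_, ?_⟩, tan⟩
  · intro s r hs hr
    have hmv := image_le_of_deriv_right_le_deriv_boundary (f := fun t => f' t - f' s) (f' := f'') (a := s) (b := r)
      (B := fun t => L / (1 + s) * (t - s)) (B' := fun _ => L / (1 + s)) ?_ ?_ (by simp) ?_ ?_ ?_ (x := r) ⟨hr, le_rfl⟩
    · exact hmv
    · intro t ht
      have : t ∈ Ici (0:ℝ) := hs.trans ht.1
      exact ((hderiv' t this).continuousWithinAt.mono (fun y hy => hs.trans hy.1)).sub continuousWithinAt_const
    · intro t ht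
      have : t ∈ Ici (0:ℝ) := hs.trans ht.1
      exact ((hderiv' t this).mono (fun y (hy : t ≤ y) => le_trans this hy)).sub_const _
    · fun_prop
    · intro t ht
      have h := ((hasDerivAt_id t).sub_const s).const_mul (L / (1 + s))
      simpa using h.hasDerivWithinAt
    · intro t ht
      refine (hsec t (hs.trans ht.1)).trans ?_
      rw [← div_eq_mul_inv]
      exact div_le_div_of_nonneg_left hL (by linarith) (by linarith [ht.1])
  · intro t ht
    by_contra hlt
    push Not at hlt
    set d := f' t - L
    have hd : 0 < d := by simp only [d]; linarith
    set T := t + (L + L * t - f t + 1 + |L + L * t - f t|) / d with hT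
    have h0 : 0 ≤ (L + L * t - f t + 1 + |L + L * t - f t|) / d := by
      apply _root_.div_nonneg _ hd.le
      linarith [neg_abs_le (L + L * t - f t)]
    have h1 := tan t T ht (by linarith)
    have h2 := hgrowth T (show (0:ℝ) ≤ T by linarith)
    have h3 : d * (T - t) = L + L * t - f t + 1 + |L + L * t - f t| := by
      rw [hT]; field_simp; ring
    have h4 := abs_nonneg (L + L * t - f t)
    have h5 : f' t * (T - t) = d * (T - t) + L * (T - t) := by simp only [d]; ring
    nlinarith
  · intro t ht
    have h1 : 0 ≤ f' t := by rw [← hf'0]; exact mono 0 t le_rfl ht.le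
    rcases h1.eq_or_lt with h | h
    · exfalso
      have h2 := tan t 0 ht.le le_rfl
      have h3 := tan 0 (t/2) le_rfl (by linarith)
      have h4 := hstrict.2 (show (0:ℝ) ∈ Ici 0 from self_mem_Ici) (show t ∈ Ici (0:ℝ) from ht.le) ht.ne (show (0:ℝ) < 1/2 by norm_num) (show (0:ℝ) < 1/2 by norm_num) (by norm_num)
      rw [← h] at h2
      have e : (1/2 : ℝ) • (0:ℝ) + (1/2 : ℝ) • t = t / 2 := by simp; ring
      rw [e] at h4
      simp [hf0, hf'0] at h2 h3 h4
      linarith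
    · exact h

end PC
end MPC

section MPD
abbrev HM (N n : ℕ) := EuclideanSpace ℝ (Fin N × Fin n)

noncomputable def tm {N n : ℕ} : (Fin N → Fin n → ℝ) →L[ℝ] HM N n :=
  LinearMap.toContinuousLinearMap
  { toFun := fun z => WithLp.toLp 2 (fun q => z q.1 q.2)
    map_add' := fun a b => by ext; simp
    map_smul' := fun c a => by ext; simp }

section PD
variable {n N : ℕ}

theorem iadd {α : Type*} {m : MeasurableSpace α} {μ : Measure α} {f g : α → ℝ} (hf : Integrable f μ) (hg : Integrable g μ) :
    Integrable (fun x => f x + g x) μ := hf.add hg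
theorem isub {α : Type*} {m : MeasurableSpace α} {μ : Measure α} {f g : α → ℝ} (hf : Integrable f μ) (hg : Integrable g μ) :
    Integrable (fun x => f x - g x) μ := hf.sub hg

theorem tm_apply (z : Fin N → Fin n → ℝ) (q : Fin N × Fin n) : tm z q = z q.1 q.2 := rfl

theorem inner_tm (z w : Fin N → Fin n → ℝ) : ⟪tm z, tm w⟫ = mdot z w := by
  rw [PiLp.inner_apply, Fintype.sum_prod_type]
  unfold mdot
  simp only [tm_apply]
  congr 1; ext a; congr 1; ext i
  simp [mul_comm]

theorem norm_tm (z : Fin N → Fin n → ℝ) : ‖tm z‖ = mnorm z := by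
  unfold mnorm
  rw [← inner_tm, real_inner_self_eq_norm_sq, Real.sqrt_sq (norm_nonneg _)]

theorem memLp_tm {Ω : Set (EVec n)} {u : EVec n → Fin N → ℝ} {Du : EVec n → Fin N → Fin n → ℝ}
    (h : MemW12 Ω u Du) : MemLp (fun x => tm (Du x)) 2 (volume.restrict Ω) := by
  have m : AEStronglyMeasurable (fun x => tm (Du x)) (volume.restrict Ω) :=
    tm.continuous.comp_aestronglyMeasurable h.1.2.1.aestronglyMeasurable
  rw [memLp_two_iff_integrable_sq_norm m]
  simp only [norm_tm]
  exact h.2.2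

theorem MemW12.add_smul {Ω : Set (EVec n)} (hΩ : IsOpen Ω) {u w : EVec n → Fin N → ℝ} {Du Dw : EVec n → Fin N → Fin n → ℝ}
    (h : MemW12 Ω u Du) (h' : MemW12 Ω w Dw) (t : ℝ) :
    MemW12 Ω (fun x => u x + t • w x) (fun x => Du x + t • Dw x) := by
  have vn : ∀ v : Fin N → ℝ, vnorm v = ‖(WithLp.toLp 2 v : EuclideanSpace ℝ (Fin N))‖ := by
    intro v; rw [EuclideanSpace.norm_eq]; simp [vnorm]
  have vm : ∀ {v : EVec n → Fin N → ℝ}, IntegrableOn v Ω → IntegrableOn (fun x => vnorm (v x) ^ 2) Ω →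
      MemLp (fun x => (WithLp.toLp 2 (v x) : EuclideanSpace ℝ (Fin N))) 2 (volume.restrict Ω) := by
    intro v h1 h2
    rw [memLp_two_iff_integrable_sq_norm]
    · simp only [← vn]; exact h2
    · exact (PiLp.continuous_toLp 2 _).comp_aestronglyMeasurable h1.aestronglyMeasurable
  have hcoord : ∀ {v : EVec n → Fin N → ℝ}, IntegrableOn v Ω → ∀ a, IntegrableOn (fun x => v x a) Ω := by
    intro v h1 a
    exact (ContinuousLinearMap.proj (R := ℝ) (φ := fun _ : Fin N => ℝ) a).integrable_comp h1
  have hcoord2 : ∀ {v : EVec n → Fin N → Fin n → ℝ}, IntegrableOn v Ω → ∀ a i, IntegrableOn (fun x => v x a i) Ω := by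
    intro v h1 a i
    have := (ContinuousLinearMap.proj (R := ℝ) (φ := fun _ : Fin N => Fin n → ℝ) a).integrable_comp h1
    exact (ContinuousLinearMap.proj (R := ℝ) (φ := fun _ : Fin n => ℝ) i).integrable_comp this
  refine ⟨⟨h.1.1.add (h'.1.1.smul t), h.1.2.1.add (h'.1.2.1.smul t), ?_⟩, ?_, ?_⟩
  · intro φ h1 h2 h3 a i
    have e1 := h.1.2.2 φ h1 h2 h3 a i
    have e2 := h'.1.2.2 φ h1 h2 h3 a i
    obtain ⟨C, hC⟩ := h2.exists_bound_of_continuous h1.continuous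
    have hfc := cont_fd h1 (EuclideanSpace.single i 1)
    obtain ⟨C', hC'⟩ := (h2.fderiv_apply ℝ (EuclideanSpace.single i 1)).exists_bound_of_continuous hfc
    have i1 : ∀ {v : EVec n → ℝ} {k : EVec n → ℝ} {C : ℝ}, Continuous k → (∀ x, ‖k x‖ ≤ C) → IntegrableOn v Ω → IntegrableOn (fun x => v x * k x) Ω := by
      intro v k C hk hkC hv
      exact Integrable.mul_bdd (c := C) hv hk.aestronglyMeasurable (Eventually.of_forall hkC)
    simp only [Pi.add_apply, Pi.smul_apply, smul_eq_mul, add_mul, mul_assoc]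
    rw [integral_add (i1 hfc hC' (hcoord h.1.1 a)) ((i1 hfc hC' (hcoord h'.1.1 a)).const_mul t),
      integral_add (i1 h1.continuous hC (hcoord2 h.1.2.1 a i)) ((i1 h1.continuous hC (hcoord2 h'.1.2.1 a i)).const_mul t),
      integral_const_mul, integral_const_mul, e1, e2]
    ring
  · have := (vm h.1.1 h.2.1).add ((vm h'.1.1 h'.2.1).const_smul t)
    rw [memLp_two_iff_integrable_sq_norm this.1] at this
    refine this.congr (Eventually.of_forall fun x => ?_)
    simp only [vn]
    rfl
  · have := (memLp_tm h).add ((memLp_tm h').const_smul t)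
    rw [memLp_two_iff_integrable_sq_norm this.1] at this
    refine this.congr (Eventually.of_forall fun x => ?_)
    simp only [← norm_tm, map_add, map_smul]
    rfl

theorem FFk_eq {Ω : Set (EVec n)} (f : ℝ → ℝ) (T₀ Du : EVec n → Fin N → Fin n → ℝ) (k : ℕ) :
    FFk Ω f T₀ k Du = (∫ x in Ω, (f ‖tm (Du x)‖ - ⟪tm (T₀ x), tm (Du x)⟫)) + (2 * (k : ℝ))⁻¹ * ∫ x in Ω, ‖tm (Du x)‖ ^ 2 := by
  simp only [FFk, FF, norm_tm, inner_tm]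

theorem int_inner {H : Type*} [NormedAddCommGroup H] [InnerProductSpace ℝ H] {μ : Measure (EVec n)} {f g : EVec n → H}
    (hf : MemLp f 2 μ) (hg : MemLp g 2 μ) : Integrable (fun x => ⟪f x, g x⟫) μ := by
  refine Integrable.mono' (hf.norm.integrable_mul hg.norm) (hf.1.inner hg.1) (Eventually.of_forall fun x => ?_)
  exact norm_inner_le_norm _ _

theorem linear_quad_zero (l C : ℝ) (h : ∀ t : ℝ, 0 ≤ t * l + C * t ^ 2) : l = 0 := by
  by_contra hl
  have hp : 0 < |C| + 1 := by positivity
  have h1 := h (-l / (2 * (|C| + 1)))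
  have h2 : C ≤ |C| + 1 := by linarith [le_abs_self C]
  have h3 : 0 < l ^ 2 := by positivity
  have h4 : -l / (2 * (|C| + 1)) * l + C * (-l / (2 * (|C| + 1))) ^ 2 ≤ -l / (2 * (|C| + 1)) * l + (|C| + 1) * (-l / (2 * (|C| + 1))) ^ 2 := by
    gcongr
  have h5 : -l / (2 * (|C| + 1)) * l + (|C| + 1) * (-l / (2 * (|C| + 1))) ^ 2 = - (l ^ 2 / (4 * (|C| + 1))) := by
    field_simp; ring
  have : 0 < l ^ 2 / (4 * (|C| + 1)) := by positivity
  linarith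

theorem FP.contOn {f p : ℝ → ℝ} {L : ℝ} (P : FP f p L) {H : Type*} [NormedAddCommGroup H] [InnerProductSpace ℝ H] :
    Continuous (fun z : H => f ‖z‖) := by
  have h : ∀ s t, 0 ≤ s → 0 ≤ t → |f s - f t| ≤ L * |s - t| := by
    intro s t hs ht
    have h1 := P.tan s t hs ht
    have h2 := P.tan t s ht hs
    have a1 := P.bd s hs
    have a2 := P.bd t ht
    have b1 := P.nonneg hs
    have b2 := P.nonneg ht
    rw [abs_le]
    rcases le_total s t with h | h
    · rw [abs_of_nonpos (by linarith)]; constructor <;> nlinarith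
    · rw [abs_of_nonneg (by linarith)]; constructor <;> nlinarith
  have : LipschitzWith L.toNNReal (fun z : H => f ‖z‖) := by
    refine LipschitzWith.of_dist_le_mul fun z w => ?_
    rw [Real.dist_eq, Real.coe_toNNReal _ P.L_pos.le, dist_eq_norm]
    exact (h _ _ (norm_nonneg _) (norm_nonneg _)).trans (mul_le_mul_of_nonneg_left (abs_norm_sub_norm_le z w) P.L_pos.le)
  exact this.continuous

theorem PF.AA_cont {p : ℝ → ℝ} {L : ℝ} (P : PF p L) {H : Type*} [NormedAddCommGroup H] [InnerProductSpace ℝ H] :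
    Continuous (fun z : H => AA p z) := by
  have : LipschitzWith (2 * L).toNNReal (fun z : H => AA p z) := by
    refine LipschitzWith.of_dist_le_mul fun z w => ?_
    rw [Real.coe_toNNReal _ (by linarith [P.L_pos]), dist_eq_norm, dist_eq_norm]
    exact P.AA_lip z w
  exact this.continuous

theorem FP.f_bound {f p : ℝ → ℝ} {L : ℝ} (P : FP f p L) (h0 : f 0 = 0) {t : ℝ} (ht : 0 ≤ t) : 0 ≤ f t ∧ f t ≤ L * t := by
  have h1 := P.tan 0 t le_rfl ht
  have h2 := P.tan t 0 ht le_rfl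
  have := P.bd t ht
  rw [h0, P.p0] at h1
  rw [h0] at h2
  constructor
  · linarith
  · nlinarith

theorem FP.int_f {f p : ℝ → ℝ} {L : ℝ} (P : FP f p L) (h0 : f 0 = 0) {H : Type*} [NormedAddCommGroup H] [InnerProductSpace ℝ H]
    {μ : Measure (EVec n)} [IsFiniteMeasure μ] {Z : EVec n → H} (hZ : MemLp Z 2 μ) : Integrable (fun x => f ‖Z x‖) μ := by
  refine Integrable.mono' ((hZ.integrable (by norm_num)).norm.const_mul L) (P.contOn.comp_aestronglyMeasurable hZ.1) (Eventually.of_forall fun x => ?_)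
  have := P.f_bound h0 (norm_nonneg (Z x))
  rw [Real.norm_of_nonneg this.1]; exact this.2

theorem euler_lagrange {Ω : Set (EVec n)} (hΩ : IsOpen Ω) (hfin : volume Ω ≠ ∞) {f p : ℝ → ℝ} {L : ℝ} (P : FP f p L) (h0 : f 0 = 0)
    {T₀ : EVec n → Fin N → Fin n → ℝ} (hT : MemLp (fun x => tm (T₀ x)) 2 (volume.restrict Ω)) (k : ℕ)
    {u : EVec n → Fin N → ℝ} {Du : EVec n → Fin N → Fin n → ℝ} (hu : MemW12 Ω u Du)
    (hmin : ∀ (w : EVec n → Fin N → ℝ) (Dw : EVec n → Fin N → Fin n → ℝ),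
        MemW12 Ω w Dw → FFk Ω f T₀ k Du ≤ FFk Ω f T₀ k Dw)
    {w : EVec n → Fin N → ℝ} {Dw : EVec n → Fin N → Fin n → ℝ} (hw : MemW12 Ω w Dw) :
    ∫ x in Ω, ⟪AA p (tm (Du x)) + (k : ℝ)⁻¹ • tm (Du x) - tm (T₀ x), tm (Dw x)⟫ = 0 := by
  haveI : IsFiniteMeasure (volume.restrict Ω) := ⟨by simpa using hfin.lt_top⟩
  have hZ := memLp_tm hu
  have hW := memLp_tm hw
  set Z := fun x => tm (Du x) with hZd
  set W := fun x => tm (Dw x) with hWd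
  set T := fun x => tm (T₀ x) with hTd
  have hA : MemLp (fun x => AA p (Z x)) 2 (volume.restrict Ω) :=
    MemLp.of_le_mul (c := 2 * L) hZ (P.AA_cont.comp_aestronglyMeasurable hZ.1) (Eventually.of_forall fun x => by
      simpa [PF.AA_zero] using P.AA_lip (Z x) 0)
  have iA := int_inner hA hW
  have iZ := int_inner hZ hW
  have iT := int_inner hT hW
  have iW2 := hW.integrable_norm_pow (by norm_num : (2:ℕ) ≠ 0)
  have iZ2 := hZ.integrable_norm_pow (by norm_num : (2:ℕ) ≠ 0)
  have ifZ := P.int_f h0 hZ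
  refine linear_quad_zero _ ((2 * L + (2 * (k : ℝ))⁻¹) * ∫ x in Ω, ‖W x‖ ^ 2) fun t => ?_
  have hm := hmin _ _ (hu.add_smul hΩ hw t)
  rw [FFk_eq, FFk_eq] at hm
  simp only [map_add, map_smul] at hm
  have hZt : MemLp (fun x => Z x + t • W x) 2 (volume.restrict Ω) := hZ.add (hW.const_smul t)
  have iZt2 := hZt.integrable_norm_pow (by norm_num : (2:ℕ) ≠ 0)
  have ifZt := P.int_f h0 hZt
  have h1 : ∫ x in Ω, (f ‖Z x + t • W x‖ - ⟪T x, Z x + t • W x⟫) ≤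
      ∫ x in Ω, ((f ‖Z x‖ - ⟪T x, Z x⟫) + (t * ⟪AA p (Z x), W x⟫ - t * ⟪T x, W x⟫ + 2 * L * t ^ 2 * ‖W x‖ ^ 2)) := by
    refine integral_mono (ifZt.sub (int_inner hT hZt)) ((ifZ.sub (int_inner hT hZ)).add (((iA.const_mul t).sub (iT.const_mul t)).add (iW2.const_mul _))) fun x => ?_
    have := P.descent (Z x) (t • W x)
    simp only [inner_smul_right, norm_smul, mul_pow, Real.norm_eq_abs, sq_abs, inner_add_right] at this ⊢
    linarith
  rw [integral_add (isub ifZ (int_inner hT hZ)) (iadd (isub (iA.const_mul t) (iT.const_mul t)) (iW2.const_mul _)), 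
    integral_add (isub (iA.const_mul t) (iT.const_mul t)) (iW2.const_mul _), integral_sub (iA.const_mul t) (iT.const_mul t),
    integral_const_mul, integral_const_mul, integral_const_mul] at h1
  have h2 : ∫ x in Ω, ‖Z x + t • W x‖ ^ 2 = (∫ x in Ω, ‖Z x‖ ^ 2) + (2 * t * (∫ x in Ω, ⟪Z x, W x⟫) + t ^ 2 * ∫ x in Ω, ‖W x‖ ^ 2) := by
    rw [← integral_const_mul, ← integral_const_mul, ← integral_add (iZ.const_mul _) (iW2.const_mul _), ← integral_add iZ2 (iadd (iZ.const_mul _) (iW2.const_mul _))]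
    congr 1; ext x
    rw [norm_add_sq_real, inner_smul_right, norm_smul, mul_pow, Real.norm_eq_abs, sq_abs]
    ring
  have h3 : ∫ x in Ω, ⟪AA p (Z x) + (k : ℝ)⁻¹ • Z x - T x, W x⟫ = (∫ x in Ω, ⟪AA p (Z x), W x⟫) + (k : ℝ)⁻¹ * (∫ x in Ω, ⟪Z x, W x⟫) - ∫ x in Ω, ⟪T x, W x⟫ := by
    rw [← integral_const_mul, ← integral_add iA (iZ.const_mul _), ← integral_sub (iadd iA (iZ.const_mul _)) iT]
    congr 1; ext x
    simp only [inner_sub_left, inner_add_left, real_inner_smul_left]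
  rw [h3]
  rw [h2] at hm
  have h4 : (2 * (k:ℝ))⁻¹ = (k:ℝ)⁻¹ / 2 := by rw [mul_inv]; ring
  rw [h4] at hm ⊢
  have hm' := hm.trans (add_le_add_left h1 _)
  set a1 := ∫ x in Ω, ⟪AA p (Z x), W x⟫
  set a2 := ∫ x in Ω, ⟪Z x, W x⟫
  set a3 := ∫ x in Ω, ⟪T x, W x⟫
  set a4 := ∫ x in Ω, ‖W x‖ ^ 2
  linarith

theorem energy_bound {Ω : Set (EVec n)} (hΩ : IsOpen Ω) (hfin : volume Ω ≠ ∞) {f p : ℝ → ℝ} {L : ℝ} (P : FP f p L) (h0 : f 0 = 0)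
    {finf : ℝ} (hfinf : Filter.Tendsto (fun t => f t / t) Filter.atTop (nhds finf))
    {T₀ : EVec n → Fin N → Fin n → ℝ} (hT : MemLp (fun x => tm (T₀ x)) 2 (volume.restrict Ω))
    (hTsmall : linfNormOn Ω T₀ < ENNReal.ofReal finf) :
    ∃ C : ℝ, ∀ (k : ℕ) (u : EVec n → Fin N → ℝ) (Du : EVec n → Fin N → Fin n → ℝ), 0 < k → MemW12 Ω u Du →
    (∀ (w : EVec n → Fin N → ℝ) (Dw : EVec n → Fin N → Fin n → ℝ),
        MemW12 Ω w Dw → FFk Ω f T₀ k Du ≤ FFk Ω f T₀ k Dw) →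
    ∫ x in Ω, ‖tm (Du x)‖ ≤ C ∧ (k:ℝ)⁻¹ * ∫ x in Ω, ‖tm (Du x)‖ ^ 2 ≤ C := by
  haveI : IsFiniteMeasure (volume.restrict Ω) := ⟨by simpa using hfin.lt_top⟩
  set τ := (linfNormOn Ω T₀).toReal with hτ
  have hτ0 : 0 ≤ τ := ENNReal.toReal_nonneg
  have hne : linfNormOn Ω T₀ ≠ ∞ := (hTsmall.trans_le le_top).ne
  have hτlt : τ < finf := by
    have := ENNReal.toReal_strict_mono ENNReal.ofReal_ne_top hTsmall
    have hp : 0 < ENNReal.ofReal finf := (zero_le).trans_lt hTsmall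
    rw [ENNReal.toReal_ofReal (ENNReal.ofReal_pos.1 hp).le] at this
    exact this
  have hTb : ∀ᵐ x ∂(volume.restrict Ω), ‖tm (T₀ x)‖ ≤ τ := by
    filter_upwards [ENNReal.ae_le_essSup (μ := volume.restrict Ω) (fun x => ENNReal.ofReal (mnorm (T₀ x)))] with x hx
    rw [norm_tm]
    exact (ENNReal.ofReal_le_iff_le_toReal hne).1 hx
  set c := (τ + finf) / 2
  have hc1 : τ < c := by simp only [c]; linarith
  have hc2 : c < finf := by simp only [c]; linarith
  obtain ⟨t0, ht0, ht1⟩ : ∃ t0 > 0, ∀ t ≥ t0, c ≤ f t / t := by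
    have := (hfinf.eventually_const_le hc2).and (eventually_gt_atTop 0)
    obtain ⟨t0, h⟩ := eventually_atTop.1 this
    exact ⟨max t0 1, by positivity, fun t ht => (h t (le_trans (le_max_left _ _) ht)).1⟩
  have hlow : ∀ t, 0 ≤ t → c * t - c * t0 ≤ f t := by
    intro t ht
    rcases le_total t0 t with h | h
    · have := ht1 t h
      rw [le_div_iff₀ (by linarith)] at this
      nlinarith
    · have := (P.f_bound h0 ht).1
      nlinarith
  refine ⟨max (c * t0 * (volume.restrict Ω).real univ / (c - τ)) (2 * (c * t0 * (volume.restrict Ω).real univ)), ?_⟩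
  intro k u Du hk hu hmin
  have hz : MemW12 Ω (fun _ => (0 : Fin N → ℝ)) (fun _ => (0 : Fin N → Fin n → ℝ)) := by
    refine ⟨⟨integrable_zero _ _ _, integrable_zero _ _ _, ?_⟩, ?_, ?_⟩
    · intros; simp
    · simp [vnorm]
    · simp [mnorm, mdot]
  have hm := hmin _ _ hz
  have hZ := memLp_tm hu
  rw [FFk_eq, FFk_eq] at hm
  simp only [map_zero, norm_zero, h0, inner_zero_right, sub_zero, integral_zero, ne_eq, OfNat.ofNat_ne_zero, not_false_eq_true, zero_pow, mul_zero, add_zero] at hm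
  have iZ := (hZ.integrable (by norm_num)).norm
  have h1 : (∫ x in Ω, ((c - τ) * ‖tm (Du x)‖ - c * t0)) ≤ ∫ x in Ω, (f ‖tm (Du x)‖ - ⟪tm (T₀ x), tm (Du x)⟫) := by
    refine integral_mono_ae ((iZ.const_mul _).sub (integrable_const _)) ((P.int_f h0 hZ).sub (int_inner hT hZ)) ?_
    filter_upwards [hTb] with x hx
    have a1 := hlow _ (norm_nonneg (tm (Du x)))
    have a2 := real_inner_le_norm (tm (T₀ x)) (tm (Du x))
    have a3 := mul_le_mul_of_nonneg_right hx (norm_nonneg (tm (Du x)))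
    linarith
  rw [integral_sub (iZ.const_mul _) (integrable_const _), integral_const_mul, integral_const, smul_eq_mul] at h1
  have i0 : 0 ≤ ∫ x in Ω, ‖tm (Du x)‖ := integral_nonneg fun x => norm_nonneg _
  have i2 : 0 ≤ ∫ x in Ω, ‖tm (Du x)‖ ^ 2 := integral_nonneg fun x => by positivity
  have hkp : 0 < (k:ℝ) := by exact_mod_cast hk
  have hk4 : (2 * (k:ℝ))⁻¹ = (k:ℝ)⁻¹ / 2 := by rw [mul_inv]; ring
  rw [hk4] at hm
  have hk5 : 0 ≤ (k:ℝ)⁻¹ * ∫ x in Ω, ‖tm (Du x)‖ ^ 2 := by positivity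
  have hcτ : 0 < c - τ := by linarith
  constructor
  · refine le_trans ?_ (le_max_left _ _)
    rw [le_div_iff₀ hcτ]
    nlinarith
  · refine le_trans ?_ (le_max_right _ _)
    have : 0 ≤ (c - τ) * ∫ x in Ω, ‖tm (Du x)‖ := by positivity
    nlinarith

end PD
end MPD

section MPE
section PE
variable {n N : ℕ}

theorem PF.caccio_pt {H : Type*} [NormedAddCommGroup H] [InnerProductSpace ℝ H] {p : ℝ → ℝ} {L : ℝ} (P : PF p L)
    (z w R : H) (t κ : ℝ) (hκ : 0 ≤ κ) :
    (1/2) * (t ^ 2 * (qq p z w + κ * ‖z - w‖ ^ 2)) ≤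
      ⟪AA p z - AA p w + κ • (z - w), t ^ 2 • (z - w) + (2 * t) • R⟫ + (2 * (2 * L / (1 + min ‖z‖ ‖w‖)) + 2 * κ) * ‖R‖ ^ 2 := by
  set a := AA p z - AA p w with ha
  set d := z - w with hd
  set c := 2 * L / (1 + min ‖z‖ ‖w‖) with hc
  have h1 : ‖a‖ ^ 2 ≤ c * qq p z w := P.AA_sub_le z w
  have hq := P.qq_nonneg z w
  have hq' : qq p z w = ⟪a, d⟫ := rfl
  have hmin : 0 ≤ min ‖z‖ ‖w‖ := le_min (norm_nonneg _) (norm_nonneg _)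
  have hc0 : 0 ≤ c := by have := P.L_pos; positivity
  have e : ⟪a + κ • d, t ^ 2 • d + (2 * t) • R⟫ = t ^ 2 * qq p z w + κ * t ^ 2 * ‖d‖ ^ 2 + 2 * t * ⟪a, R⟫ + 2 * κ * t * ⟪d, R⟫ := by
    simp only [inner_add_left, inner_add_right, real_inner_smul_left, real_inner_smul_right]
    rw [real_inner_self_eq_norm_sq, hq']; ring
  rw [e]
  have b1 : -(2 * t * ⟪a, R⟫) ≤ (1/2) * (t ^ 2 * qq p z w) + 2 * c * ‖R‖ ^ 2 := by
    have h2 : |⟪a, R⟫| ≤ ‖a‖ * ‖R‖ := abs_real_inner_le_norm a R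
    have h3 : (⟪a, R⟫) ^ 2 ≤ c * qq p z w * ‖R‖ ^ 2 := by
      have : (⟪a, R⟫) ^ 2 ≤ (‖a‖ * ‖R‖) ^ 2 := sq_le_sq' (by linarith [neg_abs_le ⟪a, R⟫]) (by linarith [le_abs_self ⟪a, R⟫])
      rw [mul_pow] at this
      exact this.trans (mul_le_mul_of_nonneg_right h1 (sq_nonneg _))
    have h4 : (2 * t * ⟪a, R⟫) ^ 2 ≤ ((1/2) * (t ^ 2 * qq p z w) + 2 * c * ‖R‖ ^ 2) ^ 2 := by
      have := sq_nonneg ((1/2) * (t ^ 2 * qq p z w) - 2 * c * ‖R‖ ^ 2)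
      have h5 := mul_le_mul_of_nonneg_left h3 (sq_nonneg t)
      nlinarith
    have h6 := abs_le_of_sq_le_sq h4 (by positivity)
    linarith [neg_abs_le (2 * t * ⟪a, R⟫)]
  have b2 : -(2 * κ * t * ⟪d, R⟫) ≤ (1/2) * (t ^ 2 * (κ * ‖d‖ ^ 2)) + 2 * κ * ‖R‖ ^ 2 := by
    have h2 : |⟪d, R⟫| ≤ ‖d‖ * ‖R‖ := abs_real_inner_le_norm d R
    have h3 : -(2 * t * ⟪d, R⟫) ≤ 2 * |t| * (‖d‖ * ‖R‖) := by
      have : |t * ⟪d, R⟫| ≤ |t| * (‖d‖ * ‖R‖) := by rw [abs_mul]; gcongr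
      linarith [neg_abs_le (t * ⟪d, R⟫)]
    have h4 : 2 * |t| * (‖d‖ * ‖R‖) ≤ (1/2) * (t ^ 2 * ‖d‖ ^ 2) + 2 * ‖R‖ ^ 2 := by
      have := sq_nonneg (|t| * ‖d‖ - 2 * ‖R‖)
      rw [← sq_abs t]; nlinarith
    have := mul_le_mul_of_nonneg_left (h3.trans h4) hκ
    nlinarith
  nlinarith

structure Loc (u : Fin N → EVec n → ℝ) (g : Fin N → Fin n → EVec n → ℝ) (T : Fin N → Fin n → EVec n → ℝ)
    (η : EVec n → ℝ) (p : ℝ → ℝ) (κ δ : ℝ) (CT : ℝ) : Prop where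
  wd : ∀ a i, WD i (u a) (g a i)
  hT : ∀ a i, ContDiff ℝ 1 (T a i)
  hη : ContDiff ℝ 1 η
  hηc : HasCompactSupport η
  δpos : 0 < δ
  eq : ∀ h, 0 < h → h < δ → ∀ j : Fin n,
    ∫ x, ⟪AA p (tm fun a i => g a i (x + h • ev j)) - AA p (tm fun a i => g a i x)
      + κ • ((tm fun a i => g a i (x + h • ev j)) - tm fun a i => g a i x),
      η x ^ 2 • ((tm fun a i => g a i (x + h • ev j)) - tm fun a i => g a i x) +
       (2 * η x) • (tm fun a i => (u a (x + h • ev j) - u a x) * fderiv ℝ η x (ev i))⟫ =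
    ∑ a, ∑ i, ∫ x, (T a i (x + h • ev j) - T a i x) * (η x ^ 2 * (g a i (x + h • ev j) - g a i x) +
      2 * η x * fderiv ℝ η x (ev i) * (u a (x + h • ev j) - u a x))
  lip : ∀ h, 0 < h → h < δ → ∀ j : Fin n, ∀ x ∈ tsupport η, ∀ a i,
    |fderiv ℝ (T a i) (x + h • ev j) (ev i) - fderiv ℝ (T a i) x (ev i)| ≤ CT * h

variable {u : Fin N → EVec n → ℝ} {g : Fin N → Fin n → EVec n → ℝ} {T : Fin N → Fin n → EVec n → ℝ}
    {η : EVec n → ℝ} {p : ℝ → ℝ} {κ δ : ℝ} {CT : ℝ}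

theorem abs_le_norm_tm (z : Fin N → Fin n → ℝ) (a : Fin N) (i : Fin n) : |z a i| ≤ ‖tm z‖ := by
  have := PiLp.norm_apply_le (tm z) (a, i)
  simpa [tm_apply] using this

theorem norm_tm_sq (z : Fin N → Fin n → ℝ) : ‖tm z‖ ^ 2 = ∑ a, ∑ i, z a i ^ 2 := by
  rw [← real_inner_self_eq_norm_sq, inner_tm]
  simp [mdot, sq]

theorem norm_tm_le_sum (z : Fin N → Fin n → ℝ) : ‖tm z‖ ≤ ∑ a, ∑ i, |z a i| := by
  rw [← abs_of_nonneg (norm_nonneg (tm z)), ← abs_of_nonneg (show 0 ≤ ∑ a, ∑ i, |z a i| by positivity), ← sq_le_sq, norm_tm_sq]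
  rw [← Fintype.sum_prod_type' (f := fun a i => z a i ^ 2), ← Fintype.sum_prod_type' (f := fun a i => |z a i|)]
  have := Finset.sum_sq_le_sq_sum_of_nonneg (s := Finset.univ) (f := fun q : Fin N × Fin n => |z q.1 q.2|) (fun q _ => abs_nonneg _)
  simpa [sq_abs] using this

theorem memLp_tm_of {μ : Measure (EVec n)} (hg : ∀ a i, MemLp (g a i) 2 μ) : MemLp (fun x => tm fun a i => g a i x) 2 μ := by
  have m : AEStronglyMeasurable (fun x => tm fun a i => g a i x) μ := by
    refine tm.continuous.comp_aestronglyMeasurable ?_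
    refine (aemeasurable_pi_lambda _ fun a => aemeasurable_pi_lambda _ fun i => (hg a i).1.aemeasurable).aestronglyMeasurable
  rw [memLp_two_iff_integrable_sq_norm m]
  simp only [norm_tm_sq]
  exact integrable_finsetSum _ fun a _ => integrable_finsetSum _ fun i _ => (hg a i).integrable_sq

theorem Loc.T_term (D : Loc u g T η p κ δ CT) {h : ℝ} (hh : 0 < h) (hδ : h < δ) (j : Fin n) (hη1 : ∀ x, |η x| ≤ 1) (a : Fin N) (i : Fin n) :
    ∫ x, (T a i (x + h • ev j) - T a i x) * (η x ^ 2 * (g a i (x + h • ev j) - g a i x) +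
      2 * η x * fderiv ℝ η x (ev i) * (u a (x + h • ev j) - u a x)) ≤
    h ^ 2 * (CT * ∫ x in tsupport η, |dq h j (u a) x|) := by
  have W := ((D.wd a i).translate (h • ev j)).sub (D.wd a i)
  have hT1 : ContDiff ℝ 1 (fun x => T a i (x + h • ev j) - T a i x) := by
    have := D.hT a i
    fun_prop
  have hη := D.hη
  have hφ : ContDiff ℝ 1 (fun x => η x ^ 2 * (T a i (x + h • ev j) - T a i x)) := (hη.pow 2).mul hT1
  have hη2 : HasCompactSupport (fun x => η x ^ 2) := D.hηc.comp_left (g := fun t : ℝ => t ^ 2) (by norm_num)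
  have h1 := W.wd _ hφ hη2.mul_right
  have fd : ∀ x, fderiv ℝ (fun x => η x ^ 2 * (T a i (x + h • ev j) - T a i x)) x (ev i) =
      2 * η x * fderiv ℝ η x (ev i) * (T a i (x + h • ev j) - T a i x) + η x ^ 2 * (fderiv ℝ (T a i) (x + h • ev j) (ev i) - fderiv ℝ (T a i) x (ev i)) := by
    intro x
    have d1 : DifferentiableAt ℝ η x := hη.differentiable (by norm_num) x
    have d2 := (D.hT a i).differentiable (by norm_num)
    have d3 : DifferentiableAt ℝ (fun x => T a i (x + h • ev j)) x := by fun_prop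
    have d4 : DifferentiableAt ℝ (fun x => η x ^ 2) x := by fun_prop
    have d5 : DifferentiableAt ℝ (fun x => T a i (x + h • ev j) - T a i x) x := by fun_prop
    rw [fderiv_fun_mul d4 d5, fderiv_fun_sub d3 (d2 x), fderiv_comp_add_right, fderiv_fun_pow 2 d1]
    simp; ring
  simp only [fd] at h1
  have cT : Continuous (fun x => (T a i (x + h • ev j) - T a i x)) := hT1.continuous
  have cdT : Continuous (fun x => fderiv ℝ (T a i) (x + h • ev j) (ev i) - fderiv ℝ (T a i) x (ev i)) := by
    have := cont_fd (D.hT a i) (ev i)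
    fun_prop
  have cη := hη.continuous
  have cdη := cont_fd hη (ev i)
  have hWl := W.mu.locallyIntegrable (by norm_num)
  have hGl := W.mg.locallyIntegrable (by norm_num)
  have c1 : HasCompactSupport (fun x => 2 * η x * fderiv ℝ η x (ev i) * (T a i (x + h • ev j) - T a i x)) :=
    (D.hηc.mul_left (f := fun _ => (2:ℝ))).mul_right.mul_right
  have c2 : HasCompactSupport (fun x => η x ^ 2 * (fderiv ℝ (T a i) (x + h • ev j) (ev i) - fderiv ℝ (T a i) x (ev i))) := hη2.mul_right
  have i1 := int_mul_test hWl (by fun_prop) c1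
  have i2 := int_mul_test hWl (by fun_prop) c2
  have i3 := int_mul_test hGl hφ.continuous hη2.mul_right
  simp only [mul_add] at h1
  rw [integral_add i1 i2] at h1
  have e1 : ∀ x, (T a i (x + h • ev j) - T a i x) * (η x ^ 2 * (g a i (x + h • ev j) - g a i x) +
      2 * η x * fderiv ℝ η x (ev i) * (u a (x + h • ev j) - u a x)) =
     (g a i (x + h • ev j) - g a i x) * (η x ^ 2 * (T a i (x + h • ev j) - T a i x)) +
     (u a (x + h • ev j) - u a x) * (2 * η x * fderiv ℝ η x (ev i) * (T a i (x + h • ev j) - T a i x)) := fun x => by ring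
  simp only [e1]
  rw [integral_add i3 i1]
  have e2 : h ^ 2 * (CT * ∫ x in tsupport η, |dq h j (u a) x|) = ∫ x, (tsupport η).indicator (fun x => (h ^ 2 * CT) * |dq h j (u a) x|) x := by
    rw [integral_indicator (isClosed_tsupport η).measurableSet, integral_const_mul]; ring
  rw [e2]
  have e3 : (∫ x, (g a i (x + h • ev j) - g a i x) * (η x ^ 2 * (T a i (x + h • ev j) - T a i x))) +
     (∫ x, (u a (x + h • ev j) - u a x) * (2 * η x * fderiv ℝ η x (ev i) * (T a i (x + h • ev j) - T a i x))) =
     - ∫ x, (u a (x + h • ev j) - u a x) * (η x ^ 2 * (fderiv ℝ (T a i) (x + h • ev j) (ev i) - fderiv ℝ (T a i) x (ev i))) := by linarith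
  rw [e3, ← integral_neg]
  refine integral_mono i2.neg ?_ fun x => ?_
  · rw [integrable_indicator_iff (isClosed_tsupport η).measurableSet]
    refine Integrable.const_mul ?_ _
    exact (((memLp_dq (D.wd a i).mu h j).locallyIntegrable (by norm_num)).integrableOn_isCompact D.hηc.isCompact).abs
  · by_cases hx : x ∈ tsupport η
    · rw [indicator_of_mem hx]
      have l := D.lip h hh hδ j x hx a i
      have e4 : u a (x + h • ev j) - u a x = h * dq h j (u a) x := by
        unfold dq; field_simp
      simp only
      rw [e4]
      set y := fderiv ℝ (T a i) (x + h • ev j) (ev i) - fderiv ℝ (T a i) x (ev i)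
      set d := dq h j (u a) x
      have hη1x := hη1 x
      have : η x ^ 2 ≤ 1 := by rw [← sq_abs]; exact pow_le_one₀ (abs_nonneg _) hη1x
      calc -(h * d * (η x ^ 2 * y)) ≤ |h * d * (η x ^ 2 * y)| := neg_le_abs _
        _ = h * |d| * (η x ^ 2 * |y|) := by
          rw [abs_mul, abs_mul, abs_mul, abs_of_pos hh, abs_of_nonneg (sq_nonneg (η x))]
        _ ≤ h * |d| * (1 * (CT * h)) := by gcongr
        _ = h ^ 2 * CT * |d| := by ring
    · rw [indicator_of_notMem hx, image_eq_zero_of_notMem_tsupport hx]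
      simp

end PE
end MPE

section MPF2
section PF2
variable {n N : ℕ}
variable {u : Fin N → EVec n → ℝ} {g : Fin N → Fin n → EVec n → ℝ} {T : Fin N → Fin n → EVec n → ℝ}
    {η : EVec n → ℝ} {p : ℝ → ℝ} {κ δ : ℝ} {CT : ℝ} {L : ℝ}

theorem main_pt (P : PF p L) (hκ : 0 ≤ κ) (hκ1 : κ ≤ 1) {b : ℝ} (hb : ∀ x i, |fderiv ℝ η x (ev i)| ≤ b) (h : ℝ) (hh : 0 < h) (j : Fin n) (x : EVec n) :
    (1/2) * (η x ^ 2 * (qq p (tm fun a i => g a i (x + h • ev j)) (tm fun a i => g a i x) + κ * ‖(tm fun a i => g a i (x + h • ev j)) - tm fun a i => g a i x‖ ^ 2)) ≤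
    ⟪AA p (tm fun a i => g a i (x + h • ev j)) - AA p (tm fun a i => g a i x)
      + κ • ((tm fun a i => g a i (x + h • ev j)) - tm fun a i => g a i x),
      η x ^ 2 • ((tm fun a i => g a i (x + h • ev j)) - tm fun a i => g a i x) +
       (2 * η x) • (tm fun a i => (u a (x + h • ev j) - u a x) * fderiv ℝ η x (ev i))⟫ +
    (tsupport η).indicator (fun x => h ^ 2 * (n * b ^ 2) * ((8 * L + 4) * ∑ a, (dq h j (u a) x - g a j x) ^ 2
      + 8 * L * (‖tm fun a i => g a i x‖ + ∑ a, ∑ i, |‖tm fun a i => g a i x‖ * (g a i (x + h • ev j) - g a i x)|)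
      + 4 * (κ * ‖tm fun a i => g a i x‖ ^ 2))) x := by
  have Lp := P.L_pos
  set z := tm fun a i => g a i (x + h • ev j) with hz
  set w := tm fun a i => g a i x with hw
  set R := tm fun a i => (u a (x + h • ev j) - u a x) * fderiv ℝ η x (ev i) with hR
  refine (P.caccio_pt z w R (η x) κ hκ).trans ?_
  gcongr
  by_cases hx : x ∈ tsupport η
  swap
  · have : fderiv ℝ η x = 0 := by
      have := support_fderiv_subset ℝ (f := η)
      by_contra h0; exact hx (this h0)
    have R0 : R = 0 := by
      rw [hR, this]; simp only [ContinuousLinearMap.zero_apply, mul_zero]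
      exact map_zero tm
    rw [indicator_of_notMem hx, R0]; simp
  rw [indicator_of_mem hx]
  set D := ∑ a, (dq h j (u a) x - g a j x) ^ 2 with hD
  have Dn : 0 ≤ D := Finset.sum_nonneg fun _ _ => sq_nonneg _
  have hR2 : ‖R‖ ^ 2 ≤ h ^ 2 * (n * b ^ 2) * (2 * D + 2 * ∑ a, g a j x ^ 2) := by
    rw [hR, norm_tm_sq, hD]
    have : ∀ a, ∑ i, ((u a (x + h • ev j) - u a x) * fderiv ℝ η x (ev i)) ^ 2 ≤ h ^ 2 * (n * b ^ 2) * (2 * (dq h j (u a) x - g a j x) ^ 2 + 2 * g a j x ^ 2) := by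
      intro a
      have e4 : u a (x + h • ev j) - u a x = h * dq h j (u a) x := by
        unfold dq; field_simp
      have : ∀ i ∈ Finset.univ, ((u a (x + h • ev j) - u a x) * fderiv ℝ η x (ev i)) ^ 2 ≤ h ^ 2 * b ^ 2 * (2 * (dq h j (u a) x - g a j x) ^ 2 + 2 * g a j x ^ 2) := by
        intro i _
        rw [e4]
        have h1 : fderiv ℝ η x (ev i) ^ 2 ≤ b ^ 2 := by
          rw [← sq_abs]; exact pow_le_pow_left₀ (abs_nonneg _) (hb x i) 2
        have h2 : dq h j (u a) x ^ 2 ≤ 2 * (dq h j (u a) x - g a j x) ^ 2 + 2 * g a j x ^ 2 := by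
          nlinarith [sq_nonneg (dq h j (u a) x - 2 * g a j x)]
        calc (h * dq h j (u a) x * fderiv ℝ η x (ev i)) ^ 2 = h ^ 2 * (fderiv ℝ η x (ev i)) ^ 2 * (dq h j (u a) x ^ 2) := by ring
          _ ≤ _ := by gcongr
      refine (Finset.sum_le_card_nsmul _ _ _ this).trans (le_of_eq ?_)
      simp; ring
    refine (Finset.sum_le_sum fun a _ => this a).trans (le_of_eq ?_)
    rw [← Finset.mul_sum, Finset.sum_add_distrib, ← Finset.mul_sum, ← Finset.mul_sum]
  have hg2 : ∑ a, g a j x ^ 2 ≤ ‖w‖ ^ 2 := by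
    rw [hw, norm_tm_sq]
    exact Finset.sum_le_sum fun a _ => Finset.single_le_sum (f := fun i => g a i x ^ 2) (fun _ _ => sq_nonneg _) (Finset.mem_univ j)
  set m := min ‖z‖ ‖w‖ with hm
  have hm0 : 0 ≤ m := le_min (norm_nonneg _) (norm_nonneg _)
  have hwb : ‖w‖ ^ 2 / (1 + m) ≤ ‖w‖ + ‖w‖ * ‖z - w‖ := weight_bound _ _ _ (norm_nonneg _) le_rfl
  have hzw : ‖w‖ * ‖z - w‖ ≤ ∑ a, ∑ i, |‖w‖ * (g a i (x + h • ev j) - g a i x)| := by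
    have : z - w = tm fun a i => g a i (x + h • ev j) - g a i x := by rw [hz, hw, ← map_sub]; rfl
    rw [this]
    have := norm_tm_le_sum fun a i => g a i (x + h • ev j) - g a i x
    simp only [abs_mul, abs_norm, ← Finset.mul_sum]
    gcongr
  have hnb : 0 ≤ h ^ 2 * (n * b ^ 2) := by positivity
  have i1 : (2 * (2 * L / (1 + m)) + 2 * κ) * (2 * D + 2 * ‖w‖ ^ 2) ≤ (8 * L + 4) * D + 8 * L * (‖w‖ ^ 2 / (1 + m)) + 4 * (κ * ‖w‖ ^ 2) := by
    have i2 : L / (1 + m) ≤ L := div_le_self Lp.le (by linarith)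
    have i3 : L / (1 + m) * D ≤ L * D := by gcongr
    have i4 : κ * D ≤ 1 * D := by gcongr
    have e1 : 2 * L / (1 + m) = 2 * (L / (1 + m)) := by ring
    have e2 : ‖w‖ ^ 2 / (1 + m) * L = L / (1 + m) * ‖w‖ ^ 2 := by ring
    rw [e1]
    nlinarith
  have c0 : 0 ≤ (2 * (2 * L / (1 + m)) + 2 * κ) := by positivity
  calc (2 * (2 * L / (1 + m)) + 2 * κ) * ‖R‖ ^ 2 ≤ (2 * (2 * L / (1 + m)) + 2 * κ) * (h ^ 2 * (n * b ^ 2) * (2 * D + 2 * ‖w‖ ^ 2)) := by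
        refine mul_le_mul_of_nonneg_left (hR2.trans ?_) c0
        gcongr
    _ = h ^ 2 * (n * b ^ 2) * ((2 * (2 * L / (1 + m)) + 2 * κ) * (2 * D + 2 * ‖w‖ ^ 2)) := by ring
    _ ≤ h ^ 2 * (n * b ^ 2) * ((8 * L + 4) * D + 8 * L * (‖w‖ ^ 2 / (1 + m)) + 4 * (κ * ‖w‖ ^ 2)) := by gcongr
    _ ≤ _ := by
      gcongr
      linarith

theorem aesm_AA (P : PF p L) {μ : Measure (EVec n)} {Z : EVec n → HM N n} (hZ : MemLp Z 2 μ) : MemLp (fun x => AA p (Z x)) 2 μ := by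
  refine MemLp.of_le_mul (c := 2 * L) hZ (P.AA_cont.comp_aestronglyMeasurable hZ.1) (ae_of_all _ fun x => ?_)
  have := P.AA_lip (Z x) 0
  simpa [PF.AA_zero] using this

theorem abs_dq_int {S : Set (EVec n)} (hS : IsCompact S) {i : Fin n} {v gv : EVec n → ℝ} (W : WD i v gv) (h : ℝ) :
    ∫ x in S, |dq h i v x| ≤ n2 (S.indicator fun _ => (1:ℝ)) * n2 (fun x => dq h i v x - gv x) + ∫ x in S, |gv x| := by
  have m1 : MemLp (S.indicator fun _ => (1:ℝ)) 2 (volume : Measure (EVec n)) :=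
    memLp_indicator_const 2 hS.measurableSet 1 (Or.inr hS.measure_lt_top.ne)
  have m2 := (memLp_dq W.mu h i).sub W.mg
  have i1 : IntegrableOn gv S := (W.mg.locallyIntegrable (by norm_num)).integrableOn_isCompact hS
  have i2 : IntegrableOn (dq h i v) S := ((memLp_dq W.mu h i).locallyIntegrable (by norm_num)).integrableOn_isCompact hS
  have i3 : IntegrableOn (fun x => |dq h i v x - gv x|) S := (i2.sub i1).abs
  have := n2_cs_abs m1 m2
  calc ∫ x in S, |dq h i v x| ≤ ∫ x in S, (|dq h i v x - gv x| + |gv x|) := by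
        refine integral_mono i2.abs (i3.add i1.abs) fun x => ?_
        have := abs_add_le (dq h i v x - gv x) (gv x)
        simpa using this
    _ = (∫ x in S, |dq h i v x - gv x|) + ∫ x in S, |gv x| := integral_add i3 i1.abs
    _ ≤ _ := by
      gcongr
      refine le_trans (le_of_eq ?_) this
      rw [← integral_indicator hS.measurableSet]
      congr 1; ext x
      by_cases hx : x ∈ S <;> simp [hx]

theorem Loc.main (P : PF p L) (D : Loc u g T η p κ δ CT) (hκ : 0 ≤ κ) (hκ1 : κ ≤ 1) (hη1 : ∀ x, |η x| ≤ 1) {b : ℝ} (hb : ∀ x i, |fderiv ℝ η x (ev i)| ≤ b)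
    (hCT : 0 ≤ CT) {M0 : ℝ} (hM : ∫ x in tsupport η, ‖tm fun a i => g a i x‖ ≤ M0) (hM2 : κ * ∫ x in tsupport η, ‖tm fun a i => g a i x‖ ^ 2 ≤ M0) (j : Fin n) :
    ∀ᶠ h in 𝓝[>] (0:ℝ), ∫ x, η x ^ 2 * (qq p (tm fun a i => g a i (x + h • ev j)) (tm fun a i => g a i x) + κ * ‖(tm fun a i => g a i (x + h • ev j)) - tm fun a i => g a i x‖ ^ 2) ≤
      2 * (CT * (N * n * M0) + n * b ^ 2 * (8 * L * M0 + 4 * M0) + 1) * h ^ 2 := by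
  have Lp := P.L_pos
  set S := tsupport η with hS
  have Sc : IsCompact S := D.hηc.isCompact
  set s := n2 (S.indicator fun _ => (1:ℝ)) with hs
  set Z : EVec n → HM N n := fun x => tm fun a i => g a i x with hZ
  have mZ : MemLp Z 2 volume := memLp_tm_of fun a i => (D.wd a i).mg
  have mZn : MemLp (fun x => ‖Z x‖) 2 volume := mZ.norm
  let F : ℝ → ℝ := fun h => CT * ∑ a, ∑ i : Fin n, (s * n2 (fun x => dq h j (u a) x - g a j x) + M0) + n * b ^ 2 * ((8 * L + 4) * ∑ a, n2 (fun x => dq h j (u a) x - g a j x) ^ 2 +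
     8 * L * (M0 + ∑ a, ∑ i, n2 (fun x => ‖Z x‖) * n2 (fun x => g a i (x + h • ev j) - g a i x)) + 4 * M0)
  have hF : Tendsto F (𝓝[>] 0) (𝓝 (CT * ∑ a : Fin N, ∑ i : Fin n, (s * 0 + M0) + n * b ^ 2 * ((8 * L + 4) * ∑ a : Fin N, (0:ℝ) ^ 2 +
     8 * L * (M0 + ∑ a : Fin N, ∑ i : Fin n, n2 (fun x => ‖Z x‖) * 0) + 4 * M0))) := by
    have t1 : ∀ a, Tendsto (fun h => n2 (fun x => dq h j (u a) x - g a j x)) (𝓝[>] 0) (𝓝 0) := fun a => (D.wd a j).dq_tendsto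
    have t2 : ∀ a i, Tendsto (fun h : ℝ => n2 (fun x => g a i (x + h • ev j) - g a i x)) (𝓝[>] 0) (𝓝 0) := fun a i =>
      ((n2_translate_tendsto (D.wd a i).mg).comp (tendsto_smul_ev j)).mono_left nhdsWithin_le_nhds
    refine Tendsto.add (Tendsto.const_mul _ ?_) (Tendsto.const_mul _ (Tendsto.add (Tendsto.add (Tendsto.const_mul _ ?_) (Tendsto.const_mul _ (Tendsto.add tendsto_const_nhds ?_))) tendsto_const_nhds))
    · exact tendsto_finsetSum _ fun a _ => tendsto_finsetSum _ fun i _ => ((t1 a).const_mul s).add tendsto_const_nhds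
    · exact tendsto_finsetSum _ fun a _ => (t1 a).pow 2
    · exact tendsto_finsetSum _ fun a _ => tendsto_finsetSum _ fun i _ => (t2 a i).const_mul _
  have hF1 : ∀ᶠ h in 𝓝[>] (0:ℝ), F h ≤ CT * (N * n * M0) + n * b ^ 2 * (8 * L * M0 + 4 * M0) + 1 := by
    refine hF.eventually_le_const ?_
    simp
    refine lt_of_le_of_lt (le_of_eq ?_) (lt_add_one _)
    ring
  have hδ : ∀ᶠ h in 𝓝[>] (0:ℝ), h < δ := nhdsWithin_le_nhds (gt_mem_nhds D.δpos)
  filter_upwards [hF1, hδ, self_mem_nhdsWithin] with h hh1 hh2 (hh0 : 0 < h)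
  have mZh : MemLp (fun x => Z (x + h • ev j)) 2 volume := memLp_tm_of fun a i => memLp_translate (D.wd a i).mg _
  have cη := D.hη.continuous
  have bη2 : ∀ x, |η x ^ 2| ≤ 1 := fun x => by rw [abs_pow]; exact pow_le_one₀ (abs_nonneg _) (hη1 x)
  have mR : MemLp (fun x => tm fun a i => (u a (x + h • ev j) - u a x) * fderiv ℝ η x (ev i)) 2 volume := by
    refine memLp_tm_of (g := fun a i x => (u a (x + h • ev j) - u a x) * fderiv ℝ η x (ev i)) fun a i => ?_
    have m := (memLp_translate (D.wd a i).mu (h • ev j)).sub (D.wd a i).mu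
    refine MemLp.of_le_mul (c := b) m (m.1.mul (cont_fd D.hη (ev i)).aestronglyMeasurable) (ae_of_all _ fun x => ?_)
    rw [norm_mul, mul_comm]
    exact mul_le_mul_of_nonneg_right (hb x i) (norm_nonneg _)
  have mI1 : MemLp (fun x => AA p (Z (x + h • ev j)) - AA p (Z x) + κ • (Z (x + h • ev j) - Z x)) 2 volume :=
    ((aesm_AA P mZh).sub (aesm_AA P mZ)).add ((mZh.sub mZ).const_smul κ)
  have mI2 : MemLp (fun x => η x ^ 2 • (Z (x + h • ev j) - Z x) + (2 * η x) • (tm fun a i => (u a (x + h • ev j) - u a x) * fderiv ℝ η x (ev i))) 2 volume := by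
    have m := mZh.sub mZ
    refine MemLp.add ?_ ?_
    · refine MemLp.of_le m ((by fun_prop : Continuous fun x => η x ^ 2).aestronglyMeasurable.smul m.1) (ae_of_all _ fun x => ?_)
      rw [norm_smul]
      exact mul_le_of_le_one_left (norm_nonneg _) (bη2 x)
    · refine MemLp.of_le_mul (c := 2) mR ((by fun_prop : Continuous fun x => 2 * η x).aestronglyMeasurable.smul mR.1) (ae_of_all _ fun x => ?_)
      rw [norm_smul, norm_mul]
      have := hη1 x
      simp only [Real.norm_eq_abs, Nat.abs_ofNat]
      gcongr
      linarith
  have iI := int_inner mI1 mI2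
  have md : ∀ a, MemLp (fun x => dq h j (u a) x - g a j x) 2 volume := fun a => (memLp_dq (D.wd a j).mu h j).sub (D.wd a j).mg
  have mg' : ∀ a i, MemLp (fun x => g a i (x + h • ev j) - g a i x) 2 volume := fun a i => (memLp_translate (D.wd a i).mg _).sub (D.wd a i).mg
  have iZ : IntegrableOn (fun x => ‖Z x‖) S := (mZn.locallyIntegrable (by norm_num)).integrableOn_isCompact Sc
  have j1 : IntegrableOn (fun x => ∑ a, (dq h j (u a) x - g a j x) ^ 2) S := (integrable_finsetSum _ fun a _ => int_sq_L2 (md a)).integrableOn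
  have j2' : ∀ a i, Integrable (fun x => |‖Z x‖ * (g a i (x + h • ev j) - g a i x)|) := fun a i => (int_mul_L2 mZn (mg' a i)).abs
  have j2 : IntegrableOn (fun x => ∑ a, ∑ i, |‖Z x‖ * (g a i (x + h • ev j) - g a i x)|) S :=
    (integrable_finsetSum _ fun a _ => integrable_finsetSum _ fun i _ => j2' a i).integrableOn
  have j3 : IntegrableOn (fun x => ‖Z x‖ ^ 2) S := (int_sq_L2 mZn).integrableOn
  have j4 : IntegrableOn (fun x => (8 * L + 4) * ∑ a, (dq h j (u a) x - g a j x) ^ 2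
      + 8 * L * (‖Z x‖ + ∑ a, ∑ i, |‖Z x‖ * (g a i (x + h • ev j) - g a i x)|)
      + 4 * (κ * ‖Z x‖ ^ 2)) S := ((j1.const_mul _).add ((iZ.add j2).const_mul _)).add ((j3.const_mul _).const_mul _)
  have j5 : Integrable (S.indicator (fun x => h ^ 2 * (n * b ^ 2) * ((8 * L + 4) * ∑ a, (dq h j (u a) x - g a j x) ^ 2
      + 8 * L * (‖Z x‖ + ∑ a, ∑ i, |‖Z x‖ * (g a i (x + h • ev j) - g a i x)|)
      + 4 * (κ * ‖Z x‖ ^ 2)))) := (integrable_indicator_iff Sc.measurableSet).2 (j4.const_mul _)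
  have key := integral_mono_of_nonneg (μ := (volume : Measure (EVec n))) (ae_of_all _ fun x => ?_) (iI.add j5) (ae_of_all _ fun x => main_pt (u := u) (g := g) P hκ hκ1 hb h hh0 j x)
  swap
  · have := P.qq_nonneg (tm fun a i => g a i (x + h • ev j)) (tm fun a i => g a i x)
    positivity
  rw [integral_const_mul] at key
  have e0 := integral_add iI j5
  simp only [Pi.add_apply] at key
  have key2 := key.trans (le_of_eq e0)
  rw [D.eq h hh0 hh2 j, integral_indicator Sc.measurableSet, integral_const_mul] at key2
  have b1 : ∑ a, ∑ i, ∫ x, (T a i (x + h • ev j) - T a i x) * (η x ^ 2 * (g a i (x + h • ev j) - g a i x) +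
      2 * η x * fderiv ℝ η x (ev i) * (u a (x + h • ev j) - u a x)) ≤ h ^ 2 * (CT * ∑ a, ∑ i : Fin n, (s * n2 (fun x => dq h j (u a) x - g a j x) + M0)) := by
    rw [Finset.mul_sum, Finset.mul_sum]
    refine Finset.sum_le_sum fun a _ => ?_
    rw [Finset.mul_sum, Finset.mul_sum]
    refine Finset.sum_le_sum fun i _ => ?_
    refine (D.T_term hh0 hh2 j hη1 a i).trans ?_
    gcongr
    refine (abs_dq_int Sc (D.wd a j) h).trans ?_
    gcongr
    refine le_trans (integral_mono ?_ iZ fun x => abs_le_norm_tm (fun a i => g a i x) a j) hM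
    exact (((D.wd a j).mg.locallyIntegrable (by norm_num)).integrableOn_isCompact Sc).abs
  have b2 : ∫ x in S, ((8 * L + 4) * ∑ a, (dq h j (u a) x - g a j x) ^ 2
      + 8 * L * (‖Z x‖ + ∑ a, ∑ i, |‖Z x‖ * (g a i (x + h • ev j) - g a i x)|)
      + 4 * (κ * ‖Z x‖ ^ 2)) ≤ ((8 * L + 4) * ∑ a, n2 (fun x => dq h j (u a) x - g a j x) ^ 2 +
     8 * L * (M0 + ∑ a, ∑ i, n2 (fun x => ‖Z x‖) * n2 (fun x => g a i (x + h • ev j) - g a i x)) + 4 * M0) := by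
    have q1 : IntegrableOn (fun x => (8 * L + 4) * ∑ a, (dq h j (u a) x - g a j x) ^ 2) S := j1.const_mul _
    have q2 : IntegrableOn (fun x => 8 * L * (‖Z x‖ + ∑ a, ∑ i, |‖Z x‖ * (g a i (x + h • ev j) - g a i x)|)) S := (iZ.add j2).const_mul _
    have q3 : IntegrableOn (fun x => 4 * (κ * ‖Z x‖ ^ 2)) S := (j3.const_mul _).const_mul _
    rw [integral_add (iadd q1 q2) q3, integral_add q1 q2, integral_const_mul, integral_const_mul, integral_add iZ j2, integral_const_mul, integral_const_mul]
    have r1 : ∫ x in S, ∑ a, (dq h j (u a) x - g a j x) ^ 2 ≤ ∑ a, n2 (fun x => dq h j (u a) x - g a j x) ^ 2 := by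
      refine (setIntegral_le_integral (integrable_finsetSum _ fun a _ => int_sq_L2 (md a)) (ae_of_all _ fun x => Finset.sum_nonneg fun _ _ => sq_nonneg _)).trans ?_
      rw [integral_finsetSum _ fun a _ => int_sq_L2 (md a)]
      refine Finset.sum_le_sum fun a _ => ?_
      rw [n2_sq (md a)]
    have r2 : ∫ x in S, ∑ a, ∑ i, |‖Z x‖ * (g a i (x + h • ev j) - g a i x)| ≤ ∑ a, ∑ i, n2 (fun x => ‖Z x‖) * n2 (fun x => g a i (x + h • ev j) - g a i x) := by
      refine (setIntegral_le_integral (integrable_finsetSum _ fun a _ => integrable_finsetSum _ fun i _ => j2' a i) (ae_of_all _ fun x => Finset.sum_nonneg fun _ _ => Finset.sum_nonneg fun _ _ => abs_nonneg _)).trans ?_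
      rw [integral_finsetSum _ fun a _ => integrable_finsetSum _ fun i _ => j2' a i]
      refine Finset.sum_le_sum fun a _ => ?_
      rw [integral_finsetSum _ fun i _ => j2' a i]
      exact Finset.sum_le_sum fun i _ => n2_cs_abs mZn (mg' a i)
    gcongr
  have b3 := mul_le_mul_of_nonneg_left b2 (show 0 ≤ h ^ 2 * (n * b ^ 2) by positivity)
  have b4 : h ^ 2 * F h ≤ h ^ 2 * (CT * (N * n * M0) + n * b ^ 2 * (8 * L * M0 + 4 * M0) + 1) := by gcongr
  have b5 : h ^ 2 * F h = h ^ 2 * (CT * ∑ a, ∑ i : Fin n, (s * n2 (fun x => dq h j (u a) x - g a j x) + M0)) + h ^ 2 * (n * b ^ 2) * ((8 * L + 4) * ∑ a, n2 (fun x => dq h j (u a) x - g a j x) ^ 2 +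
     8 * L * (M0 + ∑ a, ∑ i, n2 (fun x => ‖Z x‖) * n2 (fun x => g a i (x + h • ev j) - g a i x)) + 4 * M0) := by
    simp only [F]; ring
  have key3 := key2.trans (add_le_add b1 b3)
  rw [← b5] at key3
  have := key3.trans b4
  linarith

end PF2
end MPF2

section MPF3
section PF3
variable {n N : ℕ}

theorem cutoff {K U : Set (EVec n)} (hK : IsCompact K) (hU : IsOpen U) (hKU : K ⊆ U) :
    ∃ η : EVec n → ℝ, ContDiff ℝ 2 η ∧ HasCompactSupport η ∧ tsupport η ⊆ U ∧ (∀ x, η x ∈ Icc (0:ℝ) 1) ∧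
      ∃ O, IsOpen O ∧ K ⊆ O ∧ ∀ x ∈ O, η x = 1 := by
  obtain ⟨t, tc, h1, h2⟩ := exists_compact_between hK hU hKU
  obtain ⟨f, f1, f2, f3⟩ := exists_contMDiffMap_one_nhds_of_subset_interior (modelWithCornersSelf ℝ (EVec n)) (n := 2) hK.isClosed h1
  have fs : tsupport f ⊆ t := by
    refine closure_minimal ?_ tc.isClosed
    intro x hx; by_contra h; exact hx (f2 x h)
  obtain ⟨O, hO1, hO2, hO3⟩ := (mem_nhdsSet_iff_exists).1 f1
  exact ⟨f, f.contMDiff.contDiff, HasCompactSupport.of_support_subset_isCompact tc ((subset_tsupport _).trans fs), fs.trans h2, f3, O, hO1, hO2, fun x hx => hO3 hx⟩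

theorem WD.setInt {Ω : Set (EVec n)} {i : Fin n} {v gv : EVec n → ℝ} (W : WD i v gv) {φ : EVec n → ℝ} (h1 : ContDiff ℝ 1 φ) (h2 : HasCompactSupport φ) (h3 : tsupport φ ⊆ Ω) :
    ∫ x in Ω, v x * fderiv ℝ φ x (ev i) = - ∫ x in Ω, gv x * φ x := by
  rw [setIntegral_eq_integral_of_forall_compl_eq_zero, setIntegral_eq_integral_of_forall_compl_eq_zero]
  · exact W.wd φ h1 h2
  · intro x hx; rw [image_eq_zero_of_notMem_tsupport (fun h => hx (h3 h)), mul_zero]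
  · intro x hx
    have : fderiv ℝ φ x = 0 := by
      by_contra h0; exact hx (h3 (support_fderiv_subset ℝ (f := φ) h0))
    rw [this]; simp

theorem memW12_of_WD {Ω : Set (EVec n)} (hfin : volume Ω ≠ ⊤) {ψ : Fin N → EVec n → ℝ} {ψ' : Fin N → Fin n → EVec n → ℝ}
    (W : ∀ a i, WD i (ψ a) (ψ' a i)) (m : ∀ a, MemLp (ψ a) 2 volume) : MemW12 Ω (fun x a => ψ a x) (fun x a i => ψ' a i x) := by
  haveI : IsFiniteMeasure (volume.restrict Ω) := ⟨by simpa using hfin.lt_top⟩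
  have i1 : ∀ {v : EVec n → ℝ}, MemLp v 2 volume → IntegrableOn v Ω := fun hv => (hv.restrict Ω).integrable (by norm_num)
  refine ⟨⟨?_, ?_, ?_⟩, ?_, ?_⟩
  · exact Integrable.of_eval fun a => i1 (m a)
  · exact Integrable.of_eval fun a => Integrable.of_eval fun i => i1 (W a i).mg
  · intro φ h1 h2 h3 a i
    exact (W a i).setInt h1 h2 h3
  · have : ∀ x, vnorm (fun a => ψ a x) ^ 2 = ∑ a, ψ a x ^ 2 := fun x => by
      unfold vnorm; rw [Real.sq_sqrt (Finset.sum_nonneg fun _ _ => sq_nonneg _)]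
    simp only [this]
    exact (integrable_finsetSum _ fun a _ => int_sq_L2 (m a)).integrableOn
  · simp only [← norm_tm, norm_tm_sq]
    exact (integrable_finsetSum _ fun a _ => integrable_finsetSum _ fun i _ => int_sq_L2 (W a i).mg).integrableOn

theorem loc_test {Ω : Set (EVec n)} (hΩ : IsOpen Ω) (hfin : volume Ω ≠ ⊤) {f p : ℝ → ℝ} {L : ℝ} (P : FP f p L) (h0 : f 0 = 0)
    {T₀ : EVec n → Fin N → Fin n → ℝ} (hT : MemLp (fun x => tm (T₀ x)) 2 (volume.restrict Ω)) (k : ℕ) {u : EVec n → Fin N → ℝ} {Du : EVec n → Fin N → Fin n → ℝ}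
    (hu : MemW12 Ω u Du) (hmin : ∀ (w : EVec n → Fin N → ℝ) (Dw : EVec n → Fin N → Fin n → ℝ),
        MemW12 Ω w Dw → FFk Ω f T₀ k Du ≤ FFk Ω f T₀ k Dw)
    {O : Set (EVec n)} (hO : O ⊆ Ω) {g : Fin N → Fin n → EVec n → ℝ} {T : Fin N → Fin n → EVec n → ℝ}
    (hg : ∀ x ∈ O, ∀ a i, g a i x = Du x a i) (hTO : ∀ x ∈ O, ∀ a i, T a i x = T₀ x a i)
    {ψ : Fin N → EVec n → ℝ} {ψ' : Fin N → Fin n → EVec n → ℝ}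
    (W : ∀ a i, WD i (ψ a) (ψ' a i)) (m : ∀ a, MemLp (ψ a) 2 volume) (hψ : ∀ x ∉ O, ∀ a i, ψ' a i x = 0) :
    ∫ x, ⟪AA p (tm fun a i => g a i x) + (k:ℝ)⁻¹ • (tm fun a i => g a i x) - tm fun a i => T a i x, tm fun a i => ψ' a i x⟫ = 0 := by
  have := euler_lagrange hΩ hfin P h0 hT k hu hmin (memW12_of_WD hfin W m)
  rw [← this, ← setIntegral_eq_integral_of_forall_compl_eq_zero (s := Ω)]
  · refine setIntegral_congr_fun hΩ.measurableSet fun x hx => ?_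
    by_cases hxO : x ∈ O
    · have e1 : (fun a i => g a i x) = Du x := by ext a i; exact hg x hxO a i
      have e2 : (fun a i => T a i x) = T₀ x := by ext a i; exact hTO x hxO a i
      rw [e1, e2]
    · have e1 : (fun a i => ψ' a i x) = 0 := by ext a i; exact hψ x hxO a i
      rw [e1]; simp
  · intro x hx
    have e1 : (fun a i => ψ' a i x) = 0 := by ext a i; exact hψ x (fun h => hx (hO h)) a i
    rw [e1]; simp

theorem MemW12.mu {Ω : Set (EVec n)} {u : EVec n → Fin N → ℝ} {Du : EVec n → Fin N → Fin n → ℝ} (hu : MemW12 Ω u Du) (a : Fin N) :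
    MemLp (fun x => u x a) 2 (volume.restrict Ω) := by
  have i : IntegrableOn (fun x => u x a) Ω := (ContinuousLinearMap.proj (R := ℝ) (φ := fun _ : Fin N => ℝ) a).integrable_comp hu.1.1
  rw [memLp_two_iff_integrable_sq i.1]
  refine Integrable.mono hu.2.1 (i.1.pow 2) (ae_of_all _ fun x => ?_)
  rw [Real.norm_of_nonneg (sq_nonneg _), Real.norm_of_nonneg (sq_nonneg _)]
  unfold vnorm
  rw [Real.sq_sqrt (Finset.sum_nonneg fun _ _ => sq_nonneg _)]
  exact Finset.single_le_sum (f := fun a => u x a ^ 2) (fun _ _ => sq_nonneg _) (Finset.mem_univ a)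

theorem MemW12.mdu {Ω : Set (EVec n)} {u : EVec n → Fin N → ℝ} {Du : EVec n → Fin N → Fin n → ℝ} (hu : MemW12 Ω u Du) (a : Fin N) (i : Fin n) :
    MemLp (fun x => Du x a i) 2 (volume.restrict Ω) := by
  have m := memLp_tm hu
  refine MemLp.of_le m ?_ (ae_of_all _ fun x => ?_)
  · have := (ContinuousLinearMap.proj (R := ℝ) (φ := fun _ : Fin N => Fin n → ℝ) a).integrable_comp hu.1.2.1
    exact ((ContinuousLinearMap.proj (R := ℝ) (φ := fun _ : Fin n => ℝ) i).integrable_comp this).1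
  · rw [Real.norm_eq_abs]; exact abs_le_norm_tm (Du x) a i

theorem T_smooth {Ω : Set (EVec n)} (hΩ : IsOpen Ω) {T₀ : EVec n → Fin N → Fin n → ℝ} {C : NNReal} {DT : EVec n → EVec n →L[ℝ] (Fin N → Fin n → ℝ)}
    (hd : ∀ x ∈ Ω, HasFDerivWithinAt T₀ (DT x) Ω x) (hl : LipschitzOnWith C DT Ω) {χ : EVec n → ℝ} (hχ : ContDiff ℝ 1 χ) (hs : tsupport χ ⊆ Ω) (a : Fin N) (i : Fin n) :
    ContDiff ℝ 1 (fun x => χ x * T₀ x a i) := by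
  have hT : ContDiffOn ℝ 1 T₀ Ω := by
    rw [show (1 : WithTop ℕ∞) = 0 + 1 by norm_num, contDiffOn_succ_iff_fderiv_of_isOpen hΩ]
    refine ⟨fun x hx => (hd x hx).differentiableWithinAt, by simp, ?_⟩
    rw [contDiffOn_zero]
    refine hl.continuousOn.congr fun x hx => ?_
    exact ((hd x hx).hasFDerivAt (hΩ.mem_nhds hx)).fderiv
  rw [contDiff_iff_contDiffAt]
  intro x
  by_cases hx : x ∈ tsupport χ
  · have h1 := (hT x (hs hx)).contDiffAt (hΩ.mem_nhds (hs hx))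
    rw [contDiffAt_pi] at h1
    have h2 := h1 a
    rw [contDiffAt_pi] at h2
    exact hχ.contDiffAt.mul (h2 i)
  · have : (fun x => χ x * T₀ x a i) =ᶠ[𝓝 x] fun _ => 0 := by
      filter_upwards [(isClosed_tsupport χ).isOpen_compl.mem_nhds hx] with y hy
      rw [image_eq_zero_of_notMem_tsupport hy, zero_mul]
    exact contDiffAt_const.congr_of_eventuallyEq this

theorem loc_mk {Ω : Set (EVec n)} (hΩ : IsOpen Ω) (hfin : volume Ω ≠ ⊤) {f p : ℝ → ℝ} {L : ℝ} (P : FP f p L) (h0 : f 0 = 0)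
    {T₀ : EVec n → Fin N → Fin n → ℝ} (hT : MemLp (fun x => tm (T₀ x)) 2 (volume.restrict Ω))
    {C : NNReal} {DT : EVec n → EVec n →L[ℝ] (Fin N → Fin n → ℝ)}
    (hd : ∀ x ∈ Ω, HasFDerivWithinAt T₀ (DT x) Ω x) (hl : LipschitzOnWith C DT Ω)
    (k : ℕ) {u : EVec n → Fin N → ℝ} {Du : EVec n → Fin N → Fin n → ℝ}
    (hu : MemW12 Ω u Du) (hmin : ∀ (w : EVec n → Fin N → ℝ) (Dw : EVec n → Fin N → Fin n → ℝ),
        MemW12 Ω w Dw → FFk Ω f T₀ k Du ≤ FFk Ω f T₀ k Dw)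
    {O : Set (EVec n)} (hOo : IsOpen O) (hO : O ⊆ Ω) {η χ : EVec n → ℝ} {δ : ℝ} (hη : ContDiff ℝ 1 η) (hηc : HasCompactSupport η)
    (hχ : ContDiff ℝ 1 χ) (hχc : HasCompactSupport χ) (hχs : tsupport χ ⊆ Ω) (hχO : ∀ x ∈ O, χ x = 1) (hδ : 0 < δ) (hδO : ∀ x ∈ tsupport η, ∀ y, dist y x < δ → y ∈ O) :
    Loc (fun a x => χ x * u x a) (fun a i x => χ x * Du x a i + fderiv ℝ χ x (ev i) * u x a) (fun a i x => χ x * T₀ x a i) η p ((k:ℝ)⁻¹) δ C := by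
  have wd : ∀ a i, WD i (fun x => χ x * u x a) (fun x => χ x * Du x a i + fderiv ℝ χ x (ev i) * u x a) := fun a i =>
    WD.of_local hΩ (hu.mu a) (hu.mdu a i) (fun φ h1 h2 h3 => hu.1.2.2 φ h1 h2 h3 a i) hχ hχc hχs
  have cT : ∀ a i, ContDiff ℝ 1 (fun x => χ x * T₀ x a i) := fun a i => T_smooth hΩ hd hl hχ hχs a i
  have mu : ∀ a, MemLp (fun x => χ x * u x a) 2 volume := by
    intro a
    obtain ⟨c, hc⟩ := hχc.exists_bound_of_continuous hχ.continuous
    have m1 : MemLp (Ω.indicator fun x => u x a) 2 volume := (memLp_indicator_iff_restrict hΩ.measurableSet).2 (hu.mu a)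
    have e : (fun x => χ x * u x a) = fun x => χ x * (Ω.indicator (fun x => u x a) x) := by
      ext x; by_cases hx : x ∈ Ω
      · simp [hx]
      · rw [image_eq_zero_of_notMem_tsupport fun h => hx (hχs h)]; simp
    rw [e]
    refine MemLp.of_le_mul (c := c) m1 (hχ.continuous.aestronglyMeasurable.mul m1.1) (ae_of_all _ fun x => ?_)
    rw [norm_mul]; exact mul_le_mul_of_nonneg_right (hc x) (norm_nonneg _)
  have fχ : ∀ x ∈ O, fderiv ℝ χ x = 0 := by
    intro x hx
    have : χ =ᶠ[𝓝 x] fun _ => 1 := by filter_upwards [hOo.mem_nhds hx] with y hy using hχO y hy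
    rw [this.fderiv_eq]; simp
  have gO : ∀ x ∈ O, ∀ a i, (fun a i x => χ x * Du x a i + fderiv ℝ χ x (ev i) * u x a) a i x = Du x a i := by
    intro x hx a i; simp [hχO x hx, fχ x hx]
  have TO : ∀ x ∈ O, ∀ a i, (fun a i x => χ x * T₀ x a i) a i x = T₀ x a i := by
    intro x hx a i; simp [hχO x hx]
  have hev : ∀ (h : ℝ) (j : Fin n) (x : EVec n), 0 < h → dist (x + h • ev j) x = h := by
    intro h j x hh; rw [dist_eq_norm]; simp [norm_smul, norm_ev, abs_of_pos hh]
  refine ⟨wd, cT, hη, hηc, hδ, ?_, ?_⟩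
  · intro h hh hhδ j
    set U : Fin N → EVec n → ℝ := fun a x => χ x * u x a with hU
    set g : Fin N → Fin n → EVec n → ℝ := fun a i x => χ x * Du x a i + fderiv ℝ χ x (ev i) * u x a with hg
    set T : Fin N → Fin n → EVec n → ℝ := fun a i x => χ x * T₀ x a i with hTd
    set ψ : Fin N → EVec n → ℝ := fun a x => η x ^ 2 * (U a (x + h • ev j) - U a x) with hψ
    set ψ' : Fin N → Fin n → EVec n → ℝ := fun a i x => η x ^ 2 * (g a i (x + h • ev j) - g a i x) +
      2 * η x * fderiv ℝ η x (ev i) * (U a (x + h • ev j) - U a x) with hψ'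
    have hη2 : HasCompactSupport (fun x => η x ^ 2) := hηc.comp_left (g := fun t : ℝ => t ^ 2) (by norm_num)
    have W : ∀ a i, WD i (ψ a) (ψ' a i) := by
      intro a i
      have := (((wd a i).translate (h • ev j)).sub (wd a i)).mul (hη.pow 2) hη2
      convert! this using 1
      ext x
      rw [fderiv_fun_pow 2 (hη.differentiable (by norm_num) x)]
      simp [hψ', hg, hU]
    have mψ : ∀ a, MemLp (ψ a) 2 volume := by
      intro a
      obtain ⟨c, hc⟩ := hη2.exists_bound_of_continuous (hη.continuous.pow 2)
      have m1 := (memLp_translate (mu a) (h • ev j)).sub (mu a)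
      refine MemLp.of_le_mul (c := c) m1 ((hη.continuous.pow 2).aestronglyMeasurable.mul m1.1) (ae_of_all _ fun x => ?_)
      rw [norm_mul]; exact mul_le_mul_of_nonneg_right (hc x) (norm_nonneg _)
    have z1 : ∀ x ∉ tsupport η, ∀ a i, ψ' a i x = 0 := by
      intro x hx a i
      simp only [hψ']
      rw [image_eq_zero_of_notMem_tsupport hx]; simp
    have E1 := loc_test hΩ hfin P h0 hT k hu hmin hO gO TO W mψ (fun x hx => z1 x fun hx' => hx (hδO x hx' x (by simpa using hδ)))
    have E2 := loc_test hΩ hfin P h0 hT k hu hmin hO gO TO (fun a i => (W a i).translate (-(h • ev j))) (fun a => memLp_translate (mψ a) _) (fun x hx => z1 _ fun hx' => hx (hδO _ hx' x (by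
        have := hev h j (x + -(h • ev j)) hh
        rw [neg_add_cancel_right] at this
        rw [this]; exact hhδ)))
    rw [← integral_add_right_eq_self _ (h • ev j)] at E2
    simp only [add_neg_cancel_right] at E2
    have mZ : MemLp (fun x => tm fun a i => g a i x) 2 volume := memLp_tm_of fun a i => (wd a i).mg
    have mZh : MemLp (fun x => tm fun a i => g a i (x + h • ev j)) 2 volume := memLp_tm_of (g := fun a i x => g a i (x + h • ev j)) fun a i => memLp_translate (wd a i).mg _
    have mT' : ∀ a i, MemLp (T a i) 2 volume := fun a i => (cT a i).continuous.memLp_of_hasCompactSupport hχc.mul_right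
    have mT : MemLp (fun x => tm fun a i => T a i x) 2 volume := memLp_tm_of mT'
    have mTh : MemLp (fun x => tm fun a i => T a i (x + h • ev j)) 2 volume := memLp_tm_of (g := fun a i x => T a i (x + h • ev j)) fun a i => memLp_translate (mT' a i) _
    have mψ' : MemLp (fun x => tm fun a i => ψ' a i x) 2 volume := memLp_tm_of fun a i => (W a i).mg
    have i1 := int_inner (((aesm_AA P.toPF mZ).add (mZ.const_smul (k:ℝ)⁻¹)).sub mT) mψ'
    have i2 := int_inner (((aesm_AA P.toPF mZh).add (mZh.const_smul (k:ℝ)⁻¹)).sub mTh) mψ'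
    have i3 := int_inner (mTh.sub mT) mψ'
    simp only [Pi.add_apply, Pi.sub_apply, Pi.smul_apply] at i1 i2 i3
    have e3 : ∀ x, (tm fun a i => ψ' a i x) = η x ^ 2 • ((tm fun a i => g a i (x + h • ev j)) - tm fun a i => g a i x) +
       (2 * η x) • (tm fun a i => (U a (x + h • ev j) - U a x) * fderiv ℝ η x (ev i)) := by
      intro x
      rw [← map_sub, ← map_smul, ← map_smul, ← map_add]
      congr 1; ext a i; simp [hψ']; ring
    have E3 : ∫ x, (⟪AA p (tm fun a i => g a i (x + h • ev j)) + (k:ℝ)⁻¹ • (tm fun a i => g a i (x + h • ev j)) - tm fun a i => T a i (x + h • ev j), tm fun a i => ψ' a i x⟫ -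
       ⟪AA p (tm fun a i => g a i x) + (k:ℝ)⁻¹ • (tm fun a i => g a i x) - tm fun a i => T a i x, tm fun a i => ψ' a i x⟫ + 
       ⟪(tm fun a i => T a i (x + h • ev j)) - tm fun a i => T a i x, tm fun a i => ψ' a i x⟫) = ∫ x, ⟪(tm fun a i => T a i (x + h • ev j)) - tm fun a i => T a i x, tm fun a i => ψ' a i x⟫ := by
      rw [integral_add (isub i2 i1) i3, integral_sub i2 i1, E1, E2]; simp
    have E4 : ∫ x, ⟪(tm fun a i => T a i (x + h • ev j)) - tm fun a i => T a i x, tm fun a i => ψ' a i x⟫ = ∑ a, ∑ i, ∫ x, (T a i (x + h • ev j) - T a i x) * ψ' a i x := by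
      have q : ∀ a i, Integrable fun x => (T a i (x + h • ev j) - T a i x) * ψ' a i x := fun a i => int_mul_L2 ((memLp_translate (mT' a i) _).sub (mT' a i)) (W a i).mg
      have : ∀ x, ⟪(tm fun a i => T a i (x + h • ev j)) - tm fun a i => T a i x, tm fun a i => ψ' a i x⟫ = ∑ a, ∑ i, (T a i (x + h • ev j) - T a i x) * ψ' a i x := by
        intro x; rw [← map_sub, inner_tm]; rfl
      simp only [this]
      rw [integral_finsetSum _ fun a _ => integrable_finsetSum _ fun i _ => q a i]
      exact Finset.sum_congr rfl fun a _ => integral_finsetSum _ fun i _ => q a i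
    rw [← E4, ← E3]
    congr 1; ext x
    rw [← e3 x, ← inner_sub_left, ← inner_add_left]
    congr 1
    rw [smul_sub]; abel
  · intro h hh hhδ j x hx a i
    have fT : ∀ y ∈ O, fderiv ℝ (fun x => χ x * T₀ x a i) y (ev i) = DT y (ev i) a i := by
      intro y hy
      have e : (fun x => χ x * T₀ x a i) =ᶠ[𝓝 y] fun x => T₀ x a i := by
        filter_upwards [hOo.mem_nhds hy] with z hz
        rw [hχO z hz, one_mul]
      rw [e.fderiv_eq]
      have h1 := (hd y (hO hy)).hasFDerivAt (hΩ.mem_nhds (hO hy))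
      have h2 := (hasFDerivAt_pi'.1 ((hasFDerivAt_pi'.1 h1) a)) i
      rw [h2.fderiv]; rfl
    have y1 : x ∈ O := hδO x hx x (by simpa using hδ)
    have y2 : x + h • ev j ∈ O := hδO x hx _ (by rw [hev h j x hh]; exact hhδ)
    rw [fT _ y1, fT _ y2]
    have h3 : ‖DT (x + h • ev j) - DT x‖ ≤ C * h := by
      have := hl.dist_le_mul _ (hO y2) _ (hO y1)
      rwa [hev h j x hh, dist_eq_norm] at this
    have h4 : ‖(DT (x + h • ev j) - DT x) (ev i)‖ ≤ C * h := by
      refine ((DT (x + h • ev j) - DT x).le_opNorm _).trans ?_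
      rw [norm_ev, mul_one]; exact h3
    have h5 := (norm_le_pi_norm ((DT (x + h • ev j) - DT x) (ev i) a) i).trans ((norm_le_pi_norm ((DT (x + h • ev j) - DT x) (ev i)) a).trans h4)
    simpa using h5

end PF3
end MPF3

section MPF4
section PF4
variable {n N : ℕ}

theorem WD.of_smooth {i : Fin n} {φ : EVec n → ℝ} (h : ContDiff ℝ 1 φ) (hc : HasCompactSupport φ) : WD i φ (fun x => fderiv ℝ φ x (ev i)) := by
  have hf := cont_fd h (ev i)
  refine ⟨h.continuous.memLp_of_hasCompactSupport hc, hf.memLp_of_hasCompactSupport (hc.fderiv_apply ℝ _), ?_⟩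
  intro ψ h1 h2
  rw [← integral_neg]
  have hd := h.differentiable (by norm_num)
  have hd1 := h1.differentiable (by norm_num)
  have := integral_mul_fderiv_eq_neg_fderiv_mul_of_integrable (μ := (volume : Measure (EVec n))) (f := φ) (g := ψ) (v := ev i) ?_ ?_ ?_ (fun x _ => hd x) (fun x _ => hd1 x)
  · rw [this, integral_neg]
  · exact (hf.mul h1.continuous).integrable_of_hasCompactSupport h2.mul_left
  · exact (h.continuous.mul (cont_fd h1 _)).integrable_of_hasCompactSupport hc.mul_right
  · exact (h.continuous.mul h1.continuous).integrable_of_hasCompactSupport hc.mul_right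

theorem wk_dq {j : Fin n} {z ψ ψ' : EVec n → ℝ} (hz : MemLp z 2 volume) (W : WD j ψ ψ') :
    Tendsto (fun h => ∫ x, ψ x * dq h j z x) (𝓝[>] 0) (𝓝 (-∫ x, ψ' x * z x)) := by
  have e : ∀ h : ℝ, ∫ x, ψ x * dq h j z x = -∫ x, dq h j ψ x * z (x + h • ev j) := by
    intro h
    have mz := memLp_translate hz (h • ev j)
    have mψ := memLp_translate W.mu (h • ev j)
    have e1 : ∀ x, ψ x * dq h j z x = h⁻¹ * (ψ x * z (x + h • ev j)) - h⁻¹ * (ψ x * z x) := fun x => by unfold dq; ring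
    have e2 : ∀ x, dq h j ψ x * z (x + h • ev j) = h⁻¹ * (ψ (x + h • ev j) * z (x + h • ev j)) - h⁻¹ * (ψ x * z (x + h • ev j)) := fun x => by unfold dq; ring
    simp only [e1, e2]
    rw [integral_sub ((int_mul_L2 W.mu mz).const_mul _) ((int_mul_L2 W.mu hz).const_mul _), integral_sub ((int_mul_L2 mψ mz).const_mul _) ((int_mul_L2 W.mu mz).const_mul _)]
    simp only [integral_const_mul]
    rw [integral_add_right_eq_self (fun x => ψ x * z x) (h • ev j)]
    ring
  simp only [e]
  refine Tendsto.neg ?_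
  rw [tendsto_iff_norm_sub_tendsto_zero]
  have t1 := W.dq_tendsto
  have t2 : Tendsto (fun h : ℝ => n2 (fun x => z (x + h • ev j) - z x)) (𝓝[>] 0) (𝓝 0) :=
      ((n2_translate_tendsto hz).comp (tendsto_smul_ev j)).mono_left nhdsWithin_le_nhds
  have t3 := (t1.mul_const (n2 z)).add (t2.const_mul (n2 ψ'))
  simp only [zero_mul, mul_zero, add_zero] at t3
  refine squeeze_zero (fun _ => norm_nonneg _) (fun h => ?_) t3
  have mz := memLp_translate hz (h • ev j)
  have md := memLp_dq W.mu h j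
  have m1 : MemLp (fun x => dq h j ψ x - ψ' x) 2 volume := md.sub W.mg
  have m2 : MemLp (fun x => z (x + h • ev j) - z x) 2 volume := mz.sub hz
  rw [← integral_sub (int_mul_L2 md mz) (int_mul_L2 W.mg hz)]
  have e3 : ∀ x, dq h j ψ x * z (x + h • ev j) - ψ' x * z x = (dq h j ψ x - ψ' x) * z (x + h • ev j) + ψ' x * (z (x + h • ev j) - z x) := fun x => by ring
  simp only [e3]
  rw [integral_add (int_mul_L2 m1 mz) (int_mul_L2 W.mg m2)]
  refine (norm_add_le _ _).trans (add_le_add ?_ (n2_cs W.mg m2))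
  refine (n2_cs m1 mz).trans (le_of_eq ?_)
  rw [n2_translate hz]

theorem symm_g {u : EVec n → ℝ} {gi gj : EVec n → ℝ} {i j : Fin n} (W : WD i u gi) (W' : WD j u gj) {ψ : EVec n → ℝ} (h : ContDiff ℝ 2 ψ) (hc : HasCompactSupport ψ) :
    ∫ x, gi x * fderiv ℝ ψ x (ev j) = ∫ x, gj x * fderiv ℝ ψ x (ev i) := by
  have hd : ∀ v : EVec n, ContDiff ℝ 1 (fun x => fderiv ℝ ψ x v) := fun v => (h.fderiv_right (m := 1) (by norm_num)).clm_apply contDiff_const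
  have e1 := W.wd _ (hd (ev j)) (hc.fderiv_apply ℝ _)
  have e2 := W'.wd _ (hd (ev i)) (hc.fderiv_apply ℝ _)
  have e3 : ∀ x, fderiv ℝ (fun x => fderiv ℝ ψ x (ev j)) x (ev i) = fderiv ℝ (fun x => fderiv ℝ ψ x (ev i)) x (ev j) := by
    intro x
    have d : DifferentiableAt ℝ (fderiv ℝ ψ) x := (h.fderiv_right (m := 1) (by norm_num)).differentiable (by norm_num) x
    have s := (h.contDiffAt (x := x)).isSymmSndFDerivAt (by simp)
    rw [fderiv_clm_apply d (differentiableAt_const _), fderiv_clm_apply d (differentiableAt_const _)]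
    simpa using s (ev i) (ev j)
  simp only [e3] at e1
  linarith

theorem weak_zero {u : EVec n → ℝ} {gi gj : EVec n → ℝ} {i j : Fin n} (W : WD i u gi) (W' : WD j u gj) {η : EVec n → ℝ} (hη : ContDiff ℝ 2 η) (hηc : HasCompactSupport η)
   {C : ℝ} (hC1 : ∀ᶠ h in 𝓝[>] (0:ℝ), n2 (fun x => η x * dq h j gi x) ≤ C) (hC2 : ∀ᶠ h in 𝓝[>] (0:ℝ), n2 (fun x => η x * dq h i gj x) ≤ C)
   {F : EVec n → ℝ} (hF : MemLp F 2 volume) :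
   Tendsto (fun h => ∫ x, F x * (η x * dq h j gi x) - F x * (η x * dq h i gj x)) (𝓝[>] 0) (𝓝 0) := by
  obtain ⟨c, hc⟩ := hηc.exists_bound_of_continuous hη.continuous
  have mη : ∀ {v : EVec n → ℝ}, MemLp v 2 volume → MemLp (fun x => η x * v x) 2 volume := by
    intro v hv
    refine MemLp.of_le_mul (c := c) hv (hη.continuous.aestronglyMeasurable.mul hv.1) (ae_of_all _ fun x => ?_)
    rw [norm_mul]; exact mul_le_mul_of_nonneg_right (hc x) (norm_nonneg _)
  have C0 : 0 ≤ C := by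
    obtain ⟨h, hh⟩ := hC1.exists
    exact (n2_nonneg _).trans hh
  rw [Metric.tendsto_nhds]
  intro ε hε
  obtain ⟨ψ, hψc, hψd, hψ⟩ := hF.exist_eLpNorm_sub_le (p := 2) (by norm_num) (by norm_num) (ε := ε / (4 * (C + 1))) (by positivity)
  have hψ2 : ContDiff ℝ 2 (fun x => ψ x * η x) := (contDiff_infty.1 hψd 2).mul hη
  have hψ2c : HasCompactSupport (fun x => ψ x * η x) := hψc.mul_right
  have mψ : MemLp ψ 2 volume := hψd.continuous.memLp_of_hasCompactSupport hψc
  have nψ : n2 (fun x => F x - ψ x) ≤ ε / (4 * (C + 1)) := ENNReal.toReal_le_of_le_ofReal (by positivity) hψ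
  have mFψ : MemLp (fun x => F x - ψ x) 2 volume := hF.sub mψ
  have h1 := hψ2.of_le (n := 2) (m := 1) (by norm_num)
  have w1 := wk_dq W.mg (WD.of_smooth (i := j) h1 hψ2c)
  have w2 := wk_dq W'.mg (WD.of_smooth (i := i) h1 hψ2c)
  have w3 := w1.sub w2
  have e := symm_g W W' hψ2 hψ2c
  have e' : -(∫ x, fderiv ℝ (fun x => ψ x * η x) x (ev j) * gi x) - -(∫ x, fderiv ℝ (fun x => ψ x * η x) x (ev i) * gj x) = 0 := by
    simp only [mul_comm (fderiv ℝ (fun x => ψ x * η x) _ _)]; linarith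
  rw [e'] at w3
  have w4 := (Metric.tendsto_nhds.1 w3) (ε / 2) (by positivity)
  filter_upwards [hC1, hC2, w4] with h a1 a2 a3
  have m1 := mη (memLp_dq W.mg h j)
  have m2 := mη (memLp_dq W'.mg h i)
  rw [Real.dist_eq, sub_zero] at a3 ⊢
  have e5 : ∫ x, F x * (η x * dq h j gi x) - F x * (η x * dq h i gj x) = (∫ x, (F x - ψ x) * (η x * dq h j gi x)) - (∫ x, (F x - ψ x) * (η x * dq h i gj x)) +
      ((∫ x, ψ x * η x * dq h j gi x) - (∫ x, ψ x * η x * dq h i gj x)) := by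
    simp only [mul_assoc]
    rw [← integral_sub (int_mul_L2 mFψ m1) (int_mul_L2 mFψ m2), ← integral_sub (int_mul_L2 mψ m1) (int_mul_L2 mψ m2), ← integral_add (isub (int_mul_L2 mFψ m1) (int_mul_L2 mFψ m2)) (isub (int_mul_L2 mψ m1) (int_mul_L2 mψ m2))]
    congr 1; ext x; ring
  rw [e5]
  have b1 := n2_cs mFψ m1
  have b2 := n2_cs mFψ m2
  have b3 : ε / (4 * (C + 1)) * C ≤ ε / 4 := by
    rw [div_mul_eq_mul_div, div_le_div_iff₀ (by positivity) (by norm_num)]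
    nlinarith
  have c1 : n2 (fun x => F x - ψ x) * n2 (fun x => η x * dq h j gi x) ≤ ε / 4 := le_trans (mul_le_mul nψ a1 (n2_nonneg _) (by positivity)) b3
  have c2 : n2 (fun x => F x - ψ x) * n2 (fun x => η x * dq h i gj x) ≤ ε / 4 := le_trans (mul_le_mul nψ a2 (n2_nonneg _) (by positivity)) b3
  rw [abs_lt] at a3 ⊢
  have d1 := abs_le.1 (b1.trans c1)
  have d2 := abs_le.1 (b2.trans c2)
  constructor <;> linarith [a3.1, a3.2, d1.1, d1.2, d2.1, d2.2]

end PF4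
end MPF4

section MPF5
section PF5
variable {n N : ℕ}

noncomputable def th (t : ℝ) : ℝ := Real.smoothTransition ((4 - t) / 3)

theorem th_cd : ContDiff ℝ 3 th := by
  unfold th
  exact Real.smoothTransition.contDiff.comp (by fun_prop)

theorem th_one {t : ℝ} (h : t ≤ 1) : th t = 1 := Real.smoothTransition.one_of_one_le (by linarith)
theorem th_zero {t : ℝ} (h : 4 ≤ t) : th t = 0 := Real.smoothTransition.zero_of_nonpos (by linarith)
theorem th_nonneg (t : ℝ) : 0 ≤ th t := Real.smoothTransition.nonneg _
theorem th_le (t : ℝ) : th t ≤ 1 := Real.smoothTransition.le_one _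

theorem dth_zero {t : ℝ} (h : t ∉ Icc (1:ℝ) 4) : deriv th t = 0 := by
  rw [mem_Icc, not_and_or, not_le, not_le] at h
  rcases h with h | h
  · have : th =ᶠ[𝓝 t] fun _ => 1 := by filter_upwards [gt_mem_nhds h] with y hy using th_one hy.le
    rw [this.deriv_eq]; simp
  · have : th =ᶠ[𝓝 t] fun _ => 0 := by filter_upwards [lt_mem_nhds h] with y hy using th_zero hy.le
    rw [this.deriv_eq]; simp

theorem dth_cont : Continuous (deriv th) := th_cd.continuous_deriv (by norm_num)

theorem dth_bound : ∃ B : ℝ, 0 ≤ B ∧ ∀ t, |deriv th t| ≤ B := by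
  have : HasCompactSupport (deriv th) := HasCompactSupport.intro (isCompact_Icc (a := (1:ℝ)) (b := 4)) fun t ht => dth_zero ht
  obtain ⟨B, hB⟩ := this.exists_bound_of_continuous dth_cont
  exact ⟨B, (norm_nonneg _).trans (hB 0), hB⟩

variable {H : Type*} [NormedAddCommGroup H] [InnerProductSpace ℝ H]

noncomputable def VV (M : ℝ) (z : H) : H := th (‖z‖ ^ 2 / M ^ 2) • z

noncomputable def mm (M : ℝ) (z : H) : ℝ := th (‖z‖ ^ 2 / M ^ 2) + 2 * deriv th (‖z‖ ^ 2 / M ^ 2) * (‖z‖ ^ 2 / M ^ 2)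
noncomputable def cc (M : ℝ) (z : H) : ℝ := 2 * deriv th (‖z‖ ^ 2 / M ^ 2) / M ^ 2

theorem VV_cd (M : ℝ) : ContDiff ℝ 3 (VV M : H → H) := by
  unfold VV
  exact (th_cd.comp ((contDiff_norm_sq ℝ).div_const _)).smul contDiff_id

theorem VV_norm (M : ℝ) (z : H) : ‖VV M z‖ ≤ ‖z‖ := by
  unfold VV
  rw [norm_smul, Real.norm_of_nonneg (th_nonneg _)]
  exact mul_le_of_le_one_left (norm_nonneg _) (th_le _)

theorem VV_eq {M : ℝ} (hM : 0 < M) {z : H} (hz : ‖z‖ ≤ M) : VV M z = z := by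
  unfold VV
  rw [th_one, one_smul]
  rw [div_le_one (by positivity)]; gcongr

theorem VV_zero {M : ℝ} (hM : 0 < M) {z : H} (hz : 2 * M ≤ ‖z‖) : VV M z = 0 := by
  unfold VV
  rw [th_zero, zero_smul]
  rw [le_div_iff₀ (by positivity)]
  have := pow_le_pow_left₀ (by positivity) hz 2
  linarith

theorem VV_fd (M : ℝ) (z ξ : H) : fderiv ℝ (VV M) z ξ = mm M z • ξ - cc M z • PP z ξ := by
  have h1 : HasFDerivAt (fun z : H => ‖z‖ ^ 2 / M ^ 2) ((M ^ 2)⁻¹ • ((2:ℝ) • innerSL ℝ z)) z := by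
    have := ((hasStrictFDerivAt_norm_sq z).hasFDerivAt).const_mul ((M ^ 2)⁻¹)
    simp only [div_eq_inv_mul]
    convert! this using 2
    ext; simp
  have h2 : HasDerivAt th (deriv th (‖z‖ ^ 2 / M ^ 2)) (‖z‖ ^ 2 / M ^ 2) := (th_cd.differentiable (by norm_num) _).hasDerivAt
  have h3 := (h2.comp_hasFDerivAt z h1).smul (hasFDerivAt_id z)
  have h4 : fderiv ℝ (VV M) z = _ := h3.fderiv
  rw [h4]
  simp only [mm, cc, PP]
  simp [smul_sub, add_smul, smul_smul]
  module

theorem cc_zero {M : ℝ} (hM : 0 < M) {z : H} (hz : ¬ (M ≤ ‖z‖ ∧ ‖z‖ ≤ 2 * M)) : cc M z = 0 := by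
  unfold cc
  rw [dth_zero]; · simp
  intro h
  apply hz
  rw [mem_Icc, le_div_iff₀ (by positivity), div_le_iff₀ (by positivity)] at h
  constructor
  · exact abs_le_of_sq_le_sq (by linarith) (norm_nonneg z) |>.trans' (le_abs_self _)
  · exact abs_le_of_sq_le_sq (by linarith) (by positivity) |>.trans' (le_abs_self _)

theorem mm_cont (M : ℝ) : Continuous (mm M : H → ℝ) := by
  have h1 := th_cd.continuous
  have h2 := dth_cont
  unfold mm
  fun_prop

theorem mm_bound (M : ℝ) {B : ℝ} (hB : ∀ t, |deriv th t| ≤ B) (z : H) : |mm M z| ≤ 1 + 8 * B := by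
  unfold mm
  set t := ‖z‖ ^ 2 / M ^ 2 with ht
  have t0 : 0 ≤ t := by positivity
  have h1 : |th t| ≤ 1 := by rw [abs_of_nonneg (th_nonneg _)]; exact th_le _
  have B0 : 0 ≤ B := (abs_nonneg _).trans (hB 0)
  have h2 : |2 * deriv th t * t| ≤ 8 * B := by
    by_cases h : t ∈ Icc (1:ℝ) 4
    · rw [abs_mul, abs_mul, abs_of_nonneg t0, abs_two]
      have := hB t
      calc 2 * |deriv th t| * t ≤ 2 * B * 4 := by gcongr; exact h.2
        _ = _ := by ring
    · rw [dth_zero h]; simp [B0]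
  exact (abs_add_le _ _).trans (add_le_add h1 h2)

theorem VV_taylor [FiniteDimensional ℝ H] {M : ℝ} (hM : 0 < M) : ∃ C : ℝ, 0 ≤ C ∧ ∀ z w : H, ‖VV M z - VV M w - fderiv ℝ (VV M) w (z - w)‖ ≤ C * ‖z - w‖ ^ 2 := by
  have hc : HasCompactSupport (VV M : H → H) := HasCompactSupport.intro (isCompact_closedBall (0:H) (2 * M)) fun z hz => by
    apply VV_zero hM
    simp at hz; exact hz.le
  have hd : ContDiff ℝ 1 (fderiv ℝ (VV M : H → H)) := (VV_cd M).fderiv_right (by norm_num)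
  obtain ⟨C, hC⟩ := hd.lipschitzWith_of_hasCompactSupport (hc.fderiv ℝ) (by norm_num)
  refine ⟨C, C.2, fun z w => ?_⟩
  have hdiff := (VV_cd M : ContDiff ℝ 3 (VV M : H → H)).differentiable (by norm_num)
  have := (convex_segment w z).norm_image_sub_le_of_norm_fderiv_le' (𝕜 := ℝ) (f := VV M) (φ := fderiv ℝ (VV M) w) (C := C * ‖z - w‖) (fun x _ => hdiff x) (fun x hx => ?_) (left_mem_segment ℝ w z) (right_mem_segment ℝ w z)
  · refine this.trans (le_of_eq (by ring))
  · have h1 := hC.dist_le_mul x w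
    rw [dist_eq_norm] at h1
    refine h1.trans ?_
    gcongr
    rw [dist_eq_norm]
    obtain ⟨a, b, ha, hb, hab, rfl⟩ := hx
    have : a • w + b • z - w = b • (z - w) := by
      have : a = 1 - b := by linarith
      rw [this]; module
    rw [this, norm_smul, Real.norm_of_nonneg hb]
    exact mul_le_of_le_one_left (norm_nonneg _) (by linarith)

theorem bad_pt {p : ℝ → ℝ} {L : ℝ} (P : PF p L) {B : ℝ} (hB : ∀ t, |deriv th t| ≤ B) {M : ℝ} (hM : 1 ≤ M) (z w : H) {l h : ℝ} (hl : 0 < l) (hh : 0 < h) :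
    |cc M w| * ‖PP w (z - w)‖ / h ≤ (64 * B ^ 2 / p 1) * l * (2 * M * (Set.indicator {w : H | M ≤ ‖w‖} (fun _ => (1:ℝ)) w) + ‖z - w‖) + l⁻¹ * (qq p z w / h ^ 2) := by
  have q0 := P.qq_nonneg z w
  have p1 := P.pos 1 one_pos
  have B0 : 0 ≤ B := (abs_nonneg _).trans (hB 0)
  by_cases hw : M ≤ ‖w‖ ∧ ‖w‖ ≤ 2 * M
  swap
  · rw [cc_zero (by linarith) hw]
    have : 0 ≤ Set.indicator {w : H | M ≤ ‖w‖} (fun _ => (1:ℝ)) w := Set.indicator_nonneg (fun _ _ => by norm_num) _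
    simp only [abs_zero, zero_mul, zero_div]
    positivity
  rw [indicator_of_mem (by exact hw.1)]
  have hM0 : 0 < M := by linarith
  have h1 := P.PP_le z w
  have h2 : p 1 ≤ p ‖w‖ := P.mono 1 ‖w‖ (by norm_num) (by linarith [hw.1])
  set X := ‖PP w (z - w)‖
  set A := 2 * M + ‖z - w‖ with hA
  have A0 : 0 ≤ A := by positivity
  have h3 : ‖z‖ ≤ A := by
    have := norm_add_le (z - w) w
    rw [sub_add_cancel] at this
    linarith [hw.2]
  have h4 : p 1 * X ^ 2 ≤ 32 * M ^ 4 * A * qq p z w := by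
    calc p 1 * X ^ 2 ≤ p ‖w‖ * X ^ 2 := by gcongr
      _ ≤ 2 * ‖w‖ ^ 4 * ‖z‖ * qq p z w := h1
      _ ≤ 2 * (2 * M) ^ 4 * A * qq p z w := by gcongr; exact hw.2
      _ = _ := by ring
  have h5 : |cc M w| ≤ 2 * B / M ^ 2 := by
    unfold cc
    rw [abs_div, abs_mul, abs_two, abs_of_nonneg (sq_nonneg M)]
    gcongr; exact hB _
  have h6 : (|cc M w| * X) ^ 2 ≤ (128 * B ^ 2 / p 1) * A * qq p z w := by
    have : X ^ 2 ≤ 32 * M ^ 4 * A * qq p z w / p 1 := by rw [le_div_iff₀ p1]; linarith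
    calc (|cc M w| * X) ^ 2 = |cc M w| ^ 2 * X ^ 2 := by ring
      _ ≤ (2 * B / M ^ 2) ^ 2 * (32 * M ^ 4 * A * qq p z w / p 1) := by gcongr
      _ = _ := by field_simp; ring
  set Y := |cc M w| * X
  have Y0 : 0 ≤ Y := by positivity
  set a := (64 * B ^ 2 / p 1) * l * A with ha
  set b := l⁻¹ * (qq p z w / h ^ 2) with hb
  have a0 : 0 ≤ a := by positivity
  have b0 : 0 ≤ b := by positivity
  have hab : a * b = 64 * B ^ 2 / p 1 * A * qq p z w / h ^ 2 := by
    rw [ha, hb]; field_simp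
  have h7 : (Y / h) ^ 2 ≤ (a + b) ^ 2 := by
    have : (Y / h) ^ 2 ≤ 2 * (a * b) := by
      rw [hab, div_pow, ← mul_div_assoc]
      gcongr
      exact h6.trans (le_of_eq (by ring))
    nlinarith [sq_nonneg a, sq_nonneg b]
  rw [mul_one]
  exact (le_abs_self _).trans (abs_le_of_sq_le_sq h7 (by positivity))

end PF5
end MPF5

section MPF6
section PF6
variable {n N : ℕ} {p : ℝ → ℝ} {L : ℝ} {Z : EVec n → HM N n} {η φ : EVec n → ℝ} {κ C0 : ℝ}

theorem memLp_trZ (mZ : MemLp Z 2 volume) (v : EVec n) : MemLp (fun x => Z (x + v)) 2 volume :=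
  mZ.comp_measurePreserving (measurePreserving_add_right volume v)

theorem memLp_coord {W : EVec n → HM N n} (mW : MemLp W 2 volume) (q : Fin N × Fin n) : MemLp (fun x => W x q) 2 volume := by
  refine MemLp.of_le mW ?_ (ae_of_all _ fun x => PiLp.norm_apply_le (W x) q)
  exact (PiLp.continuous_apply 2 _ q).comp_aestronglyMeasurable mW.1

theorem memLp_VV (M : ℝ) (mZ : MemLp Z 2 volume) : MemLp (fun x => VV M (Z x)) 2 volume :=
  MemLp.of_le mZ ((VV_cd M).continuous.comp_aestronglyMeasurable mZ.1) (ae_of_all _ fun x => VV_norm M (Z x))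

theorem int_bmul {f ψ : EVec n → ℝ} (hf : Integrable f) (hψ : Continuous ψ) {c : ℝ} (hc : ∀ x, |ψ x| ≤ c) : Integrable (fun x => ψ x * f x) :=
  hf.bdd_mul (c := c) hψ.aestronglyMeasurable (ae_of_all _ hc)

structure Est (p : ℝ → ℝ) (Z : EVec n → HM N n) (η : EVec n → ℝ) (κ C0 : ℝ) : Prop where
  mZ : MemLp Z 2 volume
  hη : ContDiff ℝ 2 η
  hηc : HasCompactSupport η
  η1 : ∀ x, |η x| ≤ 1
  κp : 0 < κ
  C0n : 0 ≤ C0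
  est : ∀ j : Fin n, ∀ᶠ h in 𝓝[>] (0:ℝ), ∫ x, η x ^ 2 * (qq p (Z (x + h • ev j)) (Z x) + κ * ‖Z (x + h • ev j) - Z x‖ ^ 2) ≤ C0 * h ^ 2

theorem sq_bd {t : ℝ} (h : |t| ≤ 1) : |t ^ 2| ≤ 1 := by
  rw [abs_pow]; exact pow_le_one₀ (abs_nonneg _) h

theorem Est.iq (D : Est p Z η κ C0) (P : PF p L) (h : ℝ) (j : Fin n) : Integrable (fun x => η x ^ 2 * qq p (Z (x + h • ev j)) (Z x)) := by
  have m := memLp_trZ D.mZ (h • ev j)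
  have := D.hη.continuous
  exact int_bmul (int_inner ((aesm_AA P m).sub (aesm_AA P D.mZ)) (m.sub D.mZ)) (by fun_prop) (fun x => sq_bd (D.η1 x))

theorem Est.is (D : Est p Z η κ C0) (h : ℝ) (j : Fin n) : Integrable (fun x => η x ^ 2 * ‖Z (x + h • ev j) - Z x‖ ^ 2) := by
  have m := memLp_trZ D.mZ (h • ev j)
  have := D.hη.continuous
  exact int_bmul ((memLp_two_iff_integrable_sq_norm (m.sub D.mZ).1).1 (m.sub D.mZ)) (by fun_prop) (fun x => sq_bd (D.η1 x))

theorem Est.split (D : Est p Z η κ C0) (P : PF p L) (j : Fin n) :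
    ∀ᶠ h in 𝓝[>] (0:ℝ), ∫ x, η x ^ 2 * qq p (Z (x + h • ev j)) (Z x) ≤ C0 * h ^ 2 ∧ ∫ x, η x ^ 2 * ‖Z (x + h • ev j) - Z x‖ ^ 2 ≤ C0 / κ * h ^ 2 := by
  filter_upwards [D.est j] with h hh
  have e : ∀ x, η x ^ 2 * (qq p (Z (x + h • ev j)) (Z x) + κ * ‖Z (x + h • ev j) - Z x‖ ^ 2) = η x ^ 2 * qq p (Z (x + h • ev j)) (Z x) + κ * (η x ^ 2 * ‖Z (x + h • ev j) - Z x‖ ^ 2) := fun x => by ring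
  simp only [e] at hh
  rw [integral_add (D.iq P h j) ((D.is h j).const_mul κ), integral_const_mul] at hh
  have h1 : 0 ≤ ∫ x, η x ^ 2 * qq p (Z (x + h • ev j)) (Z x) := integral_nonneg fun x => mul_nonneg (sq_nonneg _) (P.qq_nonneg _ _)
  have h2 : 0 ≤ ∫ x, η x ^ 2 * ‖Z (x + h • ev j) - Z x‖ ^ 2 := integral_nonneg fun x => by positivity
  have := D.κp
  refine ⟨by nlinarith, ?_⟩
  rw [div_mul_eq_mul_div, le_div_iff₀ this]
  nlinarith

theorem Est.n2b (D : Est p Z η κ C0) (P : PF p L) (j : Fin n) (q : Fin N × Fin n) :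
    ∀ᶠ h in 𝓝[>] (0:ℝ), n2 (fun x => η x * dq h j (fun x => Z x q) x) ≤ Real.sqrt (C0 / κ) := by
  filter_upwards [D.split P j, self_mem_nhdsWithin] with h hh h0
  have h0' : 0 < h := h0
  apply Real.le_sqrt_of_sq_le
  have m0 := memLp_dq (memLp_coord D.mZ q) h j
  have m : MemLp (fun x => η x * dq h j (fun x => Z x q) x) 2 volume := by
    refine MemLp.of_le m0 (D.hη.continuous.aestronglyMeasurable.mul m0.1) (ae_of_all _ fun x => ?_)
    rw [norm_mul]
    exact mul_le_of_le_one_left (norm_nonneg _) (D.η1 x)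
  rw [n2_sq m]
  calc ∫ x, (η x * dq h j (fun x => Z x q) x) ^ 2 ≤ ∫ x, (h ^ 2)⁻¹ * (η x ^ 2 * ‖Z (x + h • ev j) - Z x‖ ^ 2) := by
        refine integral_mono m.integrable_sq ((D.is h j).const_mul _) fun x => ?_
        have := PiLp.norm_apply_le (Z (x + h • ev j) - Z x) q
        simp only [dq]
        have h3 : (Z (x + h • ev j) q - Z x q) ^ 2 ≤ ‖Z (x + h • ev j) - Z x‖ ^ 2 := by
          rw [← sq_abs]; gcongr; exact this
        calc (η x * (h⁻¹ * (Z (x + h • ev j) q - Z x q))) ^ 2 = (h ^ 2)⁻¹ * (η x ^ 2 * (Z (x + h • ev j) q - Z x q) ^ 2) := by field_simp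
          _ ≤ _ := by gcongr
    _ ≤ (h ^ 2)⁻¹ * (C0 / κ * h ^ 2) := by
        rw [integral_const_mul]; gcongr; exact hh.2
    _ = _ := by field_simp

theorem Est.bad (D : Est p Z η κ C0) (P : PF p L) {B : ℝ} (hB : ∀ t, |deriv th t| ≤ B)
    (hφ : Continuous φ) (hφc : HasCompactSupport φ) {c : ℝ} (hc : ∀ x, |φ x| ≤ c) (hη : ∀ x ∈ tsupport φ, η x = 1)
    {M l : ℝ} (hM : 1 ≤ M) (hl : 0 < l) (j : Fin n) (q : Fin N × Fin n) {ε : ℝ} (hε : 0 < ε) :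
    ∀ᶠ h in 𝓝[>] (0:ℝ), |∫ x, (φ x * dq h j (fun x => VV M (Z x) q) x - φ x * mm M (Z x) * (η x * dq h j (fun x => Z x q) x))| ≤
      c * ((64 * B ^ 2 / p 1) * l * (2 * M * (volume (tsupport φ ∩ {x | M ≤ ‖Z x‖})).toReal) + l⁻¹ * C0) + ε := by
  obtain ⟨C, Cn, hC⟩ := VV_taylor (H := HM N n) (M := M) (by linarith)
  set K := tsupport φ with hK
  have Kc : IsCompact K := hφc.isCompact
  have c0 : 0 ≤ c := (abs_nonneg _).trans (hc 0)
  set A := 64 * B ^ 2 / p 1 with hA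
  have p1 := P.pos 1 one_pos
  have A0 : 0 ≤ A := by positivity
  have mK : MemLp (K.indicator fun _ => (1:ℝ)) 2 (volume : Measure (EVec n)) :=
    memLp_indicator_const 2 Kc.measurableSet 1 (Or.inr Kc.measure_lt_top.ne)
  set s := n2 (K.indicator fun _ => (1:ℝ)) with hs
  have s0 : 0 ≤ s := n2_nonneg _
  have lim : Tendsto (fun h : ℝ => c * (A * l * (s * (Real.sqrt (C0 / κ) * h)) + C * (C0 / κ * h))) (𝓝[>] 0) (𝓝 0) := by
    have : Tendsto (fun h : ℝ => c * (A * l * (s * (Real.sqrt (C0 / κ) * h)) + C * (C0 / κ * h))) (𝓝 0) (𝓝 (c * (A * l * (s * (Real.sqrt (C0 / κ) * 0)) + C * (C0 / κ * 0)))) := by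
      apply Continuous.tendsto; fun_prop
    simp only [mul_zero, add_zero] at this
    exact this.mono_left nhdsWithin_le_nhds
  filter_upwards [D.split P j, self_mem_nhdsWithin, lim.eventually_le_const hε] with h hh h0 hlim
  have h0' : 0 < h := h0
  set ΔZ : EVec n → HM N n := fun x => Z (x + h • ev j) - Z x with hΔ
  have mΔ : MemLp ΔZ 2 volume := (memLp_trZ D.mZ _).sub D.mZ
  set S := {x | M ≤ ‖Z x‖} with hS
  have pt : ∀ x, |φ x * dq h j (fun x => VV M (Z x) q) x - φ x * mm M (Z x) * (η x * dq h j (fun x => Z x q) x)| ≤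
      c * (A * l * (2 * M * (K ∩ S).indicator (fun _ => (1:ℝ)) x + |K.indicator (fun _ => (1:ℝ)) x * ‖η x • ΔZ x‖|)
       + l⁻¹ * ((h ^ 2)⁻¹ * (η x ^ 2 * qq p (Z (x + h • ev j)) (Z x))) + C * (h⁻¹ * (η x ^ 2 * ‖ΔZ x‖ ^ 2))) := by
    intro x
    have qn := P.qq_nonneg (Z (x + h • ev j)) (Z x)
    by_cases hx : x ∈ K
    swap
    · rw [image_eq_zero_of_notMem_tsupport hx]
      simp only [zero_mul, sub_zero, abs_zero]
      have : 0 ≤ (K ∩ S).indicator (fun _ => (1:ℝ)) x := indicator_nonneg (fun _ _ => by norm_num) _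
      positivity
    · rw [hη x hx]
      have e2 : (K ∩ S).indicator (fun _ => (1:ℝ)) x = Set.indicator {w : HM N n | M ≤ ‖w‖} (fun _ => (1:ℝ)) (Z x) := by
        by_cases h : M ≤ ‖Z x‖
        · rw [indicator_of_mem (show x ∈ K ∩ S from ⟨hx, h⟩), indicator_of_mem (show Z x ∈ {w : HM N n | M ≤ ‖w‖} from h)]
        · rw [indicator_of_notMem (fun h' => h h'.2), indicator_of_notMem (show Z x ∉ {w : HM N n | M ≤ ‖w‖} from h)]
      rw [e2, indicator_of_mem hx]
      have bp := bad_pt P hB hM (Z (x + h • ev j)) (Z x) hl h0'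
      have tl := hC (Z (x + h • ev j)) (Z x)
      rw [VV_fd] at tl
      have tl' := (PiLp.norm_apply_le _ q).trans tl
      have pp' := PiLp.norm_apply_le (PP (Z x) (Z (x + h • ev j) - Z x)) q
      simp only [PiLp.sub_apply, PiLp.smul_apply, smul_eq_mul, Real.norm_eq_abs] at tl' pp'
      set X := PP (Z x) (Z (x + h • ev j) - Z x) q
      set r := VV M (Z (x + h • ev j)) q - VV M (Z x) q - (mm M (Z x) * (Z (x + h • ev j) q - Z x q) - cc M (Z x) * X) with hr
      have e3 : φ x * dq h j (fun x => VV M (Z x) q) x - φ x * mm M (Z x) * (1 * dq h j (fun x => Z x q) x) = φ x * ((r - cc M (Z x) * X) / h) := by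
        simp only [dq, hr]; field_simp; ring
      rw [e3, abs_mul]
      refine mul_le_mul (hc x) ?_ (abs_nonneg _) c0
      rw [abs_div, abs_of_pos h0']
      have t1 : |r - cc M (Z x) * X| ≤ C * ‖ΔZ x‖ ^ 2 + |cc M (Z x)| * ‖PP (Z x) (Z (x + h • ev j) - Z x)‖ := by
        refine (abs_sub _ _).trans (add_le_add tl' ?_)
        rw [abs_mul]; gcongr
      calc |r - cc M (Z x) * X| / h ≤ (C * ‖ΔZ x‖ ^ 2 + |cc M (Z x)| * ‖PP (Z x) (Z (x + h • ev j) - Z x)‖) / h := by gcongr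
        _ = |cc M (Z x)| * ‖PP (Z x) (Z (x + h • ev j) - Z x)‖ / h + C * (h⁻¹ * ‖ΔZ x‖ ^ 2) := by field_simp; ring
        _ ≤ _ := by
            simp only [one_smul, one_mul, one_pow, abs_norm]
            refine add_le_add (bp.trans (le_of_eq ?_)) le_rfl
            rw [div_eq_inv_mul (qq p _ _)]
  have mS : NullMeasurableSet (K ∩ S) volume := by
    refine Kc.measurableSet.nullMeasurableSet.inter ?_
    exact nullMeasurableSet_le aemeasurable_const D.mZ.1.norm.aemeasurable
  have hfin : volume (K ∩ S) ≠ ∞ := (measure_mono inter_subset_left |>.trans_lt Kc.measure_lt_top).ne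
  have i1 : Integrable ((K ∩ S).indicator (fun _ => (1:ℝ))) := by
    exact IntegrableOn.integrable_indicator₀ (integrableOn_const hfin) mS
  have mηΔ : MemLp (fun x => ‖η x • ΔZ x‖) 2 volume := by
    refine MemLp.norm (MemLp.of_le mΔ (D.hη.continuous.aestronglyMeasurable.smul mΔ.1) (ae_of_all _ fun x => ?_))
    rw [norm_smul]; exact mul_le_of_le_one_left (norm_nonneg _) (D.η1 x)
  have i2 : Integrable (fun x => |K.indicator (fun _ => (1:ℝ)) x * ‖η x • ΔZ x‖|) := (mK.integrable_mul mηΔ).abs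
  have i3 := D.iq P h j
  have i4 : Integrable (fun x => η x ^ 2 * ‖ΔZ x‖ ^ 2) := D.is h j
  have n2Δ : n2 (fun x => ‖η x • ΔZ x‖) ≤ Real.sqrt (C0 / κ) * h := by
    have : n2 (fun x => ‖η x • ΔZ x‖) ^ 2 ≤ (Real.sqrt (C0 / κ) * h) ^ 2 := by
      rw [n2_sq mηΔ, mul_pow, Real.sq_sqrt (div_nonneg D.C0n D.κp.le)]
      refine le_trans (le_of_eq ?_) hh.2
      congr 1; ext x; rw [norm_smul, mul_pow, Real.norm_eq_abs, sq_abs]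
    exact (le_abs_self _).trans (abs_le_of_sq_le_sq this (by positivity))
  have j1 : Integrable (fun x => 2 * M * (K ∩ S).indicator (fun _ => (1:ℝ)) x) := i1.const_mul _
  have j2 : Integrable (fun x => A * l * (2 * M * (K ∩ S).indicator (fun _ => (1:ℝ)) x + |K.indicator (fun _ => (1:ℝ)) x * ‖η x • ΔZ x‖|)) := (iadd j1 i2).const_mul _
  have j3 : Integrable (fun x => l⁻¹ * ((h ^ 2)⁻¹ * (η x ^ 2 * qq p (Z (x + h • ev j)) (Z x)))) := (i3.const_mul _).const_mul _
  have j4 : Integrable (fun x => C * (h⁻¹ * (η x ^ 2 * ‖ΔZ x‖ ^ 2))) := (i4.const_mul _).const_mul _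
  rw [← Real.norm_eq_abs]
  refine (norm_integral_le_of_norm_le ((iadd (iadd j2 j3) j4).const_mul c) (ae_of_all _ pt)).trans ?_
  rw [integral_const_mul, integral_add (iadd j2 j3) j4, integral_add j2 j3, integral_const_mul, integral_add j1 i2, integral_const_mul, integral_const_mul, integral_const_mul, integral_const_mul, integral_const_mul]
  have k1 : ∫ x, (K ∩ S).indicator (fun _ => (1:ℝ)) x = (volume (K ∩ S)).toReal := by
    rw [integral_indicator₀ mS]; simp [Measure.real]
  have k2 : ∫ x, |K.indicator (fun _ => (1:ℝ)) x * ‖η x • ΔZ x‖| ≤ s * (Real.sqrt (C0 / κ) * h) :=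
    (n2_cs_abs mK mηΔ).trans (by gcongr)
  rw [k1]
  have k3 : (h ^ 2)⁻¹ * ∫ x, η x ^ 2 * qq p (Z (x + h • ev j)) (Z x) ≤ C0 := by
    rw [inv_mul_le_iff₀ (by positivity)]; linarith [hh.1]
  have k4 : h⁻¹ * ∫ x, η x ^ 2 * ‖ΔZ x‖ ^ 2 ≤ C0 / κ * h := by
    rw [inv_mul_le_iff₀ (by positivity)]; refine hh.2.trans (le_of_eq (by ring))
  have li : 0 < l⁻¹ := by positivity
  calc _ ≤ c * (A * l * (2 * M * (volume (K ∩ S)).toReal + s * (Real.sqrt (C0 / κ) * h)) + l⁻¹ * C0 + C * (C0 / κ * h)) := by gcongr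
    _ = c * (A * l * (2 * M * (volume (K ∩ S)).toReal) + l⁻¹ * C0) + c * (A * l * (s * (Real.sqrt (C0 / κ) * h)) + C * (C0 / κ * h)) := by ring
    _ ≤ _ := by gcongr

theorem Est.final (D : Est p Z η κ C0) (P : PF p L) {B : ℝ} (hB : ∀ t, |deriv th t| ≤ B)
    (hφ : ContDiff ℝ 1 φ) (hφc : HasCompactSupport φ) {c : ℝ} (hc : ∀ x, |φ x| ≤ c) (hη : ∀ x ∈ tsupport φ, η x = 1)
    {M l : ℝ} (hM : 1 ≤ M) (hl : 0 < l) (i j : Fin n) (a : Fin N) {u : EVec n → ℝ}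
    (Wi : WD i u (fun x => Z x (a, i))) (Wj : WD j u (fun x => Z x (a, j))) :
    |∫ x, (VV M (Z x) (a, i) * fderiv ℝ φ x (ev j) - VV M (Z x) (a, j) * fderiv ℝ φ x (ev i))| ≤
      2 * (c * ((64 * B ^ 2 / p 1) * l * (2 * M * (volume (tsupport φ ∩ {x | M ≤ ‖Z x‖})).toReal) + l⁻¹ * C0)) := by
  set R := c * ((64 * B ^ 2 / p 1) * l * (2 * M * (volume (tsupport φ ∩ {x | M ≤ ‖Z x‖})).toReal) + l⁻¹ * C0) with hR
  have mV := memLp_VV M D.mZ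
  have mi := memLp_coord mV (a, i)
  have mj := memLp_coord mV (a, j)
  have φ2 := hφ.continuous.memLp_of_hasCompactSupport (p := 2) (μ := (volume : Measure (EVec n))) hφc
  have w1 := wk_dq mi (WD.of_smooth (i := j) hφ hφc)
  have w2 := wk_dq mj (WD.of_smooth (i := i) hφ hφc)
  have hF : MemLp (fun x => φ x * mm M (Z x)) 2 volume := by
    refine MemLp.of_le_mul (c := 1 + 8 * B) φ2 (φ2.1.mul ((mm_cont M).comp_aestronglyMeasurable D.mZ.1)) (ae_of_all _ fun x => ?_)
    rw [norm_mul, mul_comm]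
    gcongr
    exact mm_bound M hB _
  have w3 := weak_zero Wi Wj D.hη D.hηc (D.n2b P j (a, i)) (D.n2b P i (a, j)) hF
  have w4 := (w1.sub w2).sub w3
  have dm : ∀ (k : Fin n), MemLp (fun x => fderiv ℝ φ x (ev k)) 2 volume := fun k => (WD.of_smooth (i := k) hφ hφc).mg
  have e0 : -∫ x, (VV M (Z x) (a, i) * fderiv ℝ φ x (ev j) - VV M (Z x) (a, j) * fderiv ℝ φ x (ev i)) = (-∫ x, fderiv ℝ φ x (ev j) * VV M (Z x) (a, i)) - (-∫ x, fderiv ℝ φ x (ev i) * VV M (Z x) (a, j)) - 0 := by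
    rw [integral_sub (int_mul_L2 mi (dm j)) (int_mul_L2 mj (dm i))]
    simp only [mul_comm]; ring
  rw [← abs_neg, e0]
  apply le_of_forall_pos_le_add
  intro ε hε
  refine le_of_tendsto w4.abs ?_
  filter_upwards [D.bad P hB hφ.continuous hφc hc hη hM hl j (a, i) (half_pos hε), D.bad P hB hφ.continuous hφc hc hη hM hl i (a, j) (half_pos hε)] with h h1 h2
  have mη : ∀ {v : EVec n → ℝ}, MemLp v 2 volume → MemLp (fun x => η x * v x) 2 volume := by
    intro v hv
    refine MemLp.of_le hv (D.hη.continuous.aestronglyMeasurable.mul hv.1) (ae_of_all _ fun x => ?_)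
    rw [norm_mul]; exact mul_le_of_le_one_left (norm_nonneg _) (D.η1 x)
  have a1 := int_mul_L2 φ2 (memLp_dq mi h j)
  have a2 := int_mul_L2 φ2 (memLp_dq mj h i)
  have b1 := int_mul_L2 hF (mη (memLp_dq Wi.mg h j))
  have b2 := int_mul_L2 hF (mη (memLp_dq Wj.mg h i))
  rw [integral_sub a1 b1] at h1
  rw [integral_sub a2 b2] at h2
  rw [integral_sub b1 b2]
  rw [abs_le] at *
  constructor <;> linarith [h1.1, h1.2, h2.1, h2.2]

end PF6
end MPF6

section MPG
section PG
variable {n N : ℕ}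

theorem per_k {Ω : Set (EVec n)} (hΩ : IsOpen Ω) (hfin : volume Ω ≠ ⊤) {f p : ℝ → ℝ} {L : ℝ} (P : FP f p L) (h0 : f 0 = 0)
    {finf : ℝ} (hfinf : Filter.Tendsto (fun t => f t / t) Filter.atTop (nhds finf))
    {T₀ : EVec n → Fin N → Fin n → ℝ} (hT : MemLp (fun x => tm (T₀ x)) 2 (volume.restrict Ω))
    (hTsmall : linfNormOn Ω T₀ < ENNReal.ofReal finf)
    {C : NNReal} {DT : EVec n → EVec n →L[ℝ] (Fin N → Fin n → ℝ)}
    (hd : ∀ x ∈ Ω, HasFDerivWithinAt T₀ (DT x) Ω x) (hl : LipschitzOnWith C DT Ω)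
    {φ : EVec n → ℝ} (hφ : ContDiff ℝ 1 φ) (hφc : HasCompactSupport φ) (hφs : tsupport φ ⊆ Ω) :
    ∃ A1 A2 : ℝ, 0 ≤ A1 ∧ 0 ≤ A2 ∧ ∀ (k : ℕ) (u : EVec n → Fin N → ℝ) (Du : EVec n → Fin N → Fin n → ℝ), 0 < k → MemW12 Ω u Du →
    (∀ (w : EVec n → Fin N → ℝ) (Dw : EVec n → Fin N → Fin n → ℝ),
        MemW12 Ω w Dw → FFk Ω f T₀ k Du ≤ FFk Ω f T₀ k Dw) → ∀ (M l : ℝ), 1 ≤ M → 0 < l → ∀ (a : Fin N) (i j : Fin n),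
    |∫ x in tsupport φ, (VV M (tm (Du x)) (a, i) * fderiv ℝ φ x (ev j) - VV M (tm (Du x)) (a, j) * fderiv ℝ φ x (ev i))| ≤
      A1 * l * (M * (volume (tsupport φ ∩ {x | M ≤ ‖tm (Du x)‖})).toReal) + l⁻¹ * A2 := by
  obtain ⟨η, hη, hηc, hηs, hη01, O1, hO1, hO1', hη1⟩ := cutoff hφc.isCompact hΩ hφs
  obtain ⟨χ, hχ, hχc, hχs, hχ01, O2, hO2, hO2', hχ1⟩ := cutoff hηc.isCompact hΩ hηs
  set O := O2 ∩ Ω with hO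
  have hOo : IsOpen O := hO2.inter hΩ
  obtain ⟨δ, hδ, hδO⟩ := hηc.isCompact.exists_thickening_subset_open hOo (subset_inter hO2' hηs)
  have hδO' : ∀ x ∈ tsupport η, ∀ y, dist y x < δ → y ∈ O := fun x hx y hy => hδO (Metric.mem_thickening_iff.2 ⟨x, hx, hy⟩)
  obtain ⟨M0, hM0⟩ := energy_bound hΩ hfin P h0 hfinf hT hTsmall
  obtain ⟨B, B0, hB⟩ := dth_bound
  obtain ⟨c, hc⟩ := hφc.exists_bound_of_continuous hφ.continuous
  have c0 : 0 ≤ c := (norm_nonneg _).trans (hc 0)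
  have hη1' : ContDiff ℝ 1 η := hη.of_le (by norm_num)
  have hbd : ∃ b : ℝ, 0 ≤ b ∧ ∀ x (i : Fin n), |fderiv ℝ η x (ev i)| ≤ b := by
    obtain ⟨b, hb⟩ := (hηc.fderiv ℝ).exists_bound_of_continuous (hη1'.continuous_fderiv (by norm_num))
    refine ⟨b, (norm_nonneg _).trans (hb 0), fun x i => ?_⟩
    have := (fderiv ℝ η x).le_opNorm (ev i)
    rw [norm_ev, mul_one] at this
    exact this.trans (hb x)
  obtain ⟨b, b0, hb⟩ := hbd
  have Lp := P.toPF.L_pos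
  set M1 := max M0 0 with hM1
  have M10 : 0 ≤ M1 := le_max_right _ _
  set C0 := 2 * ((C:ℝ) * (N * n * M1) + n * b ^ 2 * (8 * L * M1 + 4 * M1) + 1) with hC0
  have C0n : 0 ≤ C0 := by positivity
  have p1 := P.toPF.pos 1 one_pos
  refine ⟨2 * (c * ((64 * B ^ 2 / p 1) * 2)), 2 * c * C0, by positivity, by positivity, ?_⟩
  intro k u Du hk hu hmin M l hM hl' a i j
  have D := loc_mk hΩ hfin P h0 hT hd hl k hu hmin hOo inter_subset_right hη1' hηc (hχ.of_le (by norm_num)) hχc hχs (fun x hx => hχ1 x hx.1) hδ hδO'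
  obtain ⟨E1, E2⟩ := hM0 k u Du hk hu hmin
  set g : Fin N → Fin n → EVec n → ℝ := fun a i x => χ x * Du x a i + fderiv ℝ χ x (ev i) * u x a with hg
  have fχ : ∀ x ∈ O, fderiv ℝ χ x = 0 := by
    intro x hx
    have : χ =ᶠ[𝓝 x] fun _ => 1 := by filter_upwards [hOo.mem_nhds hx] with y hy using hχ1 y hy.1
    rw [this.fderiv_eq]; simp
  have gO : ∀ x ∈ O, (tm fun a i => g a i x) = tm (Du x) := by
    intro x hx; congr 1; ext a i; simp [hg, hχ1 x hx.1, fχ x hx]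
  have ηO : tsupport η ⊆ O := subset_inter hO2' hηs
  have hm := memLp_tm hu
  haveI : IsFiniteMeasure (volume.restrict Ω) := ⟨by simpa using hfin.lt_top⟩
  have int1 : IntegrableOn (fun x => ‖tm (Du x)‖) Ω := (hm.integrable (by norm_num)).norm
  have int2 : IntegrableOn (fun x => ‖tm (Du x)‖ ^ 2) Ω := (memLp_two_iff_integrable_sq_norm hm.1).1 hm
  have hMa : ∫ x in tsupport η, ‖tm fun a i => g a i x‖ ≤ M1 := by
    rw [setIntegral_congr_fun (g := fun x => ‖tm (Du x)‖) hηc.isCompact.measurableSet (fun x hx => by simp only [gO x (ηO hx)])]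
    refine (setIntegral_mono_set int1 (ae_of_all _ fun x => norm_nonneg _) hηs.eventuallyLE).trans (E1.trans (le_max_left _ _))
  have hMb : (k:ℝ)⁻¹ * ∫ x in tsupport η, ‖tm fun a i => g a i x‖ ^ 2 ≤ M1 := by
    rw [setIntegral_congr_fun (g := fun x => ‖tm (Du x)‖ ^ 2) hηc.isCompact.measurableSet (fun x hx => by simp only [gO x (ηO hx)])]
    refine le_trans ?_ (E2.trans (le_max_left _ _))
    exact mul_le_mul_of_nonneg_left (setIntegral_mono_set int2 (ae_of_all _ fun x => sq_nonneg _) hηs.eventuallyLE) (by positivity)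
  have kk : (1:ℝ) ≤ k := by exact_mod_cast hk
  have ηa : ∀ x, |η x| ≤ 1 := fun x => abs_le.2 ⟨by linarith [(hη01 x).1], (hη01 x).2⟩
  have main := D.main P.toPF (by positivity) (inv_le_one_of_one_le₀ kk) ηa hb C.2 hMa hMb
  have Es : Est p (fun x => tm fun a i => g a i x) η ((k:ℝ)⁻¹) C0 :=
    ⟨memLp_tm_of fun a i => (D.wd a i).mg, hη, hηc, ηa, by positivity, C0n, main⟩
  have F := Es.final P.toPF hB hφ hφc hc (fun x hx => hη1 x (hO1' hx)) hM hl' i j a (D.wd a i) (D.wd a j)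
  have φη : tsupport φ ⊆ tsupport η := by
    intro x hx
    apply subset_tsupport
    simp [hη1 x (hO1' hx)]
  have e1 : ∫ x, (VV M (tm fun a i => g a i x) (a, i) * fderiv ℝ φ x (ev j) - VV M (tm fun a i => g a i x) (a, j) * fderiv ℝ φ x (ev i)) =
      ∫ x in tsupport φ, (VV M (tm (Du x)) (a, i) * fderiv ℝ φ x (ev j) - VV M (tm (Du x)) (a, j) * fderiv ℝ φ x (ev i)) := by
    rw [← setIntegral_eq_integral_of_forall_compl_eq_zero (s := tsupport φ)]
    · refine setIntegral_congr_fun hφc.isCompact.measurableSet (fun x hx => ?_)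
      simp only [gO x (ηO (φη hx))]
    · intro x hx
      have : fderiv ℝ φ x = 0 := by
        by_contra h
        exact hx (support_fderiv_subset ℝ h)
      simp [this]
  have e2 : tsupport φ ∩ {x | M ≤ ‖tm fun a i => g a i x‖} = tsupport φ ∩ {x | M ≤ ‖tm (Du x)‖} := by
    ext x
    simp only [mem_inter_iff, mem_setOf_eq]
    refine and_congr_right fun hx => ?_
    rw [gO x (ηO (φη hx))]
  rw [e1, e2] at F
  refine F.trans (le_of_eq (by ring))

noncomputable def ps (M : ℝ) (t : ℝ) : ℝ := min 1 (max 0 (2 * t / M - 1))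

theorem ps_cont (M : ℝ) : Continuous (ps M) := by unfold ps; fun_prop
theorem ps_nonneg (M t : ℝ) : 0 ≤ ps M t := le_min zero_le_one (le_max_left _ _)
theorem ps_le (M t : ℝ) : ps M t ≤ 1 := min_le_left _ _
theorem ps_one {M t : ℝ} (hM : 0 < M) (h : M ≤ t) : ps M t = 1 := by
  unfold ps
  apply min_eq_left
  apply le_max_of_le_right
  have : 2 ≤ 2 * t / M := by rw [le_div_iff₀ hM]; linarith
  linarith
theorem ps_zero {M t : ℝ} (hM : 0 < M) (h : 2 * t ≤ M) : ps M t = 0 := by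
  unfold ps
  have : 2 * t / M ≤ 1 := by rw [div_le_iff₀ hM]; linarith
  rw [max_eq_left (by linarith)]; simp
theorem ps_mul {M t : ℝ} (hM : 0 < M) (ht : 0 ≤ t) : M * ps M t ≤ 2 * t := by
  rcases le_total (2 * t) M with h | h
  · rw [ps_zero hM h]; linarith
  · have := ps_le M t; nlinarith

theorem VV_norm' {M : ℝ} (hM : 0 < M) (z : HM N n) : ‖VV M z‖ ≤ 2 * M := by
  rcases le_total (2 * M) ‖z‖ with h | h
  · rw [VV_zero hM h]; simp; linarith
  · exact (VV_norm M z).trans h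

theorem lim_curl {K : Set (EVec n)} (hK : IsCompact K) {W : ℕ → EVec n → HM N n} {W0 : EVec n → HM N n}
    (mW : ∀ k, AEStronglyMeasurable (W k) (volume.restrict K)) (iW : IntegrableOn W0 K)
    (hlim : ∀ᵐ x ∂(volume.restrict K), Tendsto (fun k => W k x) atTop (𝓝 (W0 x)))
    {d1 d2 : EVec n → ℝ} (hd1 : Continuous d1) (hd2 : Continuous d2) {A1 A2 : ℝ} (hA1 : 0 ≤ A1) (hA2 : 0 ≤ A2) (q1 q2 : Fin N × Fin n)
    (hb : ∀ᶠ k in atTop, ∀ M l, 1 ≤ M → 0 < l → |∫ x in K, (VV M (W k x) q1 * d1 x - VV M (W k x) q2 * d2 x)| ≤ A1 * l * (M * (volume (K ∩ {x | M ≤ ‖W k x‖})).toReal) + l⁻¹ * A2) :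
    ∫ x in K, (W0 x q1 * d1 x - W0 x q2 * d2 x) = 0 := by
  haveI : IsFiniteMeasure (volume.restrict K) := ⟨by simpa using hK.measure_lt_top⟩
  obtain ⟨c1, hc1⟩ := hK.exists_bound_of_continuousOn hd1.continuousOn
  obtain ⟨c2, hc2⟩ := hK.exists_bound_of_continuousOn hd2.continuousOn
  have inK : ∀ᵐ x ∂(volume.restrict K), x ∈ K := ae_restrict_mem hK.measurableSet
  have cV : ∀ (M : ℝ) (q : Fin N × Fin n), Continuous (fun z : HM N n => VV M z q) := fun M q => (PiLp.continuous_apply 2 _ q).comp (VV_cd M).continuous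
  have meas : ∀ (M : ℝ) (Y : EVec n → HM N n), AEStronglyMeasurable Y (volume.restrict K) → AEStronglyMeasurable (fun x => VV M (Y x) q1 * d1 x - VV M (Y x) q2 * d2 x) (volume.restrict K) := fun M Y hY =>
    (((cV M q1).comp_aestronglyMeasurable hY).mul hd1.aestronglyMeasurable).sub (((cV M q2).comp_aestronglyMeasurable hY).mul hd2.aestronglyMeasurable)
  have nb : ∀ (z : HM N n) (x) (r : ℝ), x ∈ K → ‖z‖ ≤ r → ‖z q1 * d1 x - z q2 * d2 x‖ ≤ r * (c1 + c2) := by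
    intro z x r hx hz
    refine (norm_sub_le _ _).trans ?_
    rw [norm_mul, norm_mul, mul_add]
    have r0 := (norm_nonneg _).trans hz
    exact add_le_add (mul_le_mul ((PiLp.norm_apply_le z q1).trans hz) (hc1 x hx) (norm_nonneg _) r0) (mul_le_mul ((PiLp.norm_apply_le z q2).trans hz) (hc2 x hx) (norm_nonneg _) r0)
  have s1 : ∀ M l, 1 ≤ M → 0 < l → |∫ x in K, (VV M (W0 x) q1 * d1 x - VV M (W0 x) q2 * d2 x)| ≤ A1 * l * (∫ x in K, M * ps M ‖W0 x‖) + l⁻¹ * A2 := by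
    intro M l hM hl
    have hM0 : 0 < M := by linarith
    have t1 : Tendsto (fun k => ∫ x in K, (VV M (W k x) q1 * d1 x - VV M (W k x) q2 * d2 x)) atTop (𝓝 (∫ x in K, (VV M (W0 x) q1 * d1 x - VV M (W0 x) q2 * d2 x))) := by
      refine tendsto_integral_of_dominated_convergence (fun _ => 2 * M * (c1 + c2)) (fun k => meas M _ (mW k)) (integrable_const _) (fun k => ?_) ?_
      · filter_upwards [inK] with x hx using nb _ x _ hx (VV_norm' hM0 _)
      · filter_upwards [hlim] with x hx
        exact ((((cV M q1).tendsto _).comp hx).mul_const _).sub ((((cV M q2).tendsto _).comp hx).mul_const _)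
    have t2 : Tendsto (fun k => ∫ x in K, M * ps M ‖W k x‖) atTop (𝓝 (∫ x in K, M * ps M ‖W0 x‖)) := by
      refine tendsto_integral_of_dominated_convergence (fun _ => M) (fun k => ?_) (integrable_const _) (fun k => ae_of_all _ fun x => ?_) ?_
      · exact ((continuous_const.mul (ps_cont M)).comp_aestronglyMeasurable (mW k).norm)
      · rw [Real.norm_of_nonneg (mul_nonneg hM0.le (ps_nonneg _ _))]
        exact mul_le_of_le_one_right hM0.le (ps_le _ _)
      · filter_upwards [hlim] with x hx
        exact ((ps_cont M).tendsto _ |>.comp hx.norm).const_mul M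
    refine le_of_tendsto_of_tendsto t1.abs ((t2.const_mul (A1 * l)).add_const (l⁻¹ * A2)) ?_
    filter_upwards [hb] with k hk
    refine (hk M l hM hl).trans ?_
    gcongr
    rw [integral_const_mul]
    gcongr
    have mS : NullMeasurableSet ({x | M ≤ ‖W k x‖}) (volume.restrict K) := nullMeasurableSet_le aemeasurable_const (mW k).norm.aemeasurable
    have : (volume (K ∩ {x | M ≤ ‖W k x‖})).toReal = ∫ x in K, {x | M ≤ ‖W k x‖}.indicator (fun _ => (1:ℝ)) x := by
      rw [integral_indicator₀ mS]
      simp [Measure.real, Measure.restrict_apply₀ mS, inter_comm, Measure.restrict_restrict₀ mS]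
    rw [this]
    have ip : Integrable (fun x => ps M ‖W k x‖) (volume.restrict K) := Integrable.of_bound ((ps_cont M).comp_aestronglyMeasurable (mW k).norm) 1 (ae_of_all _ fun x => by
        rw [Real.norm_of_nonneg (ps_nonneg _ _)]; exact ps_le _ _)
    refine integral_mono ((integrable_const (1:ℝ)).indicator₀ mS) ip fun x => ?_
    by_cases hx : x ∈ {x | M ≤ ‖W k x‖}
    · simp only [indicator_of_mem hx]; rw [ps_one hM0 hx]
    · simp only [indicator_of_notMem hx]; exact ps_nonneg _ _
  have u1 : Tendsto (fun m : ℕ => ∫ x in K, (VV m (W0 x) q1 * d1 x - VV m (W0 x) q2 * d2 x)) atTop (𝓝 (∫ x in K, (W0 x q1 * d1 x - W0 x q2 * d2 x))) := by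
    refine tendsto_integral_of_dominated_convergence (fun x => ‖W0 x‖ * (c1 + c2)) (fun k => meas _ _ iW.1) (iW.norm.mul_const _) (fun k => ?_) ?_
    · filter_upwards [inK] with x hx using nb _ x _ hx (VV_norm _ _)
    · refine ae_of_all _ fun x => tendsto_const_nhds.congr' ?_
      filter_upwards [eventually_ge_atTop (max 1 ⌈‖W0 x‖⌉₊)] with m hm
      rw [VV_eq]
      · have := (le_max_left _ _).trans hm
        exact_mod_cast this
      · exact (Nat.le_ceil _).trans (by exact_mod_cast (le_max_right _ _).trans hm)
  have u2 : Tendsto (fun m : ℕ => ∫ x in K, (m:ℝ) * ps m ‖W0 x‖) atTop (𝓝 (∫ x in K, (0:ℝ))) := by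
    refine tendsto_integral_of_dominated_convergence (fun x => 2 * ‖W0 x‖) (fun k => ?_) (iW.norm.const_mul _) (fun k => ae_of_all _ fun x => ?_) ?_
    · exact ((continuous_const.mul (ps_cont _)).comp_aestronglyMeasurable iW.1.norm)
    · rw [Real.norm_of_nonneg (mul_nonneg (by positivity) (ps_nonneg _ _))]
      rcases Nat.eq_zero_or_pos k with rfl | hk
      · simp
      · exact ps_mul (by exact_mod_cast hk) (norm_nonneg _)
    · refine ae_of_all _ fun x => tendsto_const_nhds.congr' ?_
      filter_upwards [eventually_ge_atTop (max 1 ⌈2 * ‖W0 x‖⌉₊)] with m hm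
      rw [ps_zero, mul_zero]
      · have := (le_max_left _ _).trans hm
        exact_mod_cast this
      · exact (Nat.le_ceil _).trans (by exact_mod_cast (le_max_right _ _).trans hm)
  rw [integral_zero] at u2
  have u3 : ∀ l : ℝ, 0 < l → |∫ x in K, (W0 x q1 * d1 x - W0 x q2 * d2 x)| ≤ l⁻¹ * A2 := by
    intro l hl
    have := (u2.const_mul (A1 * l)).add_const (l⁻¹ * A2)
    rw [mul_zero, zero_add] at this
    refine le_of_tendsto_of_tendsto u1.abs this ?_
    filter_upwards [eventually_ge_atTop 1] with m hm
    exact s1 m l (by exact_mod_cast hm) hl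
  have u4 : Tendsto (fun l : ℝ => l⁻¹ * A2) atTop (𝓝 (0 * A2)) := tendsto_inv_atTop_zero.mul_const _
  rw [zero_mul] at u4
  have := ge_of_tendsto u4 (by filter_upwards [eventually_gt_atTop 0] with l hl using u3 l hl)
  exact abs_eq_zero.1 (le_antisymm this (abs_nonneg _))

theorem curlFree_main
    (Ω : Set (EVec n))
    (hΩ : IsOpen Ω) (hΩbdd : Bornology.IsBounded Ω)
    (L : ℝ) (hL : 0 < L)
    (f f' f'' : ℝ → ℝ)
    (hderiv : ∀ t ∈ Set.Ici (0:ℝ), HasDerivWithinAt f (f' t) (Set.Ici 0) t)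
    (hderiv' : ∀ t ∈ Set.Ici (0:ℝ), HasDerivWithinAt f' (f'' t) (Set.Ici 0) t)
    (hf''cont : ContinuousOn f'' (Set.Ici 0))
    (hstrict : StrictConvexOn ℝ (Set.Ici 0) f)
    (hf0 : f 0 = 0) (hf'0 : f' 0 = 0)
    (hgrowth : ∀ t ∈ Set.Ici (0:ℝ), f t ≤ L * (t + 1))
    (hsec : ∀ t ∈ Set.Ici (0:ℝ), f'' t ≤ L * (1 + t)⁻¹)
    (finf : ℝ) (hfinf : Filter.Tendsto (fun t => f t / t) Filter.atTop (nhds finf))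
    (T₀ : EVec n → Fin N → Fin n → ℝ)
    (hT : MemW2inf Ω T₀)
    (hTsmall : linfNormOn Ω T₀ < ENNReal.ofReal finf)
    (u : ℕ → EVec n → Fin N → ℝ) (Du : ℕ → EVec n → Fin N → Fin n → ℝ)
    (hmem : ∀ k, 0 < k → MemW12 Ω (u k) (Du k))
    (hmin : ∀ k, 0 < k →
      ∀ (w : EVec n → Fin N → ℝ) (Dw : EVec n → Fin N → Fin n → ℝ),
        MemW12 Ω w Dw → FFk Ω f T₀ k (Du k) ≤ FFk Ω f T₀ k Dw)
    (E : EVec n → Fin N → Fin n → ℝ)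
    (hE : IntegrableOn E Ω volume)
    (φ : ℕ → ℕ) (hφ : StrictMono φ)
    (hlim : ∀ᵐ x ∂(volume.restrict Ω),
      Filter.Tendsto (fun l => Du (φ l) x) Filter.atTop (nhds (E x))) :
    CurlFreeOn Ω E := by
  have hfin : volume Ω ≠ ⊤ := hΩbdd.measure_lt_top.ne
  haveI : IsFiniteMeasure (volume.restrict Ω) := ⟨by simpa using hfin.lt_top⟩
  have P := FP.mk' L f f' f'' hderiv hderiv' hf''cont hstrict hf0 hf'0 hgrowth hsec hL.le
  obtain ⟨C, DT, hTb, hTd, hDTb, hDTl⟩ := hT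
  have mT : MemLp (fun x => tm (T₀ x)) 2 (volume.restrict Ω) := by
    have hc : ContinuousOn T₀ Ω := fun x hx => (hTd x hx).continuousWithinAt
    have m : AEStronglyMeasurable (fun x => tm (T₀ x)) (volume.restrict Ω) :=
      tm.continuous.comp_aestronglyMeasurable (hc.aestronglyMeasurable hΩ.measurableSet)
    refine MemLp.of_bound m (‖(tm : (Fin N → Fin n → ℝ) →L[ℝ] HM N n)‖ * C) ?_
    filter_upwards [ae_restrict_mem hΩ.measurableSet] with x hx
    exact (tm.le_opNorm _).trans (mul_le_mul_of_nonneg_left (hTb x hx) (norm_nonneg _))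
  intro ψ hψ hψc hψs a i j
  obtain ⟨A1, A2, hA1, hA2, hk⟩ := per_k hΩ hfin P hf0 hfinf mT hTsmall hTd hDTl hψ hψc hψs
  have rst : volume.restrict (tsupport ψ) ≤ volume.restrict Ω := Measure.restrict_mono hψs le_rfl
  have hk1 : ∀ k, 0 < φ (k + 1) := fun k => (Nat.succ_pos k).trans_le (hφ.id_le _)
  have := lim_curl (N := N) hψc.isCompact (W := fun l x => tm (Du (φ (l + 1)) x)) (W0 := fun x => tm (E x)) (fun l => ?_) ?_ ?_ (cont_fd hψ (ev j)) (cont_fd hψ (ev i)) hA1 hA2 (a, i) (a, j) (.of_forall fun l M r hM hr => hk _ _ _ (hk1 l) (hmem _ (hk1 l)) (hmin _ (hk1 l)) M r hM hr a i j)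
  · rw [setIntegral_eq_integral_of_forall_compl_eq_zero] at this ⊢
    · exact this
    · intro x hx
      have : fderiv ℝ ψ x = 0 := by
        by_contra h
        exact hx (hψs (support_fderiv_subset ℝ h))
      simp [this]
    · intro x hx
      have : fderiv ℝ ψ x = 0 := by
        by_contra h
        exact hx (support_fderiv_subset ℝ h)
      simp [this]
  · exact (memLp_tm (hmem _ (hk1 l))).1.mono_measure rst
  · exact tm.integrable_comp (hE.mono_set hψs)
  · filter_upwards [ae_mono rst hlim] with x hx
    exact (tm.continuous.tendsto _).comp (hx.comp (tendsto_add_atTop_nat 1))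

end PG
end MPG

section MPH1
open scoped ENNReal RealInnerProductSpace Convolution

section PH1
variable {n : ℕ}

noncomputable def bmp (n k : ℕ) : ContDiffBump (0 : EVec n) where
  rIn := 1 / (2 * ((k:ℝ) + 1))
  rOut := 1 / ((k:ℝ) + 1)
  rIn_pos := by positivity
  rIn_lt_rOut := by
    apply one_div_lt_one_div_of_lt <;> nlinarith [(Nat.cast_nonneg k : (0:ℝ) ≤ k)]

noncomputable def rk (n k : ℕ) : EVec n → ℝ := (bmp n k).normed volume

noncomputable def mol (k : ℕ) (f : EVec n → ℝ) : EVec n → ℝ :=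
  (rk n k) ⋆[ContinuousLinearMap.lsmul ℝ ℝ, volume] f

theorem rk_cs (k) : HasCompactSupport (rk n k) := (bmp n k).hasCompactSupport_normed
theorem rk_cd (k) {m : ℕ∞} : ContDiff ℝ m (rk n k) := (bmp n k).contDiff_normed
theorem rk_ts (k) : tsupport (rk n k) = Metric.closedBall 0 (1 / ((k:ℝ) + 1)) :=
  (bmp n k).tsupport_normed_eq
theorem rOut_lim : Tendsto (fun k => (bmp n k).rOut) atTop (𝓝 0) := tendsto_one_div_add_atTop_nhds_zero_nat

theorem mol_ae {f : EVec n → ℝ} (hf : LocallyIntegrable f) :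
    ∀ᵐ x, Tendsto (fun k => mol k f x) atTop (𝓝 (f x)) :=
  ContDiffBump.ae_convolution_tendsto_right_of_locallyIntegrable (K := 2) (φ := bmp n) rOut_lim
    (Eventually.of_forall fun k => by
      simp only [bmp]; apply le_of_eq; field_simp) hf

theorem mol_cd {f : EVec n → ℝ} (hf : LocallyIntegrable f) (k) : ContDiff ℝ 2 (mol k f) := by
  have := (rk_cs (n := n) k).contDiff_convolution_left (n := 2) (ContinuousLinearMap.lsmul ℝ ℝ) (rk_cd k) hf
  exact_mod_cast this

noncomputable def tf (k : ℕ) (x y : EVec n) : ℝ := rk n k (x - y)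

theorem tf_cd (k) (x : EVec n) : ContDiff ℝ 1 (tf k x) :=
  (rk_cd (n := n) (m := 1) k).comp (contDiff_const.sub contDiff_id)

theorem tf_ts (k) (x : EVec n) : tsupport (tf k x) ⊆ Metric.closedBall x (1 / ((k:ℝ) + 1)) := by
  apply closure_minimal _ Metric.isClosed_closedBall
  intro y hy
  have h : x - y ∈ tsupport (rk n k) := subset_tsupport _ hy
  rw [rk_ts] at h
  rw [Metric.mem_closedBall, dist_comm, dist_eq_norm]
  simpa using h

theorem tf_cs (k) (x : EVec n) : HasCompactSupport (tf k x) :=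
  (isCompact_closedBall _ _).of_isClosed_subset (isClosed_tsupport _) (tf_ts k x)

theorem mol_eq (k) (f : EVec n → ℝ) (x) : mol k f x = ∫ y, f y * tf k x y := by
  rw [mol, convolution_lsmul_swap]
  simp [tf, mul_comm]

theorem tf_fd (k) (x y v : EVec n) : fderiv ℝ (tf k x) y v = - fderiv ℝ (rk n k) (x - y) v := by
  have h1 : HasFDerivAt (rk n k) (fderiv ℝ (rk n k) (x - y)) (x - y) :=
    ((rk_cd (n := n) (m := 1) k).differentiable (by norm_num) _).hasFDerivAt
  have h2 : HasFDerivAt (fun y : EVec n => x - y) (-ContinuousLinearMap.id ℝ _) y :=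
    (hasFDerivAt_id y).const_sub x
  rw [show tf k x = rk n k ∘ (fun y => x - y) from rfl, (h1.comp y h2).fderiv]
  simp

theorem mol_fd {f : EVec n → ℝ} (hf : LocallyIntegrable f) (k) (x v : EVec n) :
    fderiv ℝ (mol k f) x v = - ∫ y, f y * fderiv ℝ (tf k x) y v := by
  have h1 : ContDiff ℝ 1 (rk n k) := rk_cd k
  rw [mol, ((rk_cs k).hasFDerivAt_convolution_left (ContinuousLinearMap.lsmul ℝ ℝ) h1 hf x).fderiv,
    convolution_eq_swap, ContinuousLinearMap.integral_apply, ← integral_neg]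
  · congr 1; ext y
    rw [tf_fd]; simp [ContinuousLinearMap.precompL_apply, mul_comm]
  · have := ((rk_cs (n := n) k).fderiv ℝ).convolutionExists_left
      ((ContinuousLinearMap.lsmul ℝ ℝ : ℝ →L[ℝ] ℝ →L[ℝ] ℝ).precompL (EVec n)) (h1.continuous_fderiv (by norm_num)) hf x
    exact (convolutionExistsAt_iff_integrable_swap).1 this

theorem mol_sub {f g : EVec n → ℝ} (hf : LocallyIntegrable f) (hg : LocallyIntegrable g) (k) (x) :
    mol k (fun y => f y - g y) x = mol k f x - mol k g x := by
  have e : ∀ {f : EVec n → ℝ}, LocallyIntegrable f → Integrable fun y => f y * tf k x y := fun h => by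
    simpa [mul_comm] using h.integrable_smul_right_of_hasCompactSupport (tf_cd k x).continuous (tf_cs k x)
  rw [mol_eq, mol_eq, mol_eq, ← integral_sub (e hf) (e hg)]
  congr 1; ext y; ring

theorem mol_int {f : EVec n → ℝ} (hf : Integrable f) (k) : Integrable (mol k f) :=
  (((rk_cd (n := n) (m := 0) k).continuous).integrable_of_hasCompactSupport (rk_cs k)).integrable_convolution _ hf

theorem mol_L1 {f : EVec n → ℝ} (hf : Integrable f) (k) : ∫ x, |mol k f x| ≤ ∫ x, |f x| := by
  have hr : Integrable (rk n k) := ((rk_cd (n := n) (m := 0) k).continuous).integrable_of_hasCompactSupport (rk_cs k)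
  have h1 : ∀ x, |mol k f x| ≤ ((rk n k) ⋆[ContinuousLinearMap.lsmul ℝ ℝ, volume] (fun y => |f y|)) x := by
    intro x
    rw [mol, convolution_def, convolution_def, ← Real.norm_eq_abs]
    refine (norm_integral_le_integral_norm _).trans (le_of_eq ?_)
    congr 1; ext y
    simp [abs_of_nonneg ((bmp n k).nonneg_normed (μ := volume) y), rk]
  refine (integral_mono (mol_int hf k).abs (hr.integrable_convolution _ hf.abs) h1).trans ?_
  rw [integral_convolution _ hr hf.abs]
  simp [rk, (bmp n k).integral_normed]

theorem mol_tendsto {f : EVec n → ℝ} (hf : Integrable f) :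
    Tendsto (fun k => ∫ x, |mol k f x - f x|) atTop (𝓝 0) := by
  rw [Metric.tendsto_atTop]
  intro ε hε
  obtain ⟨g, hgs, hg, hgc, hgi⟩ := hf.exists_hasCompactSupport_integral_sub_le (ε := ε / 4) (by positivity)
  have hgu := hgs.uniformContinuous_of_continuous hgc
  set S := Metric.cthickening 1 (tsupport g)
  have hS : IsCompact S := hgs.isCompact.cthickening
  have hSf : volume S < ∞ := hS.measure_lt_top
  set δ := ε / (4 * (volume.real S + 1)) with hδ
  have hδ0 : 0 < δ := by positivity
  obtain ⟨r, hr, hgr⟩ := Metric.uniformContinuous_iff.1 hgu δ hδ0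
  obtain ⟨K, hK⟩ := (Metric.tendsto_atTop.1 (rOut_lim (n := n))) r hr
  refine ⟨K, fun k hk => ?_⟩
  have hk' : (bmp n k).rOut < r := by
    have := hK k hk
    rw [Real.dist_eq, sub_zero, abs_of_pos (bmp n k).rOut_pos] at this; exact this
  have hb : ∀ x, |mol k g x - g x| ≤ S.indicator (fun _ => δ) x := by
    intro x
    by_cases hx : x ∈ S
    · rw [indicator_of_mem hx, ← Real.dist_eq]
      exact (bmp n k).dist_normed_convolution_le hgi.1 fun y hy =>
        (hgr (lt_trans hy hk')).le
    · rw [indicator_of_notMem hx]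
      have h0 : ∀ y, dist y x ≤ 1 → g y = 0 := by
        intro y hy
        by_contra h
        exact hx (Metric.mem_cthickening_of_dist_le x y 1 _ (subset_tsupport _ h) (by rwa [dist_comm]))
      have hrr : (bmp n k).rOut ≤ 1 := by
        show 1 / ((k:ℝ) + 1) ≤ 1
        rw [div_le_one (by positivity)]; linarith [(Nat.cast_nonneg k : (0:ℝ) ≤ k)]
      have := (bmp n k).dist_normed_convolution_le (μ := volume) (ε := 0) (x₀ := x) hgi.1 fun y hy => by
        rw [h0 y (hy.le.trans hrr), h0 x (by simp)]; simp
      rw [Real.dist_eq] at this; exact this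
  have i1 : Integrable (fun x => |mol k f x - f x|) := (isub (mol_int hf k) hf).abs
  have i2 : Integrable (fun x => |mol k (fun y => f y - g y) x|) := (mol_int (isub hf hgi) k).abs
  have i3 : Integrable (S.indicator (fun _ => δ)) := by
    rw [integrable_indicator_iff hS.measurableSet]; exact integrableOn_const hSf.ne
  have i4 : Integrable (fun x => |f x - g x|) := (isub hf hgi).abs
  have h : ∫ x, |mol k f x - f x| ≤ ∫ x, (|mol k (fun y => f y - g y) x| + S.indicator (fun _ => δ) x + |f x - g x|) := by
    refine integral_mono i1 (iadd (iadd i2 i3) i4) fun x => ?_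
    have e := mol_sub hf.locallyIntegrable hgi.locallyIntegrable k x
    have := hb x
    dsimp only
    rw [e]
    have t1 := abs_add_le (mol k f x - mol k g x + (mol k g x - g x)) (g x - f x)
    have t2 := abs_add_le (mol k f x - mol k g x) (mol k g x - g x)
    rw [abs_sub_comm (f x)]
    rw [show mol k f x - f x = mol k f x - mol k g x + (mol k g x - g x) + (g x - f x) by ring]
    linarith
  rw [integral_add (iadd i2 i3) i4, integral_add i2 i3, integral_indicator hS.measurableSet] at h
  have h5 := mol_L1 (isub hf hgi) k
  have h6 : ∫ x, |f x - g x| ≤ ε / 4 := by simpa [Real.norm_eq_abs] using hg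
  have h7 : ∫ x in S, δ ≤ ε / 4 := by
    rw [setIntegral_const, smul_eq_mul, hδ, mul_div_assoc', div_le_div_iff₀ (by positivity) (by norm_num)]
    nlinarith [(measureReal_nonneg : 0 ≤ volume.real S)]
  rw [Real.dist_eq, sub_zero, abs_of_nonneg (integral_nonneg fun _ => abs_nonneg _)]
  linarith

structure LW (O : Set (EVec n)) (u : EVec n → ℝ) (F : EVec n → Fin n → ℝ) : Prop where
  mu : LocallyIntegrableOn u O
  mF : ∀ i, LocallyIntegrableOn (fun x => F x i) O
  eq : ∀ φ : EVec n → ℝ, ContDiff ℝ 1 φ → HasCompactSupport φ → tsupport φ ⊆ O → ∀ i,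
    ∫ x, u x * fderiv ℝ φ x (ev i) = - ∫ x, F x i * φ x

theorem LW.mol_fd {O : Set (EVec n)} {u : EVec n → ℝ} {F : EVec n → Fin n → ℝ} (h : LW O u F)
    (hu : LocallyIntegrable u) {k : ℕ} {x : EVec n}
    (hx : Metric.closedBall x (1 / ((k:ℝ) + 1)) ⊆ O) (i) :
    fderiv ℝ (mol k u) x (ev i) = mol k (fun y => F y i) x := by
  rw [_root_.mol_fd hu, h.eq _ (tf_cd k x) (tf_cs k x) ((tf_ts k x).trans hx) i, mol_eq, neg_neg]

theorem LocI.mul_cs {O : Set (EVec n)} {u ψ : EVec n → ℝ} (hO : IsOpen O) (hu : LocallyIntegrableOn u O) (hψ : Continuous ψ)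
    (hc : HasCompactSupport ψ) (hs : tsupport ψ ⊆ O) : Integrable (fun x => u x * ψ x) := by
  have h1 : IntegrableOn u (tsupport ψ) := hu.integrableOn_compact_subset hs hc
  have h2 : IntegrableOn (fun x => u x * ψ x) (tsupport ψ) := h1.mul_continuousOn hψ.continuousOn hc
  refine (integrableOn_iff_integrable_of_support_subset fun x hx => ?_).1 h2
  by_contra h
  exact hx (by simp [image_eq_zero_of_notMem_tsupport h])
end PH1
end MPH1

section MPH2
section PH2
variable {n : ℕ}

theorem curve_aux {w : EVec n → ℝ} {ω : EVec n → EVec n →L[ℝ] ℝ} (hω : Continuous ω) {γ : ℝ → EVec n} {K : NNReal}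
    (hγ : LipschitzWith K γ) {b : ℝ} (hb : 0 ≤ b) (hw : ∀ t ∈ Icc 0 b, HasFDerivAt w (ω (γ t)) (γ t)) :
    w (γ b) - w (γ 0) ≤ K * ∫ t in (0:ℝ)..b, ‖ω (γ t)‖ := by
  have hc : Continuous fun t => ‖ω (γ t)‖ := (hω.comp hγ.continuous).norm
  have hB : ∀ x, HasDerivAt (fun t => K * ∫ s in (0:ℝ)..t, ‖ω (γ s)‖) (K * ‖ω (γ x)‖) x := fun x =>
    (intervalIntegral.integral_hasDerivAt_right (hc.intervalIntegrable _ _) hc.stronglyMeasurable.stronglyMeasurableAtFilter hc.continuousAt).const_mul _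
  refine image_le_of_liminf_slope_right_le_deriv_boundary (f := fun t => w (γ t) - w (γ 0)) (a := 0) (b := b)
    ?_ (by simp) (fun x _ => (hB x).continuousAt.continuousWithinAt) (fun x _ => (hB x).hasDerivWithinAt) ?_ ⟨hb, le_rfl⟩
  · exact fun t ht => (((hw t ht).continuousAt.comp hγ.continuous.continuousAt).sub continuousAt_const).continuousWithinAt
  · intro x hx r hr
    apply Eventually.frequently
    obtain ⟨ε, hε, hε2⟩ : ∃ ε > 0, K * (‖ω (γ x)‖ + ε) < r := by
      refine ⟨(r - K * ‖ω (γ x)‖) / (2 * (K + 1)), div_pos (by linarith) (by positivity), ?_⟩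
      have : (K:ℝ) * ((r - K * ‖ω (γ x)‖) / (2 * (K + 1))) ≤ (r - K * ‖ω (γ x)‖) / 2 := by
        rw [mul_div_assoc', div_le_div_iff₀ (by positivity) (by norm_num)]
        nlinarith [K.2]
      linarith
    have h1 := (hw x ⟨hx.1, hx.2.le⟩).isLittleO.def hε
    have h2 := (hγ.continuous.tendsto x).eventually h1
    filter_upwards [h2.filter_mono nhdsWithin_le_nhds, self_mem_nhdsWithin] with z hz hzx
    have hzx : x < z := hzx
    rw [slope_def_field, div_lt_iff₀ (by linarith)]
    have h3 : ‖γ z - γ x‖ ≤ K * (z - x) := by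
      have := hγ.dist_le_mul z x
      rwa [dist_eq_norm, Real.dist_eq, abs_of_pos (by linarith : 0 < z - x)] at this
    have h4 := (ω (γ x)).le_opNorm (γ z - γ x)
    have h5 := (abs_le.1 hz).2
    have h6 := (abs_le.1 h4).2
    have h7 : (‖ω (γ x)‖ + ε) * ‖γ z - γ x‖ ≤ (‖ω (γ x)‖ + ε) * (K * (z - x)) :=
      mul_le_mul_of_nonneg_left h3 (by positivity)
    have h8 : K * (‖ω (γ x)‖ + ε) * (z - x) < r * (z - x) := mul_lt_mul_of_pos_right hε2 (by linarith)
    linarith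

theorem curve {w : EVec n → ℝ} {ω : EVec n → EVec n →L[ℝ] ℝ} (hω : Continuous ω) {γ : ℝ → EVec n} {K : NNReal}
    (hγ : LipschitzWith K γ) {b : ℝ} (hb : 0 ≤ b) (hw : ∀ t ∈ Icc 0 b, HasFDerivAt w (ω (γ t)) (γ t)) :
    ‖w (γ b) - w (γ 0)‖ₑ ≤ K * ∫⁻ t in Icc 0 b, ‖ω (γ t)‖ₑ := by
  have h1 := curve_aux hω hγ hb hw
  have h2 := curve_aux (w := fun x => - w x) (ω := fun x => - ω x) hω.neg hγ hb (fun t ht => (hw t ht).neg)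
  simp only [norm_neg] at h2
  have h3 : |w (γ b) - w (γ 0)| ≤ K * ∫ t in (0:ℝ)..b, ‖ω (γ t)‖ := abs_le.2 ⟨by linarith, h1⟩
  have hc : Continuous fun t => ‖ω (γ t)‖ := (hω.comp hγ.continuous).norm
  rw [← ofReal_norm_eq_enorm, Real.norm_eq_abs]
  refine (ENNReal.ofReal_le_ofReal h3).trans ?_
  rw [ENNReal.ofReal_mul K.coe_nonneg, ENNReal.ofReal_coe_nnreal, intervalIntegral.integral_of_le hb, ← integral_Icc_eq_integral_Ioc,
    ofReal_integral_eq_lintegral_ofReal (hc.continuousOn.integrableOn_compact isCompact_Icc) (ae_of_all _ fun _ => norm_nonneg _)]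
  simp only [ofReal_norm_eq_enorm]; rfl

theorem lint_affine (g : EVec n → ℝ≥0∞) (hg : Measurable g) {t : ℝ} (ht : 1 / 2 ≤ t) (c : EVec n) :
    ∫⁻ x, g (c + t • x) ≤ 2 ^ n * ∫⁻ x, g x := by
  have h1 : ∫⁻ x, g (c + t • x) = ∫⁻ x, g (c + x) ∂(Measure.map (t • ·) volume) := by
    rw [lintegral_map (by fun_prop) (by fun_prop)]
  rw [h1, Measure.map_addHaar_smul _ (by positivity), lintegral_smul_measure, lintegral_add_left_eq_self, smul_eq_mul]
  gcongr
  rw [finrank_euclideanSpace_fin, abs_of_pos (by positivity), ← inv_pow, ENNReal.ofReal_pow (by positivity)]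
  gcongr
  rw [show (2:ℝ≥0∞) = ENNReal.ofReal 2 by simp]
  apply ENNReal.ofReal_le_ofReal
  rw [inv_le_comm₀ (by positivity) (by norm_num)]; linarith

theorem poincare {w : EVec n → ℝ} {ω : EVec n → EVec n →L[ℝ] ℝ} (hω : Continuous ω) {x0 : EVec n} {r : ℝ} (hr : 0 < r)
    (hw : ∀ x ∈ Metric.ball x0 r, HasFDerivAt w (ω x) x) (hi : IntegrableOn w (Metric.ball x0 r))
    (hm : ∫ x in Metric.ball x0 r, w x = 0) :
    ∫⁻ x in Metric.ball x0 r, ‖w x‖ₑ ≤ ENNReal.ofReal (2 * r) * 2 ^ n * ∫⁻ x in Metric.ball x0 r, ‖ω x‖ₑ := by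
  set B := Metric.ball x0 r with hB
  have hBm : MeasurableSet B := measurableSet_ball
  have hv0 : volume B ≠ 0 := (Metric.measure_ball_pos volume x0 hr).ne'
  have hvt : volume B ≠ ∞ := measure_ball_lt_top.ne
  set g : EVec n → ℝ≥0∞ := B.indicator fun x => ‖ω x‖ₑ with hg
  have hgm : Measurable g := hω.enorm.measurable.indicator hBm
  have e1 : ∀ x, volume B * ‖w x‖ₑ ≤ ∫⁻ y in B, ‖w x - w y‖ₑ := by
    intro x
    have : (volume B).toReal * w x = ∫ y in B, (w x - w y) := by
      rw [integral_sub (f := fun _ => w x) (integrableOn_const hvt : IntegrableOn (fun _ => w x) B volume) hi, hm, setIntegral_const]; simp [Measure.real]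
    rw [← ENNReal.ofReal_toReal hvt, ← Real.enorm_of_nonneg ENNReal.toReal_nonneg, ← enorm_mul, this]
    exact enorm_integral_le_lintegral_enorm _
  have e2 : ∀ x ∈ B, ∀ y ∈ B, ‖w x - w y‖ₑ ≤ ENNReal.ofReal (2 * r) * ∫⁻ t in Icc (0:ℝ) 1, g (y + t • (x - y)) := by
    intro x hx y hy
    have hd : ‖x - y‖ ≤ 2 * r := by
      rw [← dist_eq_norm]; linarith [dist_triangle_right x y x0, Metric.mem_ball.1 hx, Metric.mem_ball.1 hy]
    have hin : ∀ t ∈ Icc (0:ℝ) 1, y + t • (x - y) ∈ B := fun t ht =>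
      (convex_ball x0 r).add_smul_sub_mem hy hx ht
    have hL : LipschitzWith (Real.toNNReal (2 * r)) fun t : ℝ => y + t • (x - y) := by
      refine LipschitzWith.of_dist_le_mul fun s t => ?_
      rw [dist_eq_norm, dist_eq_norm, Real.coe_toNNReal _ (by positivity),
        show y + s • (x - y) - (y + t • (x - y)) = (s - t) • (x - y) by module, norm_smul, mul_comm]
      exact mul_le_mul_of_nonneg_right hd (norm_nonneg _)
    have := curve hω hL zero_le_one fun t ht => hw _ (hin t ht)
    simp only [one_smul, zero_smul, add_zero, add_sub_cancel] at this
    refine this.trans (le_of_eq ?_)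
    congr 1
    exact setLIntegral_congr_fun measurableSet_Icc fun t ht => by simp only [hg, indicator_of_mem (hin t ht)]
  have e3 : ∀ t ∈ Icc (0:ℝ) 1, ∫⁻ x in B, ∫⁻ y in B, g (y + t • (x - y)) ≤ 2 ^ n * (∫⁻ x, g x) * volume B := by
    intro t ht
    by_cases h : 1 / 2 ≤ t
    · rw [lintegral_lintegral_swap (by fun_prop)]
      calc _ ≤ ∫⁻ y in B, 2 ^ n * ∫⁻ x, g x := by
            refine lintegral_mono fun y => (setLIntegral_le_lintegral _ _).trans ?_
            have := lint_affine g hgm h ((1 - t) • y)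
            refine le_trans (le_of_eq ?_) this
            congr 1; ext z; congr 1; module
        _ = _ := by simp
    · calc _ ≤ ∫⁻ x in B, 2 ^ n * ∫⁻ x, g x := by
            refine lintegral_mono fun x => (setLIntegral_le_lintegral _ _).trans ?_
            have := lint_affine g hgm (t := 1 - t) (by push Not at h; linarith) (t • x)
            refine le_trans (le_of_eq ?_) this
            congr 1; ext z; congr 1; module
        _ = _ := by simp
  have e4 : volume B * ∫⁻ x in B, ‖w x‖ₑ ≤ volume B * (ENNReal.ofReal (2 * r) * 2 ^ n * ∫⁻ x, g x) := by
    rw [← lintegral_const_mul' _ _ hvt]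
    calc _ ≤ ∫⁻ x in B, ∫⁻ y in B, ‖w x - w y‖ₑ := lintegral_mono fun x => e1 x
      _ ≤ ∫⁻ x in B, ∫⁻ y in B, ENNReal.ofReal (2 * r) * ∫⁻ t in Icc (0:ℝ) 1, g (y + t • (x - y)) :=
        setLIntegral_mono' hBm fun x hx => setLIntegral_mono' hBm fun y hy => e2 x hx y hy
      _ = ENNReal.ofReal (2 * r) * ∫⁻ x in B, ∫⁻ y in B, ∫⁻ t in Icc (0:ℝ) 1, g (y + t • (x - y)) := by
        simp_rw [lintegral_const_mul' _ _ ENNReal.ofReal_ne_top]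
      _ = ENNReal.ofReal (2 * r) * ∫⁻ t in Icc (0:ℝ) 1, ∫⁻ x in B, ∫⁻ y in B, g (y + t • (x - y)) := by
        congr 1
        rw [lintegral_lintegral_swap (μ := volume.restrict (Icc (0:ℝ) 1)) (ν := volume.restrict B)
          (f := fun t x => ∫⁻ y in B, g (y + t • (x - y)))]
        · refine lintegral_congr fun x => ?_
          rw [lintegral_lintegral_swap (by fun_prop)]
        · apply Measurable.aemeasurable
          exact Measurable.lintegral_prod_right' (f := fun p : (ℝ × EVec n) × EVec n => g (p.2 + p.1.1 • (p.1.2 - p.2))) (by fun_prop)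
      _ ≤ ENNReal.ofReal (2 * r) * ∫⁻ t in Icc (0:ℝ) 1, 2 ^ n * (∫⁻ x, g x) * volume B := by
        refine mul_le_mul_right ?_ _
        exact setLIntegral_mono' measurableSet_Icc e3
      _ = _ := by simp; ring
  rw [lintegral_indicator hBm] at e4
  exact (ENNReal.mul_le_mul_iff_right hv0 hvt).1 e4
end PH2
end MPH2

section MPH3
section PH3
variable {n : ℕ}

noncomputable def om (g : Fin n → ℝ) : EVec n →L[ℝ] ℝ := ∑ i, g i • (EuclideanSpace.proj i : EVec n →L[ℝ] ℝ)

theorem om_ev (g : Fin n → ℝ) (i) : om g (ev i) = g i := by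
  simp [om, ev, ContinuousLinearMap.sum_apply, EuclideanSpace.single_apply]

theorem om_apply (g : Fin n → ℝ) (x : EVec n) : om g x = ∑ i, g i * x i := by
  simp [om, ContinuousLinearMap.sum_apply]

theorem om_norm (g : Fin n → ℝ) : ‖om g‖ₑ ≤ ∑ i, ‖g i‖ₑ := by
  unfold om
  refine (enorm_sum_le (ε := EVec n →L[ℝ] ℝ) _ _).trans (Finset.sum_le_sum fun i _ => ?_)
  refine (enorm_smul (g i) (EuclideanSpace.proj i : EVec n →L[ℝ] ℝ)).le.trans ?_
  refine mul_le_of_le_one_right' ?_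
  rw [← ofReal_norm_eq_enorm]
  refine ENNReal.ofReal_le_one.2 (ContinuousLinearMap.opNorm_le_bound _ zero_le_one fun x => ?_)
  rw [one_mul]; exact PiLp.norm_apply_le x i

theorem om_sub (g h : Fin n → ℝ) : om (fun i => g i - h i) = om g - om h := by
  ext x; simp [om_apply, sub_mul]

theorem clm_om (l : EVec n →L[ℝ] ℝ) : l = om fun i => l (ev i) := by
  ext x
  rw [om_apply]
  conv_lhs => rw [← (EuclideanSpace.basisFun (Fin n) ℝ).sum_repr x]
  rw [map_sum]; refine Finset.sum_congr rfl fun i _ => ?_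
  simp [ev, mul_comm]

theorem om_cont {F : EVec n → Fin n → ℝ} (h : ∀ i, Continuous fun x => F x i) : Continuous fun x => om (F x) := by
  unfold om
  exact continuous_finsetSum _ fun i _ => (h i).smul continuous_const

def Crl (O : Set (EVec n)) (F : EVec n → Fin n → ℝ) : Prop :=
  ∀ φ : EVec n → ℝ, ContDiff ℝ 1 φ → HasCompactSupport φ → tsupport φ ⊆ O → ∀ i j,
    ∫ x, F x i * fderiv ℝ φ x (ev j) = ∫ x, F x j * fderiv ℝ φ x (ev i)

theorem lint_mol {f : EVec n → ℝ} (hf : Integrable f) :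
    Tendsto (fun k => ∫⁻ x, ‖mol k f x - f x‖ₑ) atTop (𝓝 0) := by
  have := ENNReal.tendsto_ofReal (mol_tendsto hf)
  rw [ENNReal.ofReal_zero] at this
  refine this.congr fun k => ?_
  rw [ofReal_integral_eq_lintegral_ofReal (isub (mol_int hf k) hf).abs (ae_of_all _ fun _ => abs_nonneg _)]
  congr 1; ext x; rw [← Real.norm_eq_abs, ofReal_norm_eq_enorm]

theorem local_pot {O : Set (EVec n)} {F : EVec n → Fin n → ℝ} (hF : ∀ i, Integrable fun x => F x i) (hC : Crl O F)
    {x0 : EVec n} {r : ℝ} (hr : 0 < r) (hB : Metric.closedBall x0 (2 * r) ⊆ O) :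
    ∃ v, Integrable v ∧ LW (Metric.ball x0 r) v F := by
  classical
  obtain ⟨k0, hk0⟩ : ∃ k0 : ℕ, ∀ k ≥ k0, 1 / ((k:ℝ) + 1) ≤ r := by
    have := (tendsto_one_div_add_atTop_nhds_zero_nat (𝕜 := ℝ)).eventually_le_const hr
    exact eventually_atTop.1 this
  set B := Metric.ball x0 r with hBd
  have hBm : MeasurableSet B := measurableSet_ball
  have hvt : volume B ≠ ∞ := measure_ball_lt_top.ne
  have hv0 : volume B ≠ 0 := (Metric.measure_ball_pos volume x0 hr).ne'
  set W : ℕ → EVec n → EVec n →L[ℝ] ℝ := fun k x => om fun i => mol (k0 + k) (fun y => F y i) x with hW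
  have hmc : ∀ k i, ContDiff ℝ 2 (mol k fun y => F y i) := fun k i => mol_cd (hF i).locallyIntegrable k
  have hWc : ∀ k, Continuous (W k) := fun k => om_cont fun i => (hmc _ i).continuous
  have hex : ∀ k, ∃ w : EVec n → ℝ, (∀ x ∈ B, HasFDerivAt w (W k x) x) ∧ IntegrableOn w B ∧ ∫ x in B, w x = 0 := by
    intro k
    have hd : ∀ i x, DifferentiableAt ℝ (mol (k0 + k) fun y => F y i) x := fun i x => (hmc _ i).differentiable (by norm_num) x
    have hfd : ∀ a, HasFDerivAt (W k) (∑ i, (fderiv ℝ (mol (k0 + k) fun y => F y i) a).smulRight (EuclideanSpace.proj i : EVec n →L[ℝ] ℝ)) a := by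
      intro a
      simp only [hW, om]
      exact HasFDerivAt.fun_sum fun i _ => (hd i a).hasFDerivAt.smul_const (EuclideanSpace.proj i : EVec n →L[ℝ] ℝ)
    have hsym : ∀ a ∈ B, ∀ i j, fderiv ℝ (mol (k0 + k) fun y => F y i) a (ev j) = fderiv ℝ (mol (k0 + k) fun y => F y j) a (ev i) := by
      intro a ha i j
      rw [mol_fd (hF i).locallyIntegrable, mol_fd (hF j).locallyIntegrable, hC _ (tf_cd _ _) (tf_cs _ _) ((tf_ts _ _).trans (subset_trans ?_ hB))]
      intro y hy
      have := hk0 (k0 + k) (by omega)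
      rw [Metric.mem_closedBall] at hy ⊢
      linarith [dist_triangle y a x0, Metric.mem_ball.1 ha]
    obtain ⟨w, hw⟩ := (convex_ball x0 r).exists_forall_hasFDerivAt_of_fderiv_symmetric (ω := W k) Metric.isOpen_ball
      (fun a _ => (hfd a).differentiableAt.differentiableWithinAt) (fun a ha x y => by
        rw [(hfd a).fderiv]
        simp only [ContinuousLinearMap.sum_apply, ContinuousLinearMap.smulRight_apply, ContinuousLinearMap.smul_apply,
          (fun _ _ => rfl : ∀ (i : Fin n) (y : EVec n), (EuclideanSpace.proj i : EVec n →L[ℝ] ℝ) y = y i), smul_eq_mul]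
        have e : ∀ i (x : EVec n), fderiv ℝ (mol (k0 + k) fun y => F y i) a x = ∑ j, fderiv ℝ (mol (k0 + k) fun y => F y i) a (ev j) * x j := by
          intro i x
          conv_lhs => rw [clm_om (fderiv ℝ (mol (k0 + k) fun y => F y i) a), om_apply]
        simp_rw [e _ x, e _ y, Finset.sum_mul]
        rw [Finset.sum_comm]
        refine Finset.sum_congr rfl fun j _ => Finset.sum_congr rfl fun i _ => ?_
        rw [hsym a ha i j]; change _ * _ * y i = _ * _ * x j; ring)
    obtain ⟨C, hCb⟩ := (isCompact_closedBall x0 r).exists_bound_of_continuousOn (hWc k).continuousOn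
    have hbd : ∀ x ∈ B, ‖w x‖ ≤ ‖w x0‖ + C * r := by
      intro x hx
      have h1 := (convex_ball x0 r).norm_image_sub_le_of_norm_hasFDerivWithin_le
        (fun y hy => (hw y hy).hasFDerivWithinAt) (fun y hy => hCb y (Metric.ball_subset_closedBall hy)) (Metric.mem_ball_self hr) hx
      have hC0 : 0 ≤ C := (norm_nonneg _).trans (hCb x0 (Metric.mem_closedBall_self hr.le))
      have h2 : C * ‖x - x0‖ ≤ C * r := mul_le_mul_of_nonneg_left (mem_ball_iff_norm.1 hx).le hC0
      have h3 : ‖w x‖ ≤ ‖w x - w x0‖ + ‖w x0‖ := by simpa using norm_add_le (w x - w x0) (w x0)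
      linarith
    have hwi : IntegrableOn w B := by
      refine IntegrableOn.of_bound hvt.lt_top ?_ _ ((ae_restrict_iff' hBm).2 (ae_of_all _ hbd))
      exact ContinuousOn.aestronglyMeasurable (fun x hx => (hw x hx).continuousAt.continuousWithinAt) hBm
    refine ⟨fun x => w x - ⨍ y in B, w y, fun x hx => (hw x hx).sub_const _, ?_, ?_⟩
    · exact hwi.sub (integrableOn_const hvt)
    · rw [integral_sub hwi (integrableOn_const hvt : IntegrableOn (fun _ => ⨍ y in B, w y) B volume), setIntegral_const,
        setAverage_eq, smul_eq_mul, smul_eq_mul, mul_inv_cancel_left₀, sub_self]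
      exact (ENNReal.toReal_pos hv0 hvt).ne'
  choose w hw hwi hwm using hex
  set c := ENNReal.ofReal (2 * r) * 2 ^ n
  have hct : c ≠ ∞ := ENNReal.mul_ne_top ENNReal.ofReal_ne_top (by simp)
  set b : ℕ → ℝ≥0∞ := fun k => c * ∑ i, ∫⁻ x, ‖mol (k0 + k) (fun y => F y i) x - F x i‖ₑ with hb
  have hb0 : Tendsto b atTop (𝓝 0) := by
    have h1 : Tendsto (fun k => ∑ i, ∫⁻ x, ‖mol (k0 + k) (fun y => F y i) x - F x i‖ₑ) atTop (𝓝 0) := by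
      rw [← Finset.sum_const_zero (s := Finset.univ (α := Fin n))]
      exact tendsto_finsetSum _ fun i _ => (lint_mol (hF i)).comp (tendsto_add_atTop_nat k0 |>.congr fun k => by omega)
    simpa using ENNReal.Tendsto.const_mul h1 (Or.inr hct)
  have hdist : ∀ k l, ∫⁻ x in B, ‖w k x - w l x‖ₑ ≤ b k + b l := by
    intro k l
    have h1 := poincare (w := fun x => w k x - w l x) (ω := fun x => W k x - W l x) ((hWc k).sub (hWc l)) hr
      (fun x hx => (hw k x hx).sub (hw l x hx)) ((hwi k).sub (hwi l))
      (by rw [integral_sub (hwi k) (hwi l), hwm, hwm, sub_zero])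
    refine h1.trans ?_
    rw [hb]; dsimp only; rw [← mul_add, ← Finset.sum_add_distrib]
    refine mul_le_mul_right ?_ _
    calc _ ≤ ∫⁻ x in B, ∑ i, (‖mol (k0 + k) (fun y => F y i) x - F x i‖ₑ + ‖mol (k0 + l) (fun y => F y i) x - F x i‖ₑ) := by
          refine lintegral_mono fun x => ?_
          simp only [hW]
          rw [← om_sub]
          refine (om_norm _).trans (Finset.sum_le_sum fun i _ => ?_)
          rw [← edist_eq_enorm_sub, ← edist_eq_enorm_sub, ← edist_eq_enorm_sub]
          exact edist_triangle_right _ _ _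
      _ ≤ ∫⁻ x, ∑ i, (‖mol (k0 + k) (fun y => F y i) x - F x i‖ₑ + ‖mol (k0 + l) (fun y => F y i) x - F x i‖ₑ) := setLIntegral_le_lintegral _ _
      _ = _ := by
        have hm : ∀ i k, AEMeasurable fun x => ‖mol k (fun y => F y i) x - F x i‖ₑ := fun i k =>
          (isub (mol_int (hF i) k) (hF i)).1.enorm
        have hm2 : ∀ i, AEMeasurable fun x => ‖mol (k0 + k) (fun y => F y i) x - F x i‖ₑ + ‖mol (k0 + l) (fun y => F y i) x - F x i‖ₑ := fun i => (hm i _).add (hm i _)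
        rw [lintegral_finsetSum' _ fun i _ => hm2 i]
        refine Finset.sum_congr rfl fun i _ => lintegral_add_left' (hm i _) _
  have hwI : ∀ k, Integrable (w k) (volume.restrict B) := hwi
  have hcau : CauchySeq fun k => (hwI k).toL1 (w k) := by
    rw [EMetric.cauchySeq_iff]
    intro ε hε
    have h2 : (0:ℝ≥0∞) < ε / 2 := ENNReal.half_pos hε.ne'
    obtain ⟨K, hK⟩ := eventually_atTop.1 (hb0.eventually_lt_const h2)
    refine ⟨K, fun k hk l hl => ?_⟩
    rw [Integrable.edist_toL1_toL1]
    simp only [edist_eq_enorm_sub]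
    refine (hdist k l).trans_lt ?_
    rw [← ENNReal.add_halves ε]
    exact ENNReal.add_lt_add (hK k hk) (hK l hl)
  obtain ⟨V, hV⟩ := cauchySeq_tendsto_of_complete hcau
  have hVI : Integrable V (volume.restrict B) := L1.integrable_coeFn V
  have hVi : IntegrableOn V B := hVI
  have habs : ∀ k, IntegrableOn (fun x => |w k x - V x|) B := fun k => ((hwI k).sub hVI).abs
  have hlim : Tendsto (fun k => ∫ x in B, |w k x - V x|) atTop (𝓝 0) := by
    have h1 := ((ENNReal.tendsto_toReal ENNReal.zero_ne_top).comp (tendsto_iff_edist_tendsto_0.1 hV))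
    refine h1.congr fun k => ?_
    have : (V : Lp ℝ 1 (volume.restrict B)) = hVI.toL1 V := (Integrable.toL1_coeFn V hVI).symm
    rw [Function.comp_apply]
    conv_lhs => rw [this]
    rw [Integrable.edist_toL1_toL1, integral_eq_lintegral_of_nonneg_ae (ae_of_all _ fun _ => abs_nonneg _)
      (habs k).1]
    congr 1; refine lintegral_congr fun x => ?_
    rw [edist_eq_enorm_sub, ← Real.norm_eq_abs, ofReal_norm_eq_enorm]
  refine ⟨B.indicator V, hVi.integrable_indicator hBm, ⟨(hVi.integrable_indicator hBm).locallyIntegrable.locallyIntegrableOn _,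
    fun i => (hF i).locallyIntegrable.locallyIntegrableOn _, fun φ hφ hφc hφs i => ?_⟩⟩
  have hφi := cont_fd hφ (ev i)
  have hdc : HasCompactSupport fun x => fderiv ℝ φ x (ev i) := (hφc.fderiv_apply ℝ (ev i))
  have hds : tsupport (fun x => fderiv ℝ φ x (ev i)) ⊆ B := (tsupport_fderiv_apply_subset ℝ _).trans hφs
  obtain ⟨C1, hC1⟩ := hφi.bounded_above_of_compact_support hdc
  obtain ⟨C2, hC2⟩ := hφ.continuous.bounded_above_of_compact_support hφc
  have hib : ∀ {u : EVec n → ℝ}, IntegrableOn u B → Integrable fun x => u x * fderiv ℝ φ x (ev i) := fun hu =>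
    LocI.mul_cs Metric.isOpen_ball hu.locallyIntegrableOn hφi hdc hds
  have hib2 : ∀ {u : EVec n → ℝ}, IntegrableOn u B → Integrable fun x => u x * φ x := fun hu =>
    LocI.mul_cs Metric.isOpen_ball hu.locallyIntegrableOn hφ.continuous hφc hφs
  have hibp : ∀ k, ∫ x, w k x * fderiv ℝ φ x (ev i) = - ∫ x, mol (k0 + k) (fun y => F y i) x * φ x := by
    intro k
    have e : ∀ x, fderiv ℝ (w k) x (ev i) * φ x = mol (k0 + k) (fun y => F y i) x * φ x := by
      intro x
      by_cases hx : x ∈ B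
      · rw [(hw k x hx).fderiv, om_ev]
      · rw [image_eq_zero_of_notMem_tsupport fun h => hx (hφs h)]; simp
    rw [integral_mul_fderiv_eq_neg_fderiv_mul_of_integrable ?_ (hib (hwi k)) (hib2 (hwi k))
      (fun x hx => (hw k x (hφs hx)).differentiableAt) (fun x _ => hφ.differentiable (by norm_num) x)]
    · simp_rw [e]
    · simp_rw [e]; exact hib2 (mol_int (hF i) _).integrableOn
  have t1 : Tendsto (fun k => ∫ x, w k x * fderiv ℝ φ x (ev i)) atTop (𝓝 (∫ x, B.indicator V x * fderiv ℝ φ x (ev i))) := by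
    rw [tendsto_iff_dist_tendsto_zero]
    refine squeeze_zero (fun _ => dist_nonneg) (fun k => ?_) (by simpa using hlim.mul_const C1)
    rw [Real.dist_eq, ← integral_sub (hib (hwi k)) (hib (hVi.integrable_indicator hBm).integrableOn), ← integral_mul_const,
      ← integral_indicator hBm, ← Real.norm_eq_abs]
    have hq : IntegrableOn (fun x => |w k x - V x| * C1) B := Integrable.mul_const (habs k) C1
    refine norm_integral_le_of_norm_le (hq.integrable_indicator hBm) (ae_of_all _ fun x => ?_)
    by_cases hx : x ∈ B
    · rw [indicator_of_mem hx, indicator_of_mem hx, ← sub_mul, norm_mul]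
      exact mul_le_mul_of_nonneg_left (hC1 x) (norm_nonneg _)
    · rw [image_eq_zero_of_notMem_tsupport fun h => hx (hds h), indicator_of_notMem hx, indicator_of_notMem hx]; simp
  have t2 : Tendsto (fun k => - ∫ x, mol (k0 + k) (fun y => F y i) x * φ x) atTop (𝓝 (- ∫ x, F x i * φ x)) := by
    refine Tendsto.neg ?_
    rw [tendsto_iff_dist_tendsto_zero]
    refine squeeze_zero (fun _ => dist_nonneg) (fun k => ?_)
      (by simpa using ((mol_tendsto (hF i)).comp (tendsto_add_atTop_nat k0 |>.congr fun k => by omega : Tendsto (fun k => k0 + k) atTop atTop)).mul_const C2)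
    rw [Real.dist_eq, ← integral_sub (hib2 (mol_int (hF i) _).integrableOn) (hib2 (hF i).integrableOn), ← integral_mul_const,
      ← Real.norm_eq_abs]
    refine norm_integral_le_of_norm_le ((isub (mol_int (hF i) _) (hF i)).abs.mul_const C2) (ae_of_all _ fun x => ?_)
    rw [← sub_mul, norm_mul]
    exact mul_le_mul_of_nonneg_left (hC2 x) (norm_nonneg _)
  exact tendsto_nhds_unique t1 (t2.congr fun k => (hibp k).symm)
end PH3
end MPH3

section MPH4
section PH4
variable {n : ℕ}

theorem LW.mono {O O' : Set (EVec n)} {u : EVec n → ℝ} {F : EVec n → Fin n → ℝ} (h : LW O u F) (hs : O' ⊆ O) : LW O' u F :=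
  ⟨h.mu.mono_set hs, fun i => (h.mF i).mono_set hs, fun φ a b c => h.eq φ a b (c.trans hs)⟩

theorem fd_cs {φ : EVec n → ℝ} (hc : HasCompactSupport φ) (i) : HasCompactSupport fun x => fderiv ℝ φ x (ev i) := hc.fderiv_apply ℝ (ev i)

theorem fd_ts {φ : EVec n → ℝ} {O : Set (EVec n)} (hs : tsupport φ ⊆ O) (i) : tsupport (fun x => fderiv ℝ φ x (ev i)) ⊆ O :=
  (tsupport_fderiv_apply_subset ℝ _).trans hs

theorem LW.sub {O : Set (EVec n)} (hO : IsOpen O) {u v : EVec n → ℝ} {F : EVec n → Fin n → ℝ} (h : LW O u F) (h' : LW O v F) :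
    LW O (fun x => v x - u x) fun _ _ => 0 := by
  refine ⟨h'.mu.sub h.mu, fun i => (locallyIntegrable_const 0).locallyIntegrableOn _, fun φ a b c i => ?_⟩
  simp_rw [sub_mul]
  rw [integral_sub (LocI.mul_cs hO h'.mu (cont_fd a _) (fd_cs b i) (fd_ts c i)) (LocI.mul_cs hO h.mu (cont_fd a _) (fd_cs b i) (fd_ts c i)),
    h.eq φ a b c i, h'.eq φ a b c i]
  simp

theorem LW.const {W : Set (EVec n)} (hW : IsOpen W) (hWc : Convex ℝ W) {w : EVec n → ℝ} (hw : Integrable w)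
    (h : LW W w fun _ _ => 0) : ∃ c, ∀ᵐ x, x ∈ W → w x = c := by
  have hcx : ∀ ε : ℝ, Convex ℝ {x | Metric.closedBall x ε ⊆ W} := by
    intro ε x hx y hy a b ha hb hab z hz
    have e : z = a • (x + (z - (a • x + b • y))) + b • (y + (z - (a • x + b • y))) := by
      rw [smul_add, smul_add, add_add_add_comm, ← add_smul, hab, one_smul]; abel
    have hn : ‖z - (a • x + b • y)‖ ≤ ε := mem_closedBall_iff_norm.1 hz
    rw [e]
    exact hWc (hx (by simpa using hn)) (hy (by simpa using hn)) ha hb hab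
  have key : ∀ (k : ℕ) x y, Metric.closedBall x (1 / ((k:ℝ) + 1)) ⊆ W → Metric.closedBall y (1 / ((k:ℝ) + 1)) ⊆ W → mol k w x = mol k w y := by
    intro k x y hx hy
    have := (hcx (1 / ((k:ℝ) + 1))).norm_image_sub_le_of_norm_fderiv_le (f := mol k w) (C := 0)
      (fun z _ => (mol_cd hw.locallyIntegrable k).differentiable (by norm_num) z) (fun z hz => by
        have e : (fun i => fderiv ℝ (mol k w) z (ev i)) = fun _ => 0 := by
          ext i; rw [h.mol_fd hw.locallyIntegrable hz i, mol_eq]; simp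
        rw [clm_om (fderiv ℝ (mol k w) z), e]; simp [om]) hy hx
    rw [zero_mul] at this
    exact sub_eq_zero.1 (norm_le_zero_iff.1 this)
  have hev : ∀ x ∈ W, ∀ᶠ k : ℕ in atTop, Metric.closedBall x (1 / ((k:ℝ) + 1)) ⊆ W := by
    intro x hx
    obtain ⟨ε, h0, hε⟩ := Metric.isOpen_iff.1 hW x hx
    filter_upwards [(tendsto_one_div_add_atTop_nhds_zero_nat (𝕜 := ℝ)).eventually_lt_const h0] with k hk
    exact (Metric.closedBall_subset_ball hk).trans hε
  have hae := mol_ae hw.locallyIntegrable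
  by_cases hex : ∃ x0 ∈ W, Tendsto (fun k => mol k w x0) atTop (𝓝 (w x0))
  · obtain ⟨x0, h0, h1⟩ := hex
    refine ⟨w x0, ?_⟩
    filter_upwards [hae] with x hx hxW
    refine tendsto_nhds_unique hx (h1.congr' ?_)
    filter_upwards [hev x hxW, hev x0 h0] with k a b using key k _ _ b a
  · refine ⟨0, ?_⟩
    filter_upwards [hae] with x hx hxW using (hex ⟨x, hxW, hx⟩).elim

theorem LocI.union {O1 O2 : Set (EVec n)} (h1o : IsOpen O1) (h2o : IsOpen O2) {u : EVec n → ℝ} (h1 : LocallyIntegrableOn u O1)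
    (h2 : LocallyIntegrableOn u O2) : LocallyIntegrableOn u (O1 ∪ O2) := by
  rintro x (hx | hx)
  · have := h1 x hx; rw [h1o.nhdsWithin_eq hx] at this; exact this.filter_mono nhdsWithin_le_nhds
  · have := h2 x hx; rw [h2o.nhdsWithin_eq hx] at this; exact this.filter_mono nhdsWithin_le_nhds

theorem LW.union {O1 O2 : Set (EVec n)} (h1o : IsOpen O1) (h2o : IsOpen O2) {u : EVec n → ℝ} {F : EVec n → Fin n → ℝ}
    (h1 : LW O1 u F) (h2 : LW O2 u F) : LW (O1 ∪ O2) u F := by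
  refine ⟨LocI.union h1o h2o h1.mu h2.mu, fun i => LocI.union h1o h2o (h1.mF i) (h2.mF i), fun φ a b c i => ?_⟩
  obtain ⟨η, ηc, ηs, ηt, -, O, hO, hKO, hη⟩ := cutoff (K := tsupport φ \ O2) (b.isCompact.diff h2o) h1o (fun x hx => (c hx.1).resolve_right hx.2)
  have ηc1 : ContDiff ℝ 1 η := ηc.of_le (by norm_num)
  have c1 : ContDiff ℝ 1 fun x => η x * φ x := ηc1.mul a
  have c2 : ContDiff ℝ 1 fun x => (1 - η x) * φ x := (contDiff_const.sub ηc1).mul a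
  have b1 : HasCompactSupport fun x => η x * φ x := b.mul_left
  have b2 : HasCompactSupport fun x => (1 - η x) * φ x := b.mul_left
  have t1 : tsupport (fun x => η x * φ x) ⊆ O1 := (closure_mono (Function.support_mul_subset_left _ _)).trans ηt
  have t2 : tsupport (fun x => (1 - η x) * φ x) ⊆ O2 := by
    have : tsupport (fun x => (1 - η x) * φ x) ⊆ tsupport φ \ O := by
      refine closure_minimal (fun x hx => ⟨subset_closure (Function.support_mul_subset_right _ _ hx), fun hxO => hx ?_⟩)
        ((isClosed_tsupport φ).sdiff hO)
      simp [hη x hxO]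
    intro x hx
    by_contra h
    exact (this hx).2 (hKO ⟨(this hx).1, h⟩)
  have e : ∀ x, fderiv ℝ φ x (ev i) = fderiv ℝ (fun x => η x * φ x) x (ev i) + fderiv ℝ (fun x => (1 - η x) * φ x) x (ev i) := by
    intro x
    rw [← ContinuousLinearMap.add_apply, ← fderiv_fun_add (c1.differentiable (by norm_num) x) (c2.differentiable (by norm_num) x)]
    congr 2; ext y; ring
  have e2 : ∀ x, F x i * φ x = F x i * (η x * φ x) + F x i * ((1 - η x) * φ x) := fun x => by ring
  simp_rw [e, mul_add, e2]
  rw [integral_add (LocI.mul_cs h1o h1.mu (cont_fd c1 _) (fd_cs b1 i) (fd_ts t1 i)) (LocI.mul_cs h2o h2.mu (cont_fd c2 _) (fd_cs b2 i) (fd_ts t2 i)),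
    integral_add (LocI.mul_cs h1o (h1.mF i) c1.continuous b1 t1) (LocI.mul_cs h2o (h2.mF i) c2.continuous b2 t2),
    h1.eq _ c1 b1 t1 i, h2.eq _ c2 b2 t2 i, neg_add]

theorem LW.of_local {O : Set (EVec n)} {u : EVec n → ℝ} {F : EVec n → Fin n → ℝ}
    (h : ∀ x ∈ O, ∃ U, IsOpen U ∧ x ∈ U ∧ LW U u F) : LW O u F := by
  have hl : ∀ {g : EVec n → ℝ}, (∀ x ∈ O, ∃ U, IsOpen U ∧ x ∈ U ∧ LocallyIntegrableOn g U) → LocallyIntegrableOn g O := by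
    intro g hg x hx
    obtain ⟨U, hU, hxU, h1⟩ := hg x hx
    have := h1 x hxU; rw [hU.nhdsWithin_eq hxU] at this; exact this.filter_mono nhdsWithin_le_nhds
  refine ⟨hl fun x hx => (h x hx).imp fun U h => ⟨h.1, h.2.1, h.2.2.mu⟩, fun i => hl fun x hx => (h x hx).imp fun U h => ⟨h.1, h.2.1, h.2.2.mF i⟩,
    fun φ a b c i => ?_⟩
  have key : ∃ V, IsOpen V ∧ tsupport φ ⊆ V ∧ LW V u F := by
    refine b.isCompact.induction_on (p := fun K => ∃ V, IsOpen V ∧ K ⊆ V ∧ LW V u F)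
      ⟨∅, isOpen_empty, le_rfl, ?_⟩ (fun s t hst ⟨V, h1, h2, h3⟩ => ⟨V, h1, hst.trans h2, h3⟩)
      (fun s t ⟨V, h1, h2, h3⟩ ⟨V', h1', h2', h3'⟩ => ⟨V ∪ V', h1.union h1', union_subset_union h2 h2', h3.union h1 h1' h3'⟩) fun x hx => ?_
    · refine ⟨fun x hx => hx.elim, fun i x hx => hx.elim, fun φ a b c i => ?_⟩
      have : φ = 0 := tsupport_eq_empty_iff.1 (subset_empty_iff.1 c)
      subst this; simp
    · obtain ⟨U, h1, h2, h3⟩ := h x (c hx)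
      exact ⟨U, mem_nhdsWithin_of_mem_nhds (h1.mem_nhds h2), U, h1, le_rfl, h3⟩
  obtain ⟨V, -, h2, h3⟩ := key
  exact h3.eq φ a b h2 i

theorem LW.congr {O : Set (EVec n)} (hO : IsOpen O) {u v : EVec n → ℝ} {F : EVec n → Fin n → ℝ} (h : LW O u F) (c : ℝ)
    (hv : ∀ᵐ x, x ∈ O → v x = u x + c) : LW O v F := by
  have hvm : LocallyIntegrableOn (fun x => u x + c) O := h.mu.add ((locallyIntegrable_const c).locallyIntegrableOn _)
  refine ⟨?_, h.mF, fun φ a b d i => ?_⟩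
  · intro x hx
    obtain ⟨s, hs, hi⟩ := hvm x hx
    rw [hO.nhdsWithin_eq hx] at hs
    refine ⟨s ∩ O, inter_mem (mem_nhdsWithin_of_mem_nhds hs) self_mem_nhdsWithin, (hi.mono_set inter_subset_left).congr ?_⟩
    obtain ⟨t, ht, hto, hxt⟩ := mem_nhds_iff.1 hs
    have := hv
    refine (ae_restrict_of_ae_restrict_of_subset inter_subset_right ((ae_restrict_iff' hO.measurableSet).2 ?_))
    filter_upwards [hv] with y hy hyO using (hy hyO).symm
  · have e : ∫ x, v x * fderiv ℝ φ x (ev i) = ∫ x, (u x * fderiv ℝ φ x (ev i) + c * fderiv ℝ φ x (ev i)) := by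
      refine integral_congr_ae ?_
      filter_upwards [hv] with x hx
      by_cases hxO : x ∈ O
      · simp only [hx hxO, add_mul]
      · have := image_eq_zero_of_notMem_tsupport fun h => hxO (fd_ts d i h)
        rw [this]; simp
    have z : ∫ x, fderiv ℝ φ x (ev i) = 0 := by
      have := integral_mul_fderiv_eq_neg_fderiv_mul_of_integrable (μ := volume) (f := fun _ : EVec n => (1:ℝ)) (g := φ) (v := ev i)
        (by simp) (by simpa using (cont_fd a (ev i)).integrable_of_hasCompactSupport (fd_cs b i))
        (by simpa using a.continuous.integrable_of_hasCompactSupport b) (fun x _ => differentiableAt_const _) (fun x _ => a.differentiable (by norm_num) x)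
      simpa using this
    rw [e, integral_add (LocI.mul_cs hO h.mu (cont_fd a _) (fd_cs b i) (fd_ts d i))
      (((cont_fd a (ev i)).integrable_of_hasCompactSupport (fd_cs b i)).const_mul c), integral_const_mul, z, h.eq φ a b d i]
    simp
end PH4
end MPH4

section MPH5
section PH5
structure DR where
  val : ℝ
instance : TopologicalSpace DR := ⊥
instance : DiscreteTopology DR := ⟨rfl⟩

theorem cocycle {X : Type*} [TopologicalSpace X] [SimplyConnectedSpace X] [LocallyPathConnectedSpace X] {ι : Type*}
    (B : ι → Set X) (ho : ∀ i, IsOpen (B i)) (hc : ∀ i, IsPreconnected (B i)) (hcov : ∀ x, ∃ i, x ∈ B i) (c : ι → ι → ℝ)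
    (h0 : ∀ i, ∀ x ∈ B i, c i i = 0) (h1 : ∀ i j k, ∀ x ∈ B i ∩ B j ∩ B k, c i j + c j k = c i k) :
    ∃ t : ι → ℝ, ∀ i j, ∀ x ∈ B i ∩ B j, t i - t j = c i j := by
  choose ix hix using hcov
  let Z : FiberBundleCore ι X DR :=
    { baseSet := B
      isOpen_baseSet := ho
      indexAt := ix
      mem_baseSet_at := hix
      coordChange := fun i j _ v => ⟨v.val - c i j⟩
      coordChange_self := fun i x hx v => by
        rw [h0 i x hx, sub_zero]
      continuousOn_coordChange := fun i j =>
        ((continuous_of_discreteTopology (f := fun v : DR => (⟨v.val - c i j⟩ : DR))).comp continuous_snd).continuousOn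
      coordChange_comp := fun i j k x hx v => by
        rw [← h1 i j k x hx]; congr 1; ring }
  have hcm : IsCoveringMap (Bundle.TotalSpace.proj : Bundle.TotalSpace DR Z.Fiber → X) := FiberBundle.isCoveringMap (F := DR) (E := Z.Fiber)
  obtain ⟨a0⟩ : Nonempty X := inferInstance
  obtain ⟨s, ⟨-, hs⟩, -⟩ := hcm.existsUnique_continuousMap_lifts (ContinuousMap.id X) a0 ⟨a0, (⟨0⟩ : DR)⟩ rfl
  have hs' : ∀ x, (s x).proj = x := fun x => congrFun hs x
  have hco : ∀ i, ContinuousOn (fun x => (Z.localTriv i (s x)).2) (B i) := by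
    intro i
    refine continuous_snd.comp_continuousOn ((Z.localTriv i).continuousOn.comp s.continuous.continuousOn fun x hx => ?_)
    rw [Z.mem_localTriv_source, hs']; exact hx
  have hconst : ∀ i, ∃ t : DR, ∀ x ∈ B i, (Z.localTriv i (s x)).2 = t := by
    intro i
    by_cases hne : (B i).Nonempty
    · obtain ⟨y, hy⟩ := hne
      exact ⟨(Z.localTriv i (s y)).2, fun x hx => (hc i).constant_of_mapsTo (T := univ) (IsDiscrete.univ) (hco i) (mapsTo_univ _ _) hx hy⟩
    · exact ⟨⟨0⟩, fun x hx => (hne ⟨x, hx⟩).elim⟩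
  choose t ht using hconst
  refine ⟨fun i => (t i).val, fun i j x hx => ?_⟩
  have e : ∀ l, x ∈ B l → (t l).val = (show DR from (s x).2).val - c (ix x) l := by
    intro l hl
    rw [← ht l x hl, Z.localTriv_apply]
    have : Z.indexAt (s x).1 = ix x := by rw [hs']
    rw [this]
  have hk := hix x
  have := h1 (ix x) i j x ⟨⟨hk, hx.1⟩, hx.2⟩
  linarith [e i hx.1, e j hx.2]

variable {n : ℕ}
theorem glob_pot {O : Set (EVec n)} (hO : IsOpen O) [SimplyConnectedSpace O] {F : EVec n → Fin n → ℝ}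
    (hF : ∀ i, Integrable fun x => F x i) (hC : Crl O F) : ∃ v, LW O v F := by
  classical
  have hr : ∀ x : O, ∃ r > 0, Metric.closedBall (x : EVec n) (2 * r) ⊆ O := by
    intro x
    obtain ⟨ε, h0, hε⟩ := Metric.isOpen_iff.1 hO x x.2
    exact ⟨ε / 4, by positivity, (Metric.closedBall_subset_ball (by linarith)).trans hε⟩
  choose r hr0 hrO using hr
  choose v hvi hv using fun x : O => local_pot hF hC (hr0 x) (hrO x)
  let B : O → Set (EVec n) := fun x => Metric.ball (x : EVec n) (r x)
  have hBo : ∀ x, IsOpen (B x) := fun x => Metric.isOpen_ball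
  have hc : ∀ i j : O, ∃ c, ∀ᵐ x, x ∈ B i ∩ B j → v j x - v i x = c := fun i j =>
    LW.const ((hBo i).inter (hBo j)) ((convex_ball _ _).inter (convex_ball _ _)) (isub (hvi j) (hvi i))
      (LW.sub ((hBo i).inter (hBo j)) ((hv i).mono inter_subset_left) ((hv j).mono inter_subset_right))
  choose c hc using hc
  have hne : ∀ {p : EVec n → Prop} {U : Set (EVec n)}, IsOpen U → U.Nonempty → (∀ᵐ x, p x) → ∃ x ∈ U, p x := by
    intro p U hU hn hp
    by_contra hcon
    push Not at hcon
    exact (hU.measure_pos volume hn).ne' (measure_mono_null (fun x hx => hcon x hx) hp)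
  haveI : LocallyPathConnectedSpace O := hO.locallyPathConnectedSpace
  obtain ⟨t, ht⟩ := cocycle (X := O) (fun i => Subtype.val ⁻¹' B i) (fun i => (hBo i).preimage continuous_subtype_val)
    (fun i => by
      refine (convex_ball (i : EVec n) (r i)).isPreconnected.preimage_of_isOpenMap Subtype.val_injective hO.isOpenMap_subtype_val ?_
      rw [Subtype.range_coe]
      exact Metric.ball_subset_closedBall.trans ((Metric.closedBall_subset_closedBall (by linarith [hr0 i])).trans (hrO i)))
    (fun x => ⟨x, Metric.mem_ball_self (hr0 x)⟩) c
    (fun i x hx => by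
      obtain ⟨y, hy, h⟩ := hne (hBo i) ⟨x, hx⟩ (hc i i)
      rw [← h ⟨hy, hy⟩, sub_self])
    (fun i j k x hx => by
      obtain ⟨y, hy, h1, h2, h3⟩ := hne (((hBo i).inter (hBo j)).inter (hBo k)) ⟨x, hx⟩ ((hc i j).and ((hc j k).and (hc i k)))
      rw [← h1 ⟨hy.1.1, hy.1.2⟩, ← h2 ⟨hy.1.2, hy.2⟩, ← h3 ⟨hy.1.1, hy.2⟩]; ring)
  obtain ⟨S, hSc, hS⟩ := TopologicalSpace.isOpen_iUnion_countable B hBo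
  have hcov : ∀ y ∈ O, ∃ i ∈ S, y ∈ B i := by
    intro y hy
    have : y ∈ ⋃ i, B i := mem_iUnion.2 ⟨⟨y, hy⟩, Metric.mem_ball_self (hr0 _)⟩
    rw [← hS] at this
    simpa using this
  choose! ii hiS hiB using hcov
  haveI : Countable S := hSc
  have hall : ∀ᵐ y, ∀ i ∈ S, ∀ j ∈ S, y ∈ B i ∩ B j → v j y - v i y = c i j :=
    (ae_ball_iff hSc).2 fun i _ => (ae_ball_iff hSc).2 fun j _ => hc i j
  refine ⟨fun y => v (ii y) y + t (ii y), LW.of_local fun x hx => ⟨B (ii x), hBo _, hiB x hx, (hv (ii x)).congr (hBo _) (t (ii x)) ?_⟩⟩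
  filter_upwards [hall] with y hy hyB
  have hyO : y ∈ O := (Metric.ball_subset_closedBall.trans ((Metric.closedBall_subset_closedBall (by linarith [hr0 (ii x)])).trans (hrO (ii x)))) hyB
  have e1 := hy _ (hiS y hyO) _ (hiS x hx) ⟨hiB y hyO, hyB⟩
  have e2 := ht (ii y) (ii x) ⟨y, hyO⟩ ⟨hiB y hyO, hyB⟩
  linarith
end PH5
end MPH5

section MPI1
section PI1
variable {n : ℕ}

theorem lip_vol (n : ℕ) (K : NNReal) : ∃ C : ℝ≥0∞, C ≠ ∞ ∧ ∀ (g : EVec n → EVec n) (s : Set (EVec n)), LipschitzOnWith K g s → volume (g '' s) ≤ C * volume s := by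
  haveI : (Measure.hausdorffMeasure (n : ℝ) : Measure (EVec n)).IsAddHaarMeasure := by
    simpa using MeasureTheory.isAddHaarMeasure_hausdorffMeasure (E := EuclideanSpace ℝ (Fin n))
  have e := Measure.isAddLeftInvariant_eq_smul (volume : Measure (EVec n)) (Measure.hausdorffMeasure (n : ℝ))
  set c := (volume : Measure (EVec n)).addHaarScalarFactor (Measure.hausdorffMeasure (n : ℝ))
  refine ⟨(K : ℝ≥0∞) ^ (n:ℝ), by simp, fun g s hg => ?_⟩
  rw [e, Measure.smul_apply, Measure.smul_apply, ENNReal.smul_def, ENNReal.smul_def, smul_eq_mul, smul_eq_mul, mul_left_comm]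
  exact mul_le_mul_right (hg.hausdorffMeasure_image_le (by positivity)) _

theorem lip_null {K : NNReal} {g : EVec n → EVec n} (hg : LipschitzWith K g) {s : Set (EVec n)} (hs : volume s = 0) : volume (g '' s) = 0 := by
  obtain ⟨C, -, h⟩ := lip_vol n K
  have := h g s hg.lipschitzOnWith
  rw [hs, mul_zero] at this
  exact le_antisymm this zero_le

theorem area {K : NNReal} {h : EVec n → EVec n} (hh : LipschitzWith K h) : ∃ s0 : ℝ, 0 < s0 ∧ ∀ s : ℝ, 0 < s → s ≤ s0 →
    Function.Bijective (fun x => x - s • h x) ∧ ∀ B : Set (EVec n), MeasurableSet B →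
      ∫ x in B, ((1 : EVec n →L[ℝ] EVec n) - s • fderiv ℝ h x).det = (volume ((fun x => x - s • h x) '' B)).toReal := by
  have h1 : ∀ᶠ M : EVec n →L[ℝ] EVec n in 𝓝 1, 0 < M.det := by
    have : Tendsto (fun M : EVec n →L[ℝ] EVec n => M.det) (𝓝 1) (𝓝 1) := by
      have := (ContinuousLinearMap.continuous_det (E := EVec n) (𝕜 := ℝ)).tendsto 1
      convert this using 2
      exact LinearMap.det_id.symm
    exact this.eventually_const_lt one_pos
  obtain ⟨δ, hδ, hd⟩ := Metric.eventually_nhds_iff.1 h1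
  refine ⟨min (δ / 2) (1 / 2) / (K + 1), by positivity, fun s hs hss => ?_⟩
  have hK1 : (0:ℝ) < K + 1 := by positivity
  rw [le_div_iff₀ hK1] at hss
  have hsK : s * K ≤ min (δ / 2) (1 / 2) := le_trans (by nlinarith) hss
  have hsK1 := hsK.trans (min_le_left _ _)
  have hsK2 := hsK.trans (min_le_right _ _)
  have happ : ApproximatesLinearOn (fun x => x - s • h x) ((ContinuousLinearEquiv.refl ℝ (EVec n) : EVec n ≃L[ℝ] EVec n) : EVec n →L[ℝ] EVec n) univ (1 / 2 : NNReal) := by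
    intro x _ y _
    have : x - s • h x - (y - s • h y) - (x - y) = - (s • (h x - h y)) := by rw [smul_sub]; abel
    change ‖x - s • h x - (y - s • h y) - (x - y)‖ ≤ _
    rw [this, norm_neg, norm_smul, Real.norm_of_nonneg hs.le]
    have h2 := hh.norm_sub_le x y
    calc s * ‖h x - h y‖ ≤ s * (K * ‖x - y‖) := by gcongr
      _ = (s * K) * ‖x - y‖ := by ring
      _ ≤ (1 / 2) * ‖x - y‖ := by gcongr
      _ = _ := by simp
  have hbij : Function.Bijective (fun x => x - s • h x) := by
    refine (ApproximatesLinearOn.toHomeomorph _ happ ?_).bijective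
    rcases subsingleton_or_nontrivial (EVec n) with hsub | hnon
    · exact Or.inl hsub
    · right
      have : ‖((ContinuousLinearEquiv.refl ℝ (EVec n)).symm : EVec n →L[ℝ] EVec n)‖₊ = 1 := by
        have := ContinuousLinearMap.norm_id (𝕜 := ℝ) (E := EVec n)
        exact NNReal.eq this
      rw [this, inv_one]; exact NNReal.half_lt_self one_ne_zero
  refine ⟨hbij, fun B hB => ?_⟩
  have hDm : MeasurableSet {x | DifferentiableAt ℝ h x} := measurableSet_of_differentiableAt ℝ h
  have hae : ∀ᵐ x, DifferentiableAt ℝ h x := hh.ae_differentiableAt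
  set S := B ∩ {x | DifferentiableAt ℝ h x} with hS
  have hdiff : volume (B \ S) = 0 := measure_mono_null (fun x hx => fun hd => hx.2 ⟨hx.1, hd⟩) hae
  have hBS : (S : Set (EVec n)) =ᵐ[volume] B := by
    refine eventuallyLE_antisymm_iff.2 ⟨Eventually.of_forall fun x hx => hx.1, ?_⟩
    filter_upwards [hae] with x hx hxB using ⟨hxB, hx⟩
  have hLip : LipschitzWith (1 + ‖s‖₊ * K) (fun x => x - s • h x) := LipschitzWith.id.sub ((lipschitzWith_smul s).comp hh)
  have himg : volume ((fun x => x - s • h x) '' B) = volume ((fun x => x - s • h x) '' S) := by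
    refine le_antisymm ?_ (measure_mono (image_mono inter_subset_left))
    calc _ ≤ volume ((fun x => x - s • h x) '' S ∪ (fun x => x - s • h x) '' (B \ S)) := by
          refine measure_mono ?_
          rw [← image_union]; refine image_mono fun x hx => ?_
          by_cases hxS : x ∈ S
          · exact Or.inl hxS
          · exact Or.inr ⟨hx, hxS⟩
      _ ≤ _ := (measure_union_le _ _).trans (by rw [lip_null hLip hdiff, add_zero])
  have hpos : ∀ x, 0 < ((1 : EVec n →L[ℝ] EVec n) - s • fderiv ℝ h x).det := by
    intro x
    refine hd ?_
    rw [dist_eq_norm, sub_sub_cancel_left, norm_neg, norm_smul, Real.norm_of_nonneg hs.le]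
    have := norm_fderiv_le_of_lipschitz ℝ hh (x₀ := x)
    calc s * ‖fderiv ℝ h x‖ ≤ s * K := by gcongr
      _ < δ := by linarith
  have hfd : ∀ x ∈ S, HasFDerivWithinAt (fun x => x - s • h x) ((1 : EVec n →L[ℝ] EVec n) - s • fderiv ℝ h x) S x :=
    fun x hx => (((hasFDerivAt_id x).sub (hx.2.hasFDerivAt.const_smul s)).hasFDerivWithinAt)
  rw [himg, ← lintegral_abs_det_fderiv_eq_addHaar_image volume (hB.inter hDm) hfd hbij.1.injOn,
    ← setIntegral_congr_set hBS, integral_eq_lintegral_of_nonneg_ae (ae_of_all _ fun x => (hpos x).le)]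
  · congr 1; refine lintegral_congr fun x => ?_
    rw [abs_of_pos (hpos x)]
  · exact (ContinuousLinearMap.continuous_det.measurable.comp (measurable_const.sub ((measurable_fderiv ℝ h).const_smul s))).aestronglyMeasurable

theorem interp : ∀ {m : ℕ} (v : Fin (m + 1) → ℝ), n ≤ m → Function.Injective v → ∃ c : Fin (m + 1) → ℝ, ∀ A : EVec n →L[ℝ] EVec n,
    (-A).det = ∑ l, c l * (v l • (1 : EVec n →L[ℝ] EVec n) - A).det := by
  intro m v hm hv
  refine ⟨fun l => (Lagrange.basis Finset.univ v l).eval 0, fun A => ?_⟩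
  have hch : ∀ t : ℝ, (t • (1 : EVec n →L[ℝ] EVec n) - A).det = (LinearMap.charpoly (A : EVec n →ₗ[ℝ] EVec n)).eval t := by
    intro t
    rw [LinearMap.eval_charpoly]
    congr 1
  have h2 := Lagrange.eq_interpolate (s := Finset.univ) (v := v) (f := LinearMap.charpoly (A : EVec n →ₗ[ℝ] EVec n)) hv.injOn (by
    rw [Polynomial.degree_eq_natDegree (LinearMap.charpoly_monic _).ne_zero, LinearMap.charpoly_natDegree]
    simp only [finrank_euclideanSpace, Fintype.card_fin, Finset.card_univ]
    exact_mod_cast Nat.lt_succ_of_le hm)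
  have e0 : (0:ℝ) • (1 : EVec n →L[ℝ] EVec n) - A = -A := by ext; simp
  rw [← e0, hch, h2, Lagrange.interpolate_apply, Polynomial.eval_finsetSum]
  refine Finset.sum_congr rfl fun l _ => ?_
  rw [hch, Polynomial.eval_mul, Polynomial.eval_C, mul_comm]

theorem claimA {K : NNReal} {h1 h2 : EVec n → EVec n} (hh1 : LipschitzWith K h1) (hh2 : LipschitzWith K h2) {B : Set (EVec n)} (hB : MeasurableSet B)
    (hBf : volume B ≠ ∞) (he : ∀ x ∉ B, h1 x = h2 x) : ∫ x in B, (-fderiv ℝ h1 x).det = ∫ x in B, (-fderiv ℝ h2 x).det := by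
  obtain ⟨s1, hs1, H1⟩ := area hh1
  obtain ⟨s2, hs2, H2⟩ := area hh2
  set s0 := min s1 s2 with hs0d
  have hs0 : 0 < s0 := lt_min hs1 hs2
  have hi : ∀ {h : EVec n → EVec n}, LipschitzWith K h → ∀ t : ℝ, IntegrableOn (fun x => (t • (1 : EVec n →L[ℝ] EVec n) - fderiv ℝ h x).det) B := by
    intro h hh t
    obtain ⟨C, hC⟩ := (isCompact_closedBall (0 : EVec n →L[ℝ] EVec n) K).exists_bound_of_continuousOn
      (f := fun A => (t • (1 : EVec n →L[ℝ] EVec n) - A).det) (ContinuousLinearMap.continuous_det.comp (continuous_const.sub continuous_id)).continuousOn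
    refine IntegrableOn.of_bound hBf.lt_top ?_ C (ae_of_all _ fun x => hC _ ?_)
    · exact (ContinuousLinearMap.continuous_det.measurable.comp (measurable_const.sub (measurable_fderiv ℝ h))).aestronglyMeasurable
    · rw [mem_closedBall_zero_iff]; exact norm_fderiv_le_of_lipschitz ℝ hh
  have hlam : ∀ t : ℝ, 1 / s0 ≤ t → ∫ x in B, (t • (1 : EVec n →L[ℝ] EVec n) - fderiv ℝ h1 x).det = ∫ x in B, (t • (1 : EVec n →L[ℝ] EVec n) - fderiv ℝ h2 x).det := by
    intro t ht
    have ht0 : 0 < t := lt_of_lt_of_le (by positivity) ht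
    have hts : t⁻¹ ≤ s0 := by rw [inv_le_comm₀ ht0 hs0]; simpa using ht
    have e : ∀ A : EVec n →L[ℝ] EVec n, (t • (1 : EVec n →L[ℝ] EVec n) - A).det = t ^ n * (1 - t⁻¹ • A).det := by
      intro A
      have : t • (1 : EVec n →L[ℝ] EVec n) - A = t • (1 - t⁻¹ • A) := by rw [smul_sub, smul_smul, mul_inv_cancel₀ ht0.ne', one_smul]
      rw [this, ContinuousLinearMap.det, ContinuousLinearMap.coe_smul, LinearMap.det_smul]; simp [ContinuousLinearMap.det]
    obtain ⟨b1, i1⟩ := H1 t⁻¹ (by positivity) (hts.trans (min_le_left _ _))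
    obtain ⟨b2, i2⟩ := H2 t⁻¹ (by positivity) (hts.trans (min_le_right _ _))
    simp_rw [e, integral_const_mul]
    rw [i1 B hB, i2 B hB]
    congr 3
    refine compl_injective ?_
    rw [← image_compl_eq b1, ← image_compl_eq b2]
    refine image_congr fun x hx => ?_
    rw [he x hx]
  obtain ⟨c, hc⟩ := interp (n := n) (m := n) (fun l => 1 / s0 + (l : ℝ)) le_rfl (fun a b hab => by
    simpa [Fin.ext_iff] using hab)
  simp_rw [hc]
  rw [integral_finsetSum _ fun l _ => (hi hh1 _).const_mul _, integral_finsetSum _ fun l _ => (hi hh2 _).const_mul _]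
  refine Finset.sum_congr rfl fun l _ => ?_
  rw [integral_const_mul, integral_const_mul, hlam _ (by simp)]
end PI1
end MPI1

section MPI2
section PI2
variable {n : ℕ}

noncomputable def pm (m : ℝ) (x : EVec n) : EVec n := (max m ‖x‖)⁻¹ • x

theorem pm_norm {m : ℝ} (hm : 0 < m) (x : EVec n) : ‖pm m x‖ ≤ 1 := by
  have h0 : 0 < max m ‖x‖ := lt_max_of_lt_left hm
  rw [pm, norm_smul, norm_inv, Real.norm_of_nonneg h0.le, inv_mul_le_iff₀ h0, mul_one]
  exact le_max_right _ _

theorem pm_norm_eq {m : ℝ} (hm : 0 < m) {x : EVec n} (hx : m ≤ ‖x‖) : ‖pm m x‖ = 1 := by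
  rw [pm, max_eq_right hx, norm_smul, norm_inv, norm_norm, inv_mul_cancel₀ (hm.trans_le hx).ne']

theorem pm_lip {m : ℝ} (hm : 0 < m) : LipschitzWith (Real.toNNReal (2 / m)) (pm m : EVec n → EVec n) := by
  refine LipschitzWith.of_dist_le_mul fun x y => ?_
  rw [Real.coe_toNNReal _ (by positivity), dist_eq_norm, dist_eq_norm]
  have hx : 0 < max m ‖x‖ := lt_max_of_lt_left hm
  have hy : 0 < max m ‖y‖ := lt_max_of_lt_left hm
  have e : pm m x - pm m y = (max m ‖x‖)⁻¹ • (x - y) + ((max m ‖y‖ - max m ‖x‖) * (max m ‖x‖)⁻¹) • pm m y := by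
    simp only [pm]
    rw [smul_smul, smul_sub, sub_mul, sub_mul, sub_smul, mul_inv_cancel₀ hx.ne', one_mul, mul_right_comm, mul_inv_cancel₀ hy.ne', one_mul]
    abel
  have h1 : |max m ‖y‖ - max m ‖x‖| ≤ ‖x - y‖ := by
    refine (abs_max_sub_max_le_max m ‖y‖ m ‖x‖).trans ?_
    rw [sub_self, abs_zero, max_eq_right (abs_nonneg _), norm_sub_rev]
    exact abs_norm_sub_norm_le _ _
  have h2 : (max m ‖x‖)⁻¹ ≤ m⁻¹ := inv_anti₀ hm (le_max_left _ _)
  rw [e]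
  refine (norm_add_le _ _).trans ?_
  rw [norm_smul, norm_smul, norm_mul, norm_inv, Real.norm_of_nonneg hx.le, Real.norm_eq_abs]
  calc _ ≤ m⁻¹ * ‖x - y‖ + (‖x - y‖ * m⁻¹) * 1 := by
        gcongr
        exact pm_norm hm y
    _ = _ := by ring

def IsLip {V : Type*} [PseudoEMetricSpace V] (f : EVec n → V) : Prop := ∃ K, LipschitzWith K f

theorem IsLip.smul {a : EVec n → ℝ} {b : EVec n → EVec n} (ha : IsLip a) (hb : IsLip b) {A B : ℝ} (hA : ∀ x, |a x| ≤ A) (hB : ∀ x, ‖b x‖ ≤ B) :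
    IsLip fun x => a x • b x := by
  obtain ⟨Ka, ha⟩ := ha
  obtain ⟨Kb, hb⟩ := hb
  have hA0 := (abs_nonneg _).trans (hA 0)
  have hB0 := (norm_nonneg _).trans (hB 0)
  refine ⟨Real.toNNReal (A * Kb + B * Ka), LipschitzWith.of_dist_le_mul fun x y => ?_⟩
  rw [Real.coe_toNNReal _ (by positivity), dist_eq_norm]
  have e : a x • b x - a y • b y = a x • (b x - b y) + (a x - a y) • b y := by rw [smul_sub, sub_smul]; abel
  have h1 := ha.dist_le_mul x y
  have h2 := hb.dist_le_mul x y
  rw [dist_eq_norm] at h1 h2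
  rw [e]
  refine (norm_add_le _ _).trans ?_
  rw [norm_smul, norm_smul, Real.norm_eq_abs]
  calc _ ≤ A * (Kb * dist x y) + (Ka * dist x y) * B := by
        gcongr
        · exact hA x
        · exact hB y
    _ = _ := by ring

theorem IsLip.add {V : Type*} [SeminormedAddCommGroup V] {a b : EVec n → V} (ha : IsLip a) (hb : IsLip b) : IsLip fun x => a x + b x :=
  let ⟨_, ha⟩ := ha; let ⟨_, hb⟩ := hb; ⟨_, ha.add hb⟩
theorem IsLip.sub {V : Type*} [SeminormedAddCommGroup V] {a b : EVec n → V} (ha : IsLip a) (hb : IsLip b) : IsLip fun x => a x - b x :=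
  let ⟨_, ha⟩ := ha; let ⟨_, hb⟩ := hb; ⟨_, ha.sub hb⟩
theorem IsLip.comp {V : Type*} [PseudoEMetricSpace V] {a : EVec n → V} {b : EVec n → EVec n} (ha : IsLip a) (hb : IsLip b) : IsLip fun x => a (b x) :=
  let ⟨_, ha⟩ := ha; let ⟨_, hb⟩ := hb; ⟨_, ha.comp hb⟩
theorem IsLip.nrm {a : EVec n → EVec n} (ha : IsLip a) : IsLip fun x => ‖a x‖ := let ⟨_, ha⟩ := ha; ⟨_, lipschitzWith_one_norm.comp ha⟩
theorem IsLip.cst {V : Type*} [PseudoEMetricSpace V] (c : V) : IsLip fun _ : EVec n => c := ⟨0, LipschitzWith.const c⟩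
theorem IsLip.idd : IsLip fun x : EVec n => x := ⟨1, LipschitzWith.id⟩
theorem IsLip.cont {V : Type*} [PseudoEMetricSpace V] {a : EVec n → V} (ha : IsLip a) : Continuous a := let ⟨_, ha⟩ := ha; ha.continuous

theorem no_retract {g : EVec n → EVec n} (hg : IsLip g) (hgp : ∀ x, g x = g (pm 1 x)) (h1 : ∀ x, 1 ≤ ‖x‖ → g x = pm 1 x) : ∃ x, ‖x‖ ≤ 1 ∧ g x = 0 := by
  by_contra hcon
  push Not at hcon
  obtain ⟨z, hz, hzm⟩ := (isCompact_closedBall (0 : EVec n) 1).exists_isMinOn ⟨0, by simp⟩ hg.cont.norm.continuousOn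
  have hz0 : 0 < ‖g z‖ := norm_pos_iff.2 (hcon z (mem_closedBall_zero_iff.1 hz))
  set m := min ‖g z‖ 1
  have hm : 0 < m := lt_min hz0 one_pos
  have hgm : ∀ x, m ≤ ‖g x‖ := by
    intro x
    rw [hgp]
    exact (min_le_left _ _).trans (hzm (mem_closedBall_zero_iff.2 (pm_norm one_pos x)))
  obtain ⟨K1, hl1⟩ : IsLip fun x => pm m (g x) := IsLip.comp ⟨_, pm_lip hm⟩ hg
  have hl2 := pm_lip (n := n) one_pos
  have := claimA (K := max K1 (Real.toNNReal (2 / 1))) (hl1.weaken (le_max_left _ _)) (hl2.weaken (le_max_right _ _)) (B := Metric.ball 0 1)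
    measurableSet_ball measure_ball_lt_top.ne (fun x hx => by
      have hx1 : 1 ≤ ‖x‖ := by simpa using hx
      have h2 := pm_norm_eq one_pos hx1
      rw [h1 x hx1]
      conv_lhs => rw [pm, h2, max_eq_right (min_le_right _ _), inv_one, one_smul])
  have e1 : ∫ x in Metric.ball (0 : EVec n) 1, (-fderiv ℝ (fun x => pm m (g x)) x).det = 0 := by
    refine integral_eq_zero_of_ae (ae_restrict_of_ae ?_)
    filter_upwards [hl1.ae_differentiableAt (μ := volume)] with x hx
    by_contra hne
    have hA := hx.hasFDerivAt
    set A := fderiv ℝ (fun x => pm m (g x)) x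
    have hs : HasFDerivAt (fun x => ‖pm m (g x)‖ ^ 2) (0 : EVec n →L[ℝ] ℝ) x := by
      have : (fun x => ‖pm m (g x)‖ ^ 2) = fun _ => 1 := by ext y; rw [pm_norm_eq hm (hgm y), one_pow]
      rw [this]; exact hasFDerivAt_const _ _
    have h3 := hs.unique hA.norm_sq
    obtain ⟨y, hy⟩ : ∃ y, A y = pm m (g x) := by
      have hu : IsUnit (LinearMap.det ((-A : EVec n →L[ℝ] EVec n) : EVec n →ₗ[ℝ] EVec n)) := isUnit_iff_ne_zero.2 hne
      have hsur := ((LinearMap.isUnit_iff_isUnit_det _).2 hu)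
      obtain ⟨y, hy⟩ := ((Module.End.isUnit_iff _).1 hsur).2 (pm m (g x))
      exact ⟨-y, by rw [map_neg]; exact hy⟩
    have h4 := congrArg (fun l : EVec n →L[ℝ] ℝ => l y) h3
    simp [hy, pm_norm_eq hm (hgm x)] at h4
  have e2 : ∫ x in Metric.ball (0 : EVec n) 1, (-fderiv ℝ (pm 1) x).det = ∫ x in Metric.ball (0 : EVec n) 1, (-1 : EVec n →L[ℝ] EVec n).det := by
    refine setIntegral_congr_fun measurableSet_ball fun x hx => ?_
    have : fderiv ℝ (pm 1) x = (1 : EVec n →L[ℝ] EVec n) := by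
      have h2 : (pm 1 : EVec n → EVec n) =ᶠ[𝓝 x] id := by
        filter_upwards [Metric.isOpen_ball.mem_nhds hx] with y hy
        rw [pm, max_eq_left (by simpa using (mem_ball_zero_iff.1 hy).le), inv_one, one_smul, id]
      rw [h2.fderiv_eq, fderiv_id]; rfl
    simp only [this]
  rw [e1, e2, setIntegral_const, smul_eq_mul] at this
  have h5 : 0 < volume.real (Metric.ball (0 : EVec n) 1) := ENNReal.toReal_pos (Metric.measure_ball_pos volume _ one_pos).ne' measure_ball_lt_top.ne
  have h6 : (-1 : EVec n →L[ℝ] EVec n).det ≠ 0 := by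
    have : IsUnit (LinearMap.det ((-1 : EVec n →L[ℝ] EVec n) : EVec n →ₗ[ℝ] EVec n)) := by
      refine (LinearMap.isUnit_iff_isUnit_det _).1 ?_
      rw [ContinuousLinearMap.coe_neg]
      exact (isUnit_one).neg
    exact this.ne_zero
  exact (mul_ne_zero h5.ne' h6) this.symm

theorem invdom {K : NNReal} {h G : EVec n → EVec n} (hh : LipschitzWith K h) (hG : LipschitzWith K G)
    (hGh : ∀ x, ‖x‖ ≤ 1 → G (h x) = x) : h '' Metric.closedBall 0 1 ∈ 𝓝 (h 0) := by
  by_contra hcon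
  set ε : ℝ := 1 / (4 * (K + 1)) with hεd
  have hε : 0 < ε := by positivity
  have hKε : K * ε ≤ 1 / 4 := by
    rw [hεd, mul_one_div, div_le_iff₀ (by positivity)]; nlinarith [K.coe_nonneg]
  obtain ⟨c, hc, hcn⟩ : ∃ c ∈ Metric.ball (h 0) ε, c ∉ h '' Metric.closedBall 0 1 :=
    not_subset.1 fun hs => hcon (mem_of_superset (Metric.ball_mem_nhds _ hε) hs)
  rw [mem_ball_iff_norm'] at hc
  obtain ⟨z, hz, hzm⟩ := (isCompact_closedBall (0 : EVec n) 1).exists_isMinOn ⟨0, by simp⟩ (hh.continuous.sub continuous_const : Continuous fun x => h x - c).norm.continuousOn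
  set μ := ‖h z - c‖
  have hμ : 0 < μ := norm_pos_iff.2 (sub_ne_zero.2 fun he => hcn ⟨z, hz, he⟩)
  have hμm : ∀ x, ‖x‖ ≤ 1 → μ ≤ ‖h x - c‖ := fun x hx => hzm (mem_closedBall_zero_iff.2 hx)
  let Φ : EVec n → EVec n := fun y => y + max (ε - ‖y - c‖) 0 • pm μ (y - c)
  have hmx : ∀ y : EVec n, |max (ε - ‖y - c‖) 0| ≤ ε := fun y => by
    rw [abs_of_nonneg (le_max_right _ _)]; exact max_le (by linarith [norm_nonneg (y - c)]) hε.le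
  have hyc : IsLip fun y : EVec n => y - c := IsLip.idd.sub (IsLip.cst c)
  have hΦl : IsLip Φ := by
    refine IsLip.idd.add (IsLip.smul (A := ε) (B := 1) ?_ (IsLip.comp ⟨_, pm_lip hμ⟩ hyc) hmx fun y => pm_norm hμ _)
    obtain ⟨K', h'⟩ := (IsLip.cst ε).sub hyc.nrm
    exact ⟨_, h'.max_const 0⟩
  have hΦd : ∀ y, ‖Φ y - y‖ ≤ ε := by
    intro y
    simp only [Φ, add_sub_cancel_left, norm_smul, Real.norm_eq_abs]
    nlinarith [hmx y, pm_norm hμ (y - c), abs_nonneg (max (ε - ‖y - c‖) 0), norm_nonneg (pm μ (y - c))]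
  have hΦ1 : ∀ y, ε ≤ ‖y - c‖ → Φ y = y := fun y hy => by
    simp only [Φ]; rw [max_eq_right (by linarith), zero_smul, add_zero]
  have hΦ2 : ∀ y, ‖y - c‖ < ε → μ ≤ ‖y - c‖ → Φ y ∈ Metric.sphere c ε := by
    intro y hy hy2
    have hp : 0 < ‖y - c‖ := hμ.trans_le hy2
    have : Φ y - c = (ε * ‖y - c‖⁻¹) • (y - c) := by
      simp only [Φ, pm]
      rw [max_eq_left (by linarith), max_eq_right hy2, smul_smul, sub_mul, mul_inv_cancel₀ hp.ne', sub_smul, one_smul]; abel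
    rw [mem_sphere_iff_norm, this, norm_smul, norm_mul, norm_inv, norm_norm, Real.norm_of_nonneg hε.le, mul_assoc, inv_mul_cancel₀ hp.ne', mul_one]
  set d := (ε - ‖h 0 - c‖) / (K + 1)
  have hd : 0 < d := div_pos (by linarith) (by positivity)
  have hdx : ∀ x, ε ≤ ‖h x - c‖ → d ≤ ‖x‖ := by
    intro x hx
    have h2 := hh.norm_sub_le x 0
    rw [sub_zero] at h2
    have h3 : ‖h x - c‖ ≤ ‖h x - h 0‖ + ‖h 0 - c‖ := norm_sub_le_norm_sub_add_norm_sub _ _ _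
    rw [div_le_iff₀ (by positivity)]
    nlinarith [norm_nonneg x]
  have hnull : volume (G '' Metric.sphere c ε) = 0 := lip_null hG (Measure.addHaar_sphere_of_ne_zero _ _ hε.ne')
  obtain ⟨v, hv, hvn⟩ : ∃ v ∈ Metric.ball (0 : EVec n) (min d (1/4)), v ∉ G '' Metric.sphere c ε :=
    not_subset.1 fun hs => (Metric.measure_ball_pos volume (0 : EVec n) (lt_min hd (by norm_num : (0:ℝ) < 1/4))).ne' (measure_mono_null hs hnull)
  rw [mem_ball_zero_iff, lt_min_iff] at hv
  let w : EVec n → EVec n := fun x => G (Φ (h x)) - v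
  have hwl : IsLip w := ((IsLip.comp ⟨_, hG⟩ (hΦl.comp ⟨_, hh⟩))).sub (IsLip.cst v)
  have hw0 : ∀ x, ‖x‖ ≤ 1 → w x ≠ 0 := by
    intro x hx he
    have he' : G (Φ (h x)) = v := sub_eq_zero.1 he
    by_cases hc2 : ‖h x - c‖ < ε
    · exact hvn ⟨_, hΦ2 _ hc2 (hμm x hx), he'⟩
    · push Not at hc2
      rw [hΦ1 _ hc2, hGh x hx] at he'
      have := hdx x hc2
      rw [he'] at this; linarith
  have hwd : ∀ x, ‖x‖ ≤ 1 → ‖w x - x‖ ≤ 1 / 2 := by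
    intro x hx
    have h2 := hG.norm_sub_le (Φ (h x)) (h x)
    rw [hGh x hx] at h2
    have h3 : (K : ℝ) * ‖Φ (h x) - h x‖ ≤ K * ε := mul_le_mul_of_nonneg_left (hΦd _) K.coe_nonneg
    have h4 : ‖w x - x‖ ≤ ‖G (Φ (h x)) - x‖ + ‖v‖ := by
      have : w x - x = (G (Φ (h x)) - x) - v := by simp only [w]; abel
      rw [this]; exact norm_sub_le _ _
    linarith
  have hpl : IsLip (pm 1 : EVec n → EVec n) := ⟨_, pm_lip one_pos⟩
  let η : EVec n → ℝ := fun x => min (2 - (‖pm 1 x‖ + ‖pm 1 x‖)) 1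
  have hp1 := pm_norm (n := n) one_pos
  have hη0 : ∀ x, 0 ≤ η x := fun x => le_min (by linarith [hp1 x]) zero_le_one
  have hpp : ∀ x : EVec n, pm 1 (pm 1 x) = pm 1 x := fun x => by
    conv_lhs => rw [pm, max_eq_left (hp1 x), inv_one, one_smul]
  let g : EVec n → EVec n := fun x => pm 1 x + η x • (w (pm 1 x) - pm 1 x)
  obtain ⟨x, hx, hgx⟩ := no_retract (g := g)
    (by
      refine hpl.add (IsLip.smul (A := 1) (B := 1/2) ?_ ((hwl.comp hpl).sub hpl) (fun x => ?_) fun x => hwd _ (hp1 x))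
      · obtain ⟨K', h'⟩ := (IsLip.cst (2:ℝ)).sub (hpl.nrm.add hpl.nrm)
        exact ⟨_, h'.min_const 1⟩
      · rw [abs_of_nonneg (hη0 x)]; exact min_le_right _ _)
    (fun x => by simp only [g, η, hpp])
    (fun x hx => by
      have : η x = 0 := by simp only [η]; rw [pm_norm_eq one_pos hx]; norm_num
      simp only [g, this, zero_smul, add_zero])
  simp only [g] at hgx
  by_cases hc3 : ‖pm 1 x‖ ≤ 1 / 2
  · have : η x = 1 := min_eq_right (by linarith)
    rw [this, one_smul, add_sub_cancel] at hgx
    exact hw0 _ (hp1 x) hgx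
  · push Not at hc3
    have h2 : η x ≤ 2 - (‖pm 1 x‖ + ‖pm 1 x‖) := min_le_left _ _
    have h3 : ‖pm 1 x‖ = ‖η x • (w (pm 1 x) - pm 1 x)‖ := by have := congrArg norm (eq_neg_of_add_eq_zero_left hgx); rwa [norm_neg] at this
    rw [norm_smul, Real.norm_of_nonneg (hη0 x)] at h3
    nlinarith [hη0 x, hwd _ (hp1 x)]

theorem inv_dom {U : Set (EVec n)} (hU : IsOpen U) {h hinv : EVec n → EVec n} {K : NNReal} (hh : LipschitzOnWith K h U)
    (hi : LipschitzOnWith K hinv (h '' U)) (he : ∀ y ∈ U, hinv (h y) = y) {x0 : EVec n} (hx0 : x0 ∈ U) : h '' U ∈ 𝓝 (h x0) := by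
  obtain ⟨H, hH, hHe⟩ := hh.extend_finite_dimension
  obtain ⟨G, hG, hGe⟩ := hi.extend_finite_dimension
  obtain ⟨ε, h0, hε⟩ := Metric.isOpen_iff.1 hU x0 hx0
  set r := ε / 2
  have hr : 0 < r := by positivity
  have hxU : ∀ x : EVec n, ‖x‖ ≤ 1 → x0 + r • x ∈ U := by
    intro x hx
    refine hε ?_
    rw [mem_ball_iff_norm, add_sub_cancel_left, norm_smul, Real.norm_of_nonneg hr.le]
    simp only [r]; nlinarith
  obtain ⟨K1, h1⟩ : IsLip fun x : EVec n => H (x0 + r • x) := IsLip.comp ⟨_, hH⟩ ((IsLip.cst x0).add ⟨_, lipschitzWith_smul r⟩)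
  obtain ⟨K2, h2⟩ : IsLip fun y : EVec n => r⁻¹ • (G y - x0) := IsLip.comp (a := fun y => r⁻¹ • y) ⟨_, lipschitzWith_smul r⁻¹⟩ (IsLip.sub ⟨_, hG⟩ (IsLip.cst x0))
  have := invdom (h1.weaken (le_max_left K1 K2)) (h2.weaken (le_max_right K1 K2)) (fun x hx => by
    have hm := hxU x hx
    rw [← hHe hm, ← hGe ⟨_, hm, rfl⟩, he _ hm, add_sub_cancel_left, smul_smul, inv_mul_cancel₀ hr.ne', one_smul])
  rw [smul_zero, add_zero, ← hHe hx0] at this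
  refine mem_of_superset this ?_
  rintro _ ⟨x, hx, rfl⟩
  have hm := hxU x (mem_closedBall_zero_iff.1 hx)
  exact ⟨_, hm, hHe hm⟩
end PI2
end MPI2

section MPJ1
section PJ1
variable {n : ℕ}

theorem lint_mol_le {f : EVec n → ℝ} (hf : Integrable f) (k : ℕ) : ∫⁻ x, ‖mol k f x‖ₑ ≤ ∫⁻ x, ‖f x‖ₑ := by
  have h := mol_L1 hf k
  rw [← ofReal_integral_norm_eq_lintegral_enorm (mol_int hf k), ← ofReal_integral_norm_eq_lintegral_enorm hf]
  exact ENNReal.ofReal_le_ofReal h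

theorem shift_bound {Ω : Set (EVec n)} (hΩ : IsOpen Ω) {v : EVec n → ℝ} {F : EVec n → Fin n → ℝ} (h : LW Ω v F)
    (hF : ∀ i, Integrable fun x => F x i) {S : ℝ → EVec n → EVec n} (hSc : Continuous fun p : ℝ × EVec n => S p.1 p.2)
    {κ : NNReal} (hSl : ∀ x, LipschitzWith κ fun t => S t x) {C : ℝ≥0∞} (hC : C ≠ ∞) {R : ℝ} (hR : 0 ≤ R)
    {W : Set (EVec n)} (hW : MeasurableSet W) (hS0 : ∀ x ∈ W, S 0 x = x)
    (hvol : ∀ t ∈ Icc 0 R, ∀ A, MeasurableSet A → volume (W ∩ S t ⁻¹' A) ≤ C * volume A)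
    {K1 Kc : Set (EVec n)} (hK1c : IsCompact K1) (hK1s : K1 ⊆ Kc) (hKcc : IsCompact Kc) (hKcs : Kc ⊆ Ω)
    (hK1 : ∀ x ∈ W, S R x ∈ K1) (hKc : ∀ x ∈ W, ∀ t ∈ Icc 0 R, S t x ∈ Kc) :
    ∫⁻ x in W, ‖v x‖ₑ ≤ C * (∫⁻ x in K1, ‖v x‖ₑ) + κ * (ENNReal.ofReal R * (C * ∑ i, ∫⁻ x, ‖F x i‖ₑ)) := by
  have hpull : ∀ t ∈ Icc 0 R, ∀ g : EVec n → ℝ≥0∞, Measurable g → ∫⁻ x in W, g (S t x) ≤ C * ∫⁻ x, g x := by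
    intro t ht g hg
    have hSm : Measurable (S t) := (hSc.comp (by fun_prop : Continuous fun x : EVec n => (t, x))).measurable
    rw [← lintegral_map hg hSm, ← smul_eq_mul, ← lintegral_smul_measure]
    refine lintegral_mono' (Measure.le_iff.2 fun A hA => ?_) le_rfl
    rw [Measure.map_apply hSm hA, Measure.restrict_apply (hSm hA), inter_comm]
    exact hvol t ht A hA
  obtain ⟨δ, hδ, hδs⟩ := hKcc.exists_cthickening_subset_open hΩ hKcs
  set O := Metric.thickening δ Kc with hOd
  have hOo : IsOpen O := Metric.isOpen_thickening
  have hKcc' : IsCompact (Metric.cthickening δ Kc) := hKcc.cthickening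
  have hO' : O ⊆ Metric.cthickening δ Kc := Metric.thickening_subset_cthickening _ _
  have hKO : Kc ⊆ O := Metric.self_subset_thickening hδ _
  set w := (Metric.cthickening δ Kc).indicator v with hw
  have hwi : Integrable w := IntegrableOn.integrable_indicator (h.mu.integrableOn_compact_subset hδs hKcc') hKcc'.measurableSet
  have hwv : ∀ x ∈ Kc, w x = v x := fun x hx => indicator_of_mem (hO' (hKO hx)) _
  have hLw : LW O w F := (h.mono (hO'.trans hδs)).congr hOo 0 (ae_of_all _ fun x hx => by rw [add_zero]; exact indicator_of_mem (hO' hx) _)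
  obtain ⟨k0, hk0⟩ : ∃ k0 : ℕ, ∀ k ≥ k0, 1 / ((k:ℝ) + 1) ≤ δ / 2 := by
    have := (tendsto_one_div_add_atTop_nhds_zero_nat (𝕜 := ℝ)).eventually_le_const (half_pos hδ)
    exact eventually_atTop.1 this
  set M := κ * (ENNReal.ofReal R * (C * ∑ i, ∫⁻ x, ‖F x i‖ₑ)) with hM
  have hWK : W ⊆ Kc := fun x hx => by have := hKc x hx 0 ⟨le_rfl, hR⟩; rwa [hS0 x hx] at this
  have key : ∀ k ≥ k0, ∫⁻ x in W, ‖mol k w x‖ₑ ≤ C * (∫⁻ x in K1, ‖mol k w x‖ₑ) + M := by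
    intro k hk
    set ω : EVec n → EVec n →L[ℝ] ℝ := fun x => om fun i => mol k (fun y => F y i) x
    have hFc : ∀ i, Continuous (mol k fun y => F y i) := fun i => (mol_cd (hF i).locallyIntegrable k).continuous
    have hωc : Continuous ω := om_cont hFc
    have hwc := mol_cd hwi.locallyIntegrable k
    have hfd : ∀ x ∈ Kc, HasFDerivAt (mol k w) (ω x) x := by
      intro x hx
      have hd := (hwc.differentiable (by norm_num) x).hasFDerivAt
      rw [clm_om (fderiv ℝ (mol k w) x)] at hd
      have hb : Metric.closedBall x (1 / ((k:ℝ) + 1)) ⊆ O := by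
        intro y hy
        refine Metric.mem_thickening_iff.2 ⟨x, hx, ?_⟩
        have := hk0 k hk
        rw [Metric.mem_closedBall] at hy
        linarith
      simp_rw [hLw.mol_fd hwi.locallyIntegrable hb] at hd
      exact hd
    have hpt : ∀ x ∈ W, ‖mol k w x‖ₑ ≤ K1.indicator (fun y => ‖mol k w y‖ₑ) (S R x) + κ * ∫⁻ t in Icc 0 R, ∑ i, ‖mol k (fun y => F y i) (S t x)‖ₑ := by
      intro x hx
      have h1 := curve hωc (hSl x) hR (fun t ht => hfd _ (hKc x hx t ht))
      rw [hS0 x hx] at h1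
      rw [indicator_of_mem (hK1 x hx)]
      have h2 : ‖mol k w x‖ₑ ≤ ‖mol k w (S R x)‖ₑ + ‖mol k w (S R x) - mol k w x‖ₑ := by
        have := enorm_sub_le (E := ℝ) (a := mol k w (S R x)) (b := mol k w (S R x) - mol k w x)
        rwa [sub_sub_cancel] at this
      refine h2.trans (add_le_add le_rfl (h1.trans (mul_le_mul_right (lintegral_mono fun t => om_norm _) _)))
    have hm1 : Measurable fun x => K1.indicator (fun y => ‖mol k w y‖ₑ) x := hwc.continuous.enorm.measurable.indicator hK1c.measurableSet
    have hm2 : Measurable fun p : EVec n × ℝ => ∑ i, ‖mol k (fun y => F y i) (S p.2 p.1)‖ₑ := by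
      refine (continuous_finsetSum _ fun i _ => ((hFc i).comp ?_).enorm).measurable
      exact hSc.comp (by fun_prop : Continuous fun p : EVec n × ℝ => (p.2, p.1))
    have hSR : Measurable (S R) := (hSc.comp (by fun_prop : Continuous fun x : EVec n => (R, x))).measurable
    have hm3 : Measurable fun x => K1.indicator (fun y => ‖mol k w y‖ₑ) (S R x) := hm1.comp hSR
    calc ∫⁻ x in W, ‖mol k w x‖ₑ ≤ ∫⁻ x in W, (K1.indicator (fun y => ‖mol k w y‖ₑ) (S R x) + κ * ∫⁻ t in Icc 0 R, ∑ i, ‖mol k (fun y => F y i) (S t x)‖ₑ) :=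
          setLIntegral_mono' hW hpt
      _ = (∫⁻ x in W, K1.indicator (fun y => ‖mol k w y‖ₑ) (S R x)) + κ * ∫⁻ t in Icc 0 R, ∫⁻ x in W, ∑ i, ‖mol k (fun y => F y i) (S t x)‖ₑ := by
          rw [lintegral_add_left hm3, lintegral_const_mul' _ _ ENNReal.coe_ne_top, lintegral_lintegral_swap]
          exact hm2.aemeasurable
      _ ≤ C * (∫⁻ x in K1, ‖mol k w x‖ₑ) + M := by
          refine add_le_add ?_ (mul_le_mul_right ?_ _)
          · refine (hpull R ⟨hR, le_rfl⟩ _ hm1).trans_eq ?_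
            rw [lintegral_indicator hK1c.measurableSet]
          · refine (setLIntegral_mono' measurableSet_Icc (g := fun _ => C * ∑ i, ∫⁻ x, ‖F x i‖ₑ) fun t ht => ?_).trans_eq ?_
            · refine (hpull t ht (fun z => ∑ i, ‖mol k (fun y => F y i) z‖ₑ)
                (continuous_finsetSum _ fun i _ => (hFc i).enorm).measurable).trans (mul_le_mul_right ?_ _)
              rw [lintegral_finsetSum _ fun i _ => (hFc i).enorm.measurable]
              exact Finset.sum_le_sum fun i _ => lint_mol_le (hF i) k
            · rw [lintegral_const, Measure.restrict_apply_univ, Real.volume_Icc, sub_zero, mul_comm]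
  have key2 : ∀ k ≥ k0, ∫⁻ x in W, ‖v x‖ₑ ≤ (1 + C) * (∫⁻ x, ‖mol k w x - w x‖ₑ) + (C * (∫⁻ x in K1, ‖v x‖ₑ) + M) := by
    intro k hk
    have hmm : Measurable fun x => ‖mol k w x‖ₑ := (mol_cd hwi.locallyIntegrable k).continuous.enorm.measurable
    have e1 : ∫⁻ x in W, ‖v x‖ₑ = ∫⁻ x in W, ‖w x‖ₑ := setLIntegral_congr_fun hW fun x hx => by simp only [hwv x (hWK hx)]
    have e2 : ∫⁻ x in K1, ‖v x‖ₑ = ∫⁻ x in K1, ‖w x‖ₑ := setLIntegral_congr_fun hK1c.measurableSet fun x hx => by simp only [hwv x (hK1s hx)]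
    rw [e1, e2]
    set ε := ∫⁻ x, ‖mol k w x - w x‖ₑ
    have a1 : ∫⁻ x in W, ‖w x‖ₑ ≤ (∫⁻ x in W, ‖mol k w x‖ₑ) + ε := by
      calc _ ≤ ∫⁻ x in W, (‖mol k w x‖ₑ + ‖mol k w x - w x‖ₑ) := lintegral_mono fun x => by
              have := enorm_sub_le (E := ℝ) (a := mol k w x) (b := mol k w x - w x)
              rwa [sub_sub_cancel] at this
        _ ≤ _ := by rw [lintegral_add_left hmm]; exact add_le_add le_rfl (setLIntegral_le_lintegral _ _)
    have a2 : ∫⁻ x in K1, ‖mol k w x‖ₑ ≤ (∫⁻ x in K1, ‖w x‖ₑ) + ε := by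
      calc _ ≤ ∫⁻ x in K1, (‖w x‖ₑ + ‖mol k w x - w x‖ₑ) := lintegral_mono fun x => by
              have := enorm_add_le (w x) (mol k w x - w x)
              rwa [add_sub_cancel] at this
        _ ≤ _ := by rw [lintegral_add_left' hwi.1.enorm.restrict]; exact add_le_add le_rfl (setLIntegral_le_lintegral _ _)
    calc _ ≤ (∫⁻ x in W, ‖mol k w x‖ₑ) + ε := a1
      _ ≤ (C * (∫⁻ x in K1, ‖mol k w x‖ₑ) + M) + ε := add_le_add (key k hk) le_rfl
      _ ≤ (C * ((∫⁻ x in K1, ‖w x‖ₑ) + ε) + M) + ε := add_le_add (add_le_add (mul_le_mul_right a2 _) le_rfl) le_rfl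
      _ = _ := by ring
  have hlim : Tendsto (fun k => (1 + C) * (∫⁻ x, ‖mol k w x - w x‖ₑ) + (C * (∫⁻ x in K1, ‖v x‖ₑ) + M)) atTop
      (𝓝 ((1 + C) * 0 + (C * (∫⁻ x in K1, ‖v x‖ₑ) + M))) :=
    (ENNReal.Tendsto.const_mul (lint_mol hwi) (Or.inr (by simp [hC]))).add tendsto_const_nhds
  rw [mul_zero, zero_add] at hlim
  exact ge_of_tendsto hlim (eventually_atTop.2 ⟨k0, key2⟩)

end PJ1
end MPJ1

section MPJ2
section PJ2
variable {n : ℕ}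

theorem bdry_local {Ω : Set (EVec n)} (hΩ : IsOpen Ω) {v : EVec n → ℝ} {F : EVec n → Fin n → ℝ} (hv : LW Ω v F)
    (hF : ∀ i, Integrable fun x => F x i) {x0 : EVec n} {U : Set (EVec n)} {h hinv : EVec n → EVec n} {K : NNReal}
    {e : EVec n} (hen : ‖e‖ = 1) (hU : IsOpen U) (hxU : x0 ∈ U) (hh : LipschitzOnWith K h U)
    (hi : LipschitzOnWith K hinv (h '' U)) (he : ∀ y ∈ U, hinv (h y) = y)
    (hflat : h '' (U ∩ Ω) = (h '' U) ∩ {y : EVec n | 0 < ⟪e, y⟫}) :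
    ∃ V, IsOpen V ∧ x0 ∈ V ∧ ∫⁻ x in V ∩ Ω, ‖v x‖ₑ ≠ ∞ := by
  obtain ⟨H, hH, hHe⟩ := hh.extend_finite_dimension
  obtain ⟨G, hG, hGe⟩ := hi.extend_finite_dimension
  set KH := lipschitzExtensionConstant (EVec n) * K
  have hGH : ∀ x ∈ U, G (H x) = x := fun x hx => by rw [← hHe hx, ← hGe (mem_image_of_mem h hx), he x hx]
  have hpos : ∀ x ∈ U, x ∈ Ω → 0 < ⟪e, H x⟫ := by
    intro x hx hxo
    have : h x ∈ h '' (U ∩ Ω) := mem_image_of_mem h ⟨hx, hxo⟩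
    rw [hflat] at this
    rw [← hHe hx]; exact this.2
  have himg : ∀ z ∈ h '' U, 0 < ⟪e, z⟫ → G z ∈ U ∧ G z ∈ Ω ∧ H (G z) = z := by
    intro z hz hz0
    have : z ∈ h '' (U ∩ Ω) := by rw [hflat]; exact ⟨hz, hz0⟩
    obtain ⟨x, ⟨hx, hxo⟩, rfl⟩ := this
    rw [hHe hx, hGH x hx]; exact ⟨hx, hxo, rfl⟩
  obtain ⟨R', hR', hball⟩ := Metric.mem_nhds_iff.1 (inv_dom hU hh hi he hxU)
  set y0 := h x0
  obtain ⟨R, hR, hRR⟩ : ∃ R : ℝ, 0 < R ∧ 2 * R < R' := ⟨R' / 3, by positivity, by linarith⟩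
  have hHc : Continuous H := hH.continuous
  have hGc : Continuous G := hG.continuous
  set V := U ∩ H ⁻¹' Metric.ball y0 R with hV
  have hVo : IsOpen V := hU.inter (Metric.isOpen_ball.preimage hHc)
  set Z : ℝ → Set (EVec n) := fun τ => Metric.closedBall y0 (2 * R) ∩ {z | τ ≤ ⟪e, z⟫} with hZ
  have hZc : ∀ τ, IsCompact (G '' Z τ) := fun τ =>
    ((isCompact_closedBall y0 (2 * R)).inter_right (isClosed_le continuous_const (by fun_prop))).image hGc
  have hZU : ∀ τ, 0 < τ → ∀ z ∈ Z τ, G z ∈ U ∧ G z ∈ Ω ∧ H (G z) = z := fun τ hτ z hz =>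
    himg z (hball ((Metric.closedBall_subset_ball hRR) hz.1)) (hτ.trans_le hz.2)
  have hZΩ : ∀ τ, 0 < τ → G '' Z τ ⊆ Ω := by
    rintro τ hτ _ ⟨z, hz, rfl⟩; exact (hZU τ hτ z hz).2.1
  set W : ℝ → Set (EVec n) := fun τ => V ∩ Ω ∩ {x | τ < ⟪e, H x⟫} with hWd
  have hWZ : ∀ τ, ∀ x ∈ W τ, ∀ t ∈ Icc 0 R, H x + t • e ∈ Z τ ∧ (t = R → 0 < τ → H x + t • e ∈ Z R) := by
    intro τ x hx t ht
    have h1 : ⟪e, H x + t • e⟫ = ⟪e, H x⟫ + t := by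
      rw [inner_add_right, inner_smul_right, real_inner_self_eq_norm_sq, hen]; ring
    have h2 : H x + t • e ∈ Metric.closedBall y0 (2 * R) := by
      have h3 := hx.1.1.2
      rw [mem_preimage, mem_ball_iff_norm] at h3
      rw [mem_closedBall_iff_norm, add_sub_right_comm]
      have h4 := norm_add_le (H x - y0) (t • e)
      rw [norm_smul, hen, Real.norm_of_nonneg ht.1] at h4
      linarith [ht.2]
    have h5 : τ < ⟪e, H x⟫ := hx.2
    refine ⟨⟨h2, ?_⟩, fun h6 h7 => ⟨h2, ?_⟩⟩
    · rw [mem_setOf_eq, h1]; linarith [ht.1]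
    · rw [mem_setOf_eq, h1]; linarith
  obtain ⟨C, hC, hCv⟩ := lip_vol n (KH * KH)
  set M := C * (∫⁻ x in G '' Z R, ‖v x‖ₑ) + KH * (ENNReal.ofReal R * (C * ∑ i, ∫⁻ x, ‖F x i‖ₑ)) with hM
  have hMt : M ≠ ∞ := by
    have h1 : ∫⁻ x in G '' Z R, ‖v x‖ₑ ≠ ∞ := (hv.mu.integrableOn_compact_subset (hZΩ R hR) (hZc R)).2.ne
    have h2 : ∑ i, ∫⁻ x, ‖F x i‖ₑ ≠ ∞ := ENNReal.sum_ne_top.2 fun i _ => (hF i).2.ne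
    exact ENNReal.add_ne_top.2 ⟨ENNReal.mul_ne_top hC h1, ENNReal.mul_ne_top ENNReal.coe_ne_top
      (ENNReal.mul_ne_top ENNReal.ofReal_ne_top (ENNReal.mul_ne_top hC h2))⟩
  have hWo : ∀ τ, IsOpen (W τ) := fun τ => (hVo.inter hΩ).inter (isOpen_lt continuous_const (by fun_prop))
  have hWb : ∀ τ, 0 < τ → τ ≤ R → ∫⁻ x in W τ, ‖v x‖ₑ ≤ M := by
    intro τ hτ hτR
    refine shift_bound hΩ hv hF (S := fun t x => G (H x + t • e)) (by fun_prop) (κ := KH) (fun x => ?_) hC hR.le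
      (hWo τ).measurableSet (fun x hx => ?_) (fun t ht A hA => ?_) (hZc R)
      (image_mono fun z (hz : z ∈ Z R) => (⟨hz.1, hτR.trans hz.2⟩ : z ∈ Z τ)) (hZc τ) (hZΩ τ hτ)
      (fun x hx => mem_image_of_mem G ((hWZ τ x hx R ⟨hR.le, le_rfl⟩).2 rfl hτ))
      (fun x hx t ht => mem_image_of_mem G (hWZ τ x hx t ht).1)
    · refine LipschitzWith.of_dist_le_mul fun s t => (hG.dist_le_mul _ _).trans_eq ?_
      rw [dist_add_left, dist_eq_norm, ← sub_smul, norm_smul, hen, mul_one, Real.dist_eq, Real.norm_eq_abs]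
    · simp only [zero_smul, add_zero]; exact hGH x hx.1.1.1
    · have hT : LipschitzWith (KH * KH) fun y => G (H y - t • e) :=
        hG.comp (by simpa using hH.sub (LipschitzWith.const (t • e)))
      refine (measure_mono ?_).trans (hCv _ A hT.lipschitzOnWith)
      rintro x ⟨hx, hxA⟩
      refine ⟨_, hxA, ?_⟩
      simp only [(hZU τ hτ _ (hWZ τ x hx t ht).1).2.2, add_sub_cancel_right]
      exact hGH x hx.1.1.1
  refine ⟨V, hVo, ⟨hxU, ?_⟩, ne_top_of_le_ne_top hMt ?_⟩
  · rw [mem_preimage, ← hHe hxU]; exact Metric.mem_ball_self hR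
  have hun : V ∩ Ω = ⋃ m : ℕ, W (R / (m + 1)) := by
    ext x
    simp only [mem_iUnion, hWd]
    constructor
    · intro hx
      have hp := hpos x hx.1.1 hx.2
      obtain ⟨m, hm⟩ := exists_nat_gt (R / ⟪e, H x⟫)
      refine ⟨m, hx, ?_⟩
      rw [mem_setOf_eq, div_lt_iff₀ (by positivity)]
      rw [div_lt_iff₀ hp] at hm
      nlinarith
    · rintro ⟨m, hm⟩; exact hm.1
  have hmono : Monotone fun m : ℕ => W (R / (m + 1)) := by
    intro a b hab x hx
    have h9 : R / ((a:ℝ) + 1) < ⟪e, H x⟫ := hx.2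
    refine ⟨hx.1, ?_⟩
    rw [mem_setOf_eq]
    refine lt_of_le_of_lt ?_ h9
    have : (a:ℝ) ≤ b := by exact_mod_cast hab
    gcongr
  rw [hun, setLIntegral_iUnion_of_directed _ hmono.directed_le]
  refine iSup_le fun m => hWb _ (by positivity) (div_le_self hR.le (by have : (0:ℝ) ≤ m := m.cast_nonneg; linarith))

theorem v_int {Ω : Set (EVec n)} (hΩ : IsLipschitzDomain Ω) (hb : Bornology.IsBounded Ω) {v : EVec n → ℝ}
    {F : EVec n → Fin n → ℝ} (hv : LW Ω v F) (hF : ∀ i, Integrable fun x => F x i) : IntegrableOn v Ω := by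
  have hc : IsCompact (closure Ω) := hb.isCompact_closure
  have hfin : ∫⁻ x in closure Ω ∩ Ω, ‖v x‖ₑ ≠ ∞ := by
    refine hc.induction_on (p := fun s => ∫⁻ x in s ∩ Ω, ‖v x‖ₑ ≠ ∞) (by simp) (fun s t hst ht => ?_) (fun s t hs ht => ?_) (fun x hx => ?_)
    · exact ne_top_of_le_ne_top ht (lintegral_mono_set (inter_subset_inter_left _ hst))
    · rw [union_inter_distrib_right]
      exact ne_top_of_le_ne_top (ENNReal.add_ne_top.2 ⟨hs, ht⟩) (lintegral_union_le _ _ _)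
    · by_cases hxo : x ∈ Ω
      · obtain ⟨r, hr, hrs⟩ := Metric.nhds_basis_closedBall.mem_iff.1 (hΩ.1.mem_nhds hxo)
        refine ⟨_, mem_nhdsWithin_of_mem_nhds (Metric.closedBall_mem_nhds x hr), ?_⟩
        exact ne_top_of_le_ne_top (hv.mu.integrableOn_compact_subset hrs (isCompact_closedBall x r)).2.ne
          (lintegral_mono_set inter_subset_left)
      · obtain ⟨U, h, hinv, K, e, h1, h2, h3, h4, h5, h6, h7⟩ := hΩ.2.2.2 x ⟨hx, by rwa [hΩ.1.interior_eq]⟩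
        obtain ⟨V, hV, hxV, hVf⟩ := bdry_local hΩ.1 hv hF h1 h2 h3 h4 h5 h6 h7
        exact ⟨V, mem_nhdsWithin_of_mem_nhds (hV.mem_nhds hxV), hVf⟩
  rw [inter_eq_right.2 subset_closure] at hfin
  exact ⟨hv.mu.aestronglyMeasurable, hfin.lt_top⟩

end PJ2
end MPJ2

section MPK
section PK
variable {n N : ℕ}

theorem ind_int {Ω : Set (EVec n)} (hΩ : IsOpen Ω) (g φ : EVec n → ℝ) :
    ∫ x, Ω.indicator g x * φ x = ∫ x in Ω, g x * φ x := by
  rw [← integral_indicator hΩ.measurableSet]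
  refine integral_congr_ae (ae_of_all _ fun x => ?_)
  by_cases hx : x ∈ Ω <;> simp [hx]

theorem repr_main {Ω : Set (EVec n)} (hΩ : IsLipschitzDomain Ω) (hb : Bornology.IsBounded Ω)
    {E : EVec n → Fin N → Fin n → ℝ} (hE : IntegrableOn E Ω volume) (hC : CurlFreeOn Ω E) (hs : SimplyConnectedSpace Ω) :
    ∃ v : EVec n → Fin N → ℝ, HasWeakDerivOn Ω v E := by
  have hEi : ∀ a i, IntegrableOn (fun x => E x a i) Ω := fun a i => (hE.eval a).eval i
  set F : Fin N → EVec n → Fin n → ℝ := fun a x i => Ω.indicator (fun x => E x a i) x with hFd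
  have hF : ∀ a i, Integrable fun x => F a x i := fun a i => (hEi a i).integrable_indicator hΩ.1.measurableSet
  have hcr : ∀ a, Crl Ω (F a) := by
    intro a φ h1 h2 h3 i j
    have hb : ∀ i j, Integrable (fun x => E x a i * fderiv ℝ φ x (ev j)) (volume.restrict Ω) := by
      intro i j
      obtain ⟨B, hB⟩ := (fd_cs h2 j).exists_bound_of_continuous (cont_fd h1 _)
      exact (hEi a i).mul_bdd (c := B) (cont_fd h1 _).aestronglyMeasurable (ae_of_all _ hB)
    have := hC φ h1 h2 h3 a i j
    erw [integral_sub (hb i j) (hb j i)] at this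
    simp only [hFd]
    rw [ind_int hΩ.1, ind_int hΩ.1]
    linarith
  have hv : ∀ a, ∃ v, LW Ω v (F a) := fun a => glob_pot hΩ.1 (hF a) (hcr a)
  choose v hv using hv
  refine ⟨fun x a => v a x, Integrable.of_eval fun a => v_int hΩ hb (hv a) (hF a), hE, fun φ h1 h2 h3 a i => ?_⟩
  have h := (hv a).eq φ h1 h2 h3 i
  simp only [hFd] at h
  rw [ind_int hΩ.1] at h
  rw [← h]
  refine setIntegral_eq_integral_of_forall_compl_eq_zero fun x hx => ?_
  have : fderiv ℝ φ x = 0 := image_eq_zero_of_notMem_tsupport fun hx' => hx (h3 (tsupport_fderiv_subset ℝ hx'))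
  rw [this]; simp

end PK
end MPK

/-- **Section 3.3 (the limit of the gradients is a gradient).** The `ℒⁿ`-a.e. limit `E`
of (a subsequence of) the gradients `∇u_k` of the minimisers of the regularised
functionals is curl-free in the sense of distributions; if moreover `Ω` is simply
connected, then `E = ∇v` a.e. for some `v ∈ W^{1,1}(Ω;ℝ^N)`. -/
theorem limit_gradient_curlFree_and_representation
    {n N : ℕ} (Ω : Set (EVec n))
    (hΩ : IsLipschitzDomain Ω) (hΩbdd : Bornology.IsBounded Ω)
    (ν L : ℝ) (hν : 0 < ν) (hνL : ν ≤ L)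
    (f f' f'' : ℝ → ℝ)
    (hderiv : ∀ t ∈ Set.Ici (0:ℝ), HasDerivWithinAt f (f' t) (Set.Ici 0) t)
    (hderiv' : ∀ t ∈ Set.Ici (0:ℝ), HasDerivWithinAt f' (f'' t) (Set.Ici 0) t)
    (hf''cont : ContinuousOn f'' (Set.Ici 0))
    (hstrict : StrictConvexOn ℝ (Set.Ici 0) f)
    (hf0 : f 0 = 0) (hf'0 : f' 0 = 0)
    (hgrowth : ∀ t ∈ Set.Ici (0:ℝ), ν * t - L ≤ f t ∧ f t ≤ L * (t + 1))
    (hsec : ∀ t ∈ Set.Ici (0:ℝ), f'' t ≤ L * (1 + t)⁻¹)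
    (finf : ℝ) (hfinf : Filter.Tendsto (fun t => f t / t) Filter.atTop (nhds finf))
    (T₀ : EVec n → Fin N → Fin n → ℝ)
    (hT : MemW2inf Ω T₀)
    (hTsmall : linfNormOn Ω T₀ < ENNReal.ofReal finf)
    (u : ℕ → EVec n → Fin N → ℝ) (Du : ℕ → EVec n → Fin N → Fin n → ℝ)
    (hmem : ∀ k, 0 < k → MemW12 Ω (u k) (Du k))
    (hzero : ∀ k, 0 < k → ZeroMean Ω (u k))
    (hmin : ∀ k, 0 < k →
      ∀ (w : EVec n → Fin N → ℝ) (Dw : EVec n → Fin N → Fin n → ℝ),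
        MemW12 Ω w Dw → FFk Ω f T₀ k (Du k) ≤ FFk Ω f T₀ k Dw)
    (E : EVec n → Fin N → Fin n → ℝ)
    (hE : IntegrableOn E Ω volume)
    (φ : ℕ → ℕ) (hφ : StrictMono φ)
    (hlim : ∀ᵐ x ∂(volume.restrict Ω),
      Filter.Tendsto (fun l => Du (φ l) x) Filter.atTop (nhds (E x))) :
    CurlFreeOn Ω E ∧
    (SimplyConnectedSpace Ω → ∃ v : EVec n → Fin N → ℝ, HasWeakDerivOn Ω v E) := by
  have hL : 0 < L := hν.trans_le hνL
  have hC : CurlFreeOn Ω E := curlFree_main Ω hΩ.1 hΩbdd L hL f f' f'' hderiv hderiv' hf''cont hstrict hf0 hf'0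
    (fun t ht => (hgrowth t ht).2) hsec finf hfinf T₀ hT hTsmall u Du hmem hmin E hE φ hφ hlim
  exact ⟨hC, fun hs => repr_main hΩ hΩbdd hE hC hs⟩
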